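/- For every ε > 0, 0 < α ≤ ζ ≤ 1 and D, K ≥ 1 there is a constant C₀ = C₀(D) depending only on D such that the following holds for all sufficiently small δ > 0 (depending on D, K, ε). Let 𝓕 ⊆ C²(J) be a family of cinematic functions with cinematic constant K and doubling constant D, let E ⊆ [0,1]² be a (δ,α;δ^{−ε})₁×(δ,α;δ^{−ε})₁ quasi-product, and let F ⊆ 𝓕 be a finite set satisfying #(F ∩ B) ≤ δ^{−ε}(r/δ)^ζ for every ball B ⊂ C²(J) of radius r ≥ δ. Let J′ = (1/16)J be the concentric subinterval of J of one-sixteenth the length, and let E′ = E ∩ (J′×ℝ). Then ∫_{E′} (∑_{f∈F} 1_{f^δ})^{3/2} ≤ δ^{2−α/2−ζ/2−C₀ε} · #F, where f^δ = {(θ,y) ∈ J×ℝ : |f(θ)−y| ≤ δ}. -/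

import Mathlib

open Set MeasureTheory
open scoped ENNReal

/-- The `C²(J)` distance between two functions. -/
noncomputable def c2dist (J : Set ℝ) (f g : ℝ → ℝ) : ℝ :=
  sSup ((fun θ => |f θ - g θ| + |deriv f θ - deriv g θ| +
      |deriv (deriv f) θ - deriv (deriv g) θ|) '' J)

/-- A family of cinematic functions over `J` with cinematic constant `K`. -/
def CinematicFamily (J : Set ℝ) (K : ℝ) (𝓕 : Set (ℝ → ℝ)) : Prop :=
  (∀ f ∈ 𝓕, ContDiff ℝ 2 f) ∧
  (∀ f ∈ 𝓕, ∀ g ∈ 𝓕, c2dist J f g ≤ K) ∧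
  (∀ f ∈ 𝓕, ∀ g ∈ 𝓕, ∀ θ ∈ J, K⁻¹ * c2dist J f g ≤
      |f θ - g θ| + |deriv f θ - deriv g θ| + |deriv (deriv f) θ - deriv (deriv g) θ|)

/-- `𝓕` is doubling with constant `D` for the `C²(J)` metric. -/
def DoublingFamily (J : Set ℝ) (D : ℝ) (𝓕 : Set (ℝ → ℝ)) : Prop :=
  ∀ g ∈ 𝓕, ∀ r : ℝ, 0 < r → ∃ S : Finset (ℝ → ℝ), ↑S ⊆ 𝓕 ∧ (S.card : ℝ) ≤ D ∧
    ∀ f ∈ 𝓕, c2dist J f g ≤ 2 * r → ∃ h ∈ S, c2dist J f h ≤ r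

/-- A `(δ,α;C)₁`-set. -/
def IsDeltaSet (δ α C : ℝ) (A : Set ℝ) : Prop :=
  A ⊆ Set.Icc 0 1 ∧
  (∃ T : Set ℝ, A = ⋃ x ∈ T, Set.Icc x (x + δ)) ∧
  ∀ u v : ℝ, u ≤ v → Set.Icc u v ⊆ Set.Icc (0:ℝ) 1 →
    volume (A ∩ Set.Icc u v) ≤ ENNReal.ofReal (C * δ ^ (1 - α) * (v - u) ^ α)

/-- A `(δ,α;C)₁ × (δ,β;C)₁` quasi-product. -/
def IsQuasiProduct (δ α β C : ℝ) (E : Set (ℝ × ℝ)) : Prop :=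
  MeasurableSet E ∧
  ∃ (A : Set ℝ) (B : ℝ → Set ℝ), IsDeltaSet δ α C A ∧ (∀ a ∈ A, IsDeltaSet δ β C (B a)) ∧
    E = {p : ℝ × ℝ | p.1 ∈ A ∧ p.2 ∈ B p.1}

/-- `f^δ`, the vertical `δ`-neighborhood of the graph of `f` over `J`. -/
def vtube (J : Set ℝ) (f : ℝ → ℝ) (s : ℝ) : Set (ℝ × ℝ) :=
  {p : ℝ × ℝ | p.1 ∈ J ∧ |f p.1 - p.2| ≤ s}

/-- `λJ` for `J = [u,v]`: the interval concentric with `J` of `λ` times the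
length. -/
def subIcc (lam u v : ℝ) : Set ℝ :=
  Set.Icc ((u + v) / 2 - lam * (v - u) / 2) ((u + v) / 2 + lam * (v - u) / 2)

namespace WM

/-- order sign -/
def sg (a b : ℕ) : ℤ := if a < b then 1 else if b < a then -1 else 0

/-- The cyclic order of the four points is `x1, x2, y2, y1` up to rotation and reflection. -/
def Cyc (x1 x2 y1 y2 : ℕ) : Prop :=
  (x1 < x2 ∧ x2 < y2 ∧ y2 < y1) ∨ (x2 < y2 ∧ y2 < y1 ∧ y1 < x1) ∨
  (y2 < y1 ∧ y1 < x1 ∧ x1 < x2) ∨ (y1 < x1 ∧ x1 < x2 ∧ x2 < y2) ∨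
  (y1 < y2 ∧ y2 < x2 ∧ x2 < x1) ∨ (x1 < y1 ∧ y1 < y2 ∧ y2 < x2) ∨
  (x2 < x1 ∧ x1 < y1 ∧ y1 < y2) ∨ (y2 < x2 ∧ x2 < x1 ∧ x1 < y1)

lemma Cyc.swap {x1 x2 y1 y2 : ℕ} (h : Cyc x1 x2 y1 y2) : Cyc x1 y1 x2 y2 := by
  unfold Cyc at *
  rcases h with h | h | h | h | h | h | h | h <;> simp [h]

lemma sg_lt {a b : ℕ} (h : a < b) : sg a b = 1 := by simp [sg, h]
lemma sg_gt {a b : ℕ} (h : b < a) : sg a b = -1 := by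
  have : ¬ a < b := by omega
  simp [sg, h, this]
lemma sg_self (a : ℕ) : sg a a = 0 := by simp [sg]
lemma sg_cases {a b : ℕ} (h : a ≠ b) : (a < b ∧ sg a b = 1) ∨ (b < a ∧ sg a b = -1) := by
  rcases lt_or_gt_of_ne h with h | h
  · exact Or.inl ⟨h, sg_lt h⟩
  · exact Or.inr ⟨h, sg_gt h⟩
lemma sg_sq_le (a b : ℕ) : sg a b * sg a b ≤ 1 := by
  unfold sg; split_ifs <;> norm_num
lemma sg_sq {a b : ℕ} (h : a ≠ b) : sg a b * sg a b = 1 := by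
  rcases sg_cases h with h | h <;> simp [h.2]

lemma Cyc.prod {x1 x2 y1 y2 : ℕ} (h : Cyc x1 x2 y1 y2) :
    sg x1 x2 * sg y1 y2 = - (sg x1 y1 * sg x2 y2) := by
  unfold Cyc at h
  rcases h with ⟨a1, a2, a3⟩ | ⟨a1, a2, a3⟩ | ⟨a1, a2, a3⟩ | ⟨a1, a2, a3⟩ |
    ⟨a1, a2, a3⟩ | ⟨a1, a2, a3⟩ | ⟨a1, a2, a3⟩ | ⟨a1, a2, a3⟩ <;>
  · rw [show sg x1 x2 = _ from by first | exact sg_lt (by omega) | exact sg_gt (by omega),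
      show sg y1 y2 = _ from by first | exact sg_lt (by omega) | exact sg_gt (by omega),
      show sg x1 y1 = _ from by first | exact sg_lt (by omega) | exact sg_gt (by omega),
      show sg x2 y2 = _ from by first | exact sg_lt (by omega) | exact sg_gt (by omega)]
    norm_num

section tree
variable {β : Type*} [DecidableEq β]

/-- signed count of elements whose two points lie in the dyadic interval `(l,i)`. -/
def dI (S : Finset β) (p q : β → ℕ) (l i : ℕ) : ℤ :=
  ∑ b ∈ S with (p b / 2 ^ l = i ∧ q b / 2 ^ l = i), sg (p b) (q b)

lemma crossing_same {p1 q1 p2 q2 l i : ℕ} (h : Cyc p1 p2 q1 q2)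
    (hp1 : p1 / 2 ^ (l+1) = i) (hq1 : q1 / 2 ^ (l+1) = i) (h1 : p1 / 2 ^ l ≠ q1 / 2 ^ l)
    (hp2 : p2 / 2 ^ (l+1) = i) (hq2 : q2 / 2 ^ (l+1) = i) (h2 : p2 / 2 ^ l ≠ q2 / 2 ^ l) :
    sg p1 q1 = sg p2 q2 := by
  have hh : ∀ x : ℕ, x / 2 ^ (l+1) = (x / 2^l) / 2 := by
    intro x; rw [pow_succ, Nat.div_div_eq_div_mul]
  rw [hh] at hp1 hq1 hp2 hq2
  have n1 : p1 ≠ q1 := by rintro rfl; exact h1 rfl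
  have n2 : p2 ≠ q2 := by rintro rfl; exact h2 rfl
  have mono : ∀ {a b : ℕ}, a < b → a / 2^l ≤ b / 2^l := fun h => Nat.div_le_div_right h.le
  have a1 : p1 < q2 → p1 / 2^l ≤ q2 / 2^l := mono
  have a2 : q2 < p1 → q2 / 2^l ≤ p1 / 2^l := mono
  have a3 : p1 < p2 → p1 / 2^l ≤ p2 / 2^l := mono
  have a4 : p2 < p1 → p2 / 2^l ≤ p1 / 2^l := mono
  have a5 : q1 < q2 → q1 / 2^l ≤ q2 / 2^l := mono
  have a6 : q2 < q1 → q2 / 2^l ≤ q1 / 2^l := mono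
  have a7 : q1 < p2 → q1 / 2^l ≤ p2 / 2^l := mono
  have a8 : p2 < q1 → p2 / 2^l ≤ q1 / 2^l := mono
  have a9 : p1 < q1 → p1 / 2^l ≤ q1 / 2^l := mono
  have a10 : q1 < p1 → q1 / 2^l ≤ p1 / 2^l := mono
  have a11 : p2 < q2 → p2 / 2^l ≤ q2 / 2^l := mono
  have a12 : q2 < p2 → q2 / 2^l ≤ p2 / 2^l := mono
  generalize p1 / 2^l = P1 at *
  generalize p2 / 2^l = P2 at *
  generalize q1 / 2^l = Q1 at *
  generalize q2 / 2^l = Q2 at *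
  unfold Cyc at h
  rcases sg_cases n1 with ⟨b1, c1⟩ | ⟨b1, c1⟩ <;> rcases sg_cases n2 with ⟨b2, c2⟩ | ⟨b2, c2⟩ <;>
  rw [c1, c2] <;> (exfalso; omega)

lemma same_index {p1 q1 p2 q2 l i j : ℕ} (h : Cyc p1 p2 q1 q2)
    (hs : sg p1 q1 = sg p2 q2)
    (hp1 : p1 / 2 ^ l = i) (hq1 : q1 / 2 ^ l = i)
    (hp2 : p2 / 2 ^ l = j) (hq2 : q2 / 2 ^ l = j) : i = j := by
  have mono : ∀ {a b : ℕ}, a < b → a / 2^l ≤ b / 2^l := fun h => Nat.div_le_div_right h.le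
  have n1 : p1 ≠ q1 := by unfold Cyc at h; omega
  have n2 : p2 ≠ q2 := by unfold Cyc at h; omega
  have a1 : p1 < q2 → p1 / 2^l ≤ q2 / 2^l := mono
  have a2 : q2 < p1 → q2 / 2^l ≤ p1 / 2^l := mono
  have a3 : p1 < p2 → p1 / 2^l ≤ p2 / 2^l := mono
  have a4 : p2 < p1 → p2 / 2^l ≤ p1 / 2^l := mono
  have a5 : q1 < q2 → q1 / 2^l ≤ q2 / 2^l := mono
  have a6 : q2 < q1 → q2 / 2^l ≤ q1 / 2^l := mono
  have a7 : q1 < p2 → q1 / 2^l ≤ p2 / 2^l := mono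
  have a8 : p2 < q1 → p2 / 2^l ≤ q1 / 2^l := mono
  rw [hp1, hq1, hp2, hq2] at *
  unfold Cyc at h
  rcases sg_cases n1 with ⟨b1, c1⟩ | ⟨b1, c1⟩ <;> rcases sg_cases n2 with ⟨b2, c2⟩ | ⟨b2, c2⟩ <;>
  rw [c1, c2] at hs <;> first | (exfalso; omega) | omega

variable {S : Finset β} {p q : β → ℕ} {J : ℕ}

lemma theta_sq (h4 : ∀ b ∈ S, ∀ b' ∈ S, b ≠ b' → Cyc (p b) (p b') (q b) (q b'))
    (hne : ∀ b ∈ S, p b ≠ q b) (l : ℕ) :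
    (∑ i ∈ Finset.range (2^J), |dI S p q l i|)^2 ≤
      2 * ∑ i ∈ Finset.range (2^J), (dI S p q l i)^2 := by
  classical
  set U := (Finset.range (2^J)).filter (fun i => dI S p q l i ≠ 0)
  have hU : U.card ≤ 2 := by
    set Up := (Finset.range (2^J)).filter (fun i => ∃ b ∈ S, p b / 2^l = i ∧ q b / 2^l = i ∧ sg (p b) (q b) = 1)
    set Um := (Finset.range (2^J)).filter (fun i => ∃ b ∈ S, p b / 2^l = i ∧ q b / 2^l = i ∧ sg (p b) (q b) = -1)
    have hsub : U ⊆ Up ∪ Um := by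
      intro i hi
      simp only [U, Finset.mem_filter] at hi
      obtain ⟨hi1, hi2⟩ := hi
      obtain ⟨b, hb, -⟩ := Finset.exists_ne_zero_of_sum_ne_zero hi2
      simp only [Finset.mem_filter] at hb
      simp only [Up, Um, Finset.mem_union, Finset.mem_filter]
      rcases sg_cases (hne b hb.1) with h | h
      · exact Or.inl ⟨hi1, b, hb.1, hb.2.1, hb.2.2, h.2⟩
      · exact Or.inr ⟨hi1, b, hb.1, hb.2.1, hb.2.2, h.2⟩
    have key : ∀ s : ℤ, ((Finset.range (2^J)).filter (fun i => ∃ b ∈ S, p b / 2^l = i ∧ q b / 2^l = i ∧ sg (p b) (q b) = s)).card ≤ 1 := by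
      intro s
      rw [Finset.card_le_one]
      intro i hi j hj
      simp only [Finset.mem_filter] at hi hj
      obtain ⟨-, b, hb, h1, h2, h3⟩ := hi
      obtain ⟨-, b', hb', h1', h2', h3'⟩ := hj
      by_cases hbb : b = b'
      · subst hbb; omega
      · exact same_index (h4 b hb b' hb' hbb) (h3.trans h3'.symm) h1 h2 h1' h2'
    calc U.card ≤ (Up ∪ Um).card := Finset.card_le_card hsub
      _ ≤ Up.card + Um.card := Finset.card_union_le _ _
      _ ≤ 1 + 1 := Nat.add_le_add (key 1) (key (-1))
  have e1 : ∑ i ∈ Finset.range (2^J), |dI S p q l i| = ∑ i ∈ U, |dI S p q l i| := by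
    symm; apply Finset.sum_filter_of_ne
    intro i _ h h'; exact h (by simp [h'])
  have e2 : ∑ i ∈ Finset.range (2^J), (dI S p q l i)^2 = ∑ i ∈ U, (dI S p q l i)^2 := by
    symm; apply Finset.sum_filter_of_ne
    intro i _ h h'; exact h (by simp [h'])
  rw [e1, e2]
  calc (∑ i ∈ U, |dI S p q l i|)^2 ≤ U.card * ∑ i ∈ U, |dI S p q l i|^2 := sq_sum_le_card_mul_sum_sq
    _ = U.card * ∑ i ∈ U, (dI S p q l i)^2 := by simp only [sq_abs]
    _ ≤ 2 * ∑ i ∈ U, (dI S p q l i)^2 := by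
      apply mul_le_mul_of_nonneg_right (by exact_mod_cast hU)
      exact Finset.sum_nonneg fun _ _ => sq_nonneg _

lemma dI_step (l i : ℕ) : dI S p q (l+1) i = dI S p q l (2*i) + dI S p q l (2*i+1) +
    ∑ b ∈ S with (p b / 2 ^ (l+1) = i ∧ q b / 2 ^ (l+1) = i ∧ p b / 2^l ≠ q b / 2^l), sg (p b) (q b) := by
  unfold dI
  simp only [Finset.sum_filter]
  rw [← Finset.sum_add_distrib, ← Finset.sum_add_distrib]
  apply Finset.sum_congr rfl
  intro b _
  have hh : ∀ x : ℕ, x / 2 ^ (l+1) = (x / 2^l) / 2 := by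
    intro x; rw [pow_succ, Nat.div_div_eq_div_mul]
  rw [hh, hh]
  generalize p b / 2^l = P
  generalize q b / 2^l = Q
  generalize sg (p b) (q b) = s
  by_cases h1 : P / 2 = i ∧ Q / 2 = i
  · by_cases h2 : P = Q
    · subst h2
      have : P = 2 * i ∨ P = 2 * i + 1 := by omega
      rcases this with h | h
      · subst h; simp; try (intro h; omega)
      · subst h; simp; try (intro h; omega)
    · have c1 : ¬ (P = 2*i ∧ Q = 2*i) := by omega
      have c2 : ¬ (P = 2*i+1 ∧ Q = 2*i+1) := by omega
      have c3 : (P / 2 = i ∧ Q / 2 = i ∧ P ≠ Q) := by omega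
      simp [c1, c2, h1.1, h1.2, h2]
  · have c1 : ¬ (P = 2*i ∧ Q = 2*i) := by omega
    have c2 : ¬ (P = 2*i+1 ∧ Q = 2*i+1) := by omega
    have c3 : ¬ (P / 2 = i ∧ Q / 2 = i ∧ P ≠ Q) := by omega
    simp only [h1, c1, c2, c3, if_false]; norm_num

lemma cross_abs (h4 : ∀ b ∈ S, ∀ b' ∈ S, b ≠ b' → Cyc (p b) (p b') (q b) (q b'))
    (hne : ∀ b ∈ S, p b ≠ q b) (l i : ℕ) :
    ((S.filter (fun b => p b / 2 ^ (l+1) = i ∧ q b / 2 ^ (l+1) = i ∧ p b / 2^l ≠ q b / 2^l)).card : ℤ)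
     = |∑ b ∈ S with (p b / 2 ^ (l+1) = i ∧ q b / 2 ^ (l+1) = i ∧ p b / 2^l ≠ q b / 2^l), sg (p b) (q b)| := by
  set Z := S.filter (fun b => p b / 2 ^ (l+1) = i ∧ q b / 2 ^ (l+1) = i ∧ p b / 2^l ≠ q b / 2^l) with hZ
  rcases Z.eq_empty_or_nonempty with h | ⟨b0, hb0⟩
  · simp [h]
  · have hc : ∀ b ∈ Z, sg (p b) (q b) = sg (p b0) (q b0) := by
      intro b hb
      by_cases hbb : b = b0
      · rw [hbb]
      · simp only [hZ, Finset.mem_filter] at hb hb0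
        exact crossing_same (h4 b hb.1 b0 hb0.1 hbb) hb.2.1 hb.2.2.1 hb.2.2.2 hb0.2.1 hb0.2.2.1 hb0.2.2.2
    rw [Finset.sum_congr rfl hc, Finset.sum_const, nsmul_eq_mul, abs_mul]
    have : |sg (p b0) (q b0)| = 1 := by
      simp only [hZ, Finset.mem_filter] at hb0
      rcases sg_cases (hne b0 hb0.1) with h | h <;> simp [h.2]
    rw [this]; simp

lemma k_step (h4 : ∀ b ∈ S, ∀ b' ∈ S, b ≠ b' → Cyc (p b) (p b') (q b) (q b'))
    (hne : ∀ b ∈ S, p b ≠ q b) (hp : ∀ b ∈ S, p b < 2^J) (l : ℕ) :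
    ((S.filter (fun b => p b / 2^(l+1) = q b / 2^(l+1))).card : ℤ) ≤
      (S.filter (fun b => p b / 2^l = q b / 2^l)).card +
      ∑ i ∈ Finset.range (2^J), |dI S p q (l+1) i| + ∑ i ∈ Finset.range (2^J), |dI S p q l i| := by
  classical
  have hh : ∀ x : ℕ, x / 2 ^ (l+1) = (x / 2^l) / 2 := by
    intro x; rw [pow_succ, Nat.div_div_eq_div_mul]
  -- decompose
  set Zf : ℕ → Finset β := fun i => S.filter (fun b => p b / 2 ^ (l+1) = i ∧ q b / 2 ^ (l+1) = i ∧ p b / 2^l ≠ q b / 2^l) with hZf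
  have hsub : S.filter (fun b => p b / 2^(l+1) = q b / 2^(l+1)) ⊆
      S.filter (fun b => p b / 2^l = q b / 2^l) ∪ (Finset.range (2^J)).biUnion Zf := by
    intro b hb
    simp only [Finset.mem_filter] at hb
    simp only [Finset.mem_union, Finset.mem_filter, Finset.mem_biUnion, Finset.mem_range, hZf]
    by_cases h : p b / 2^l = q b / 2^l
    · exact Or.inl ⟨hb.1, h⟩
    · exact Or.inr ⟨p b / 2^(l+1), lt_of_le_of_lt (Nat.div_le_self _ _) (hp b hb.1), hb.1, rfl, hb.2.symm, h⟩
  have hcard := (Finset.card_le_card hsub).trans (Finset.card_union_le _ _)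
  have hcard2 := hcard.trans (Nat.add_le_add_left Finset.card_biUnion_le _)
  have hb1 : ∀ i, ((Zf i).card : ℤ) ≤ |dI S p q (l+1) i| + (|dI S p q l (2*i)| + |dI S p q l (2*i+1)|) := by
    intro i
    rw [hZf, cross_abs h4 hne l i]
    have := dI_step (S := S) (p := p) (q := q) l i
    set s := ∑ b ∈ S with (p b / 2 ^ (l+1) = i ∧ q b / 2 ^ (l+1) = i ∧ p b / 2^l ≠ q b / 2^l), sg (p b) (q b)
    have e : s = dI S p q (l+1) i - (dI S p q l (2*i) + dI S p q l (2*i+1)) := by rw [this]; ring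
    rw [e]
    exact (abs_sub _ _).trans (by gcongr; exact abs_add_le _ _)
  have hpair : ∑ i ∈ Finset.range (2^J), (|dI S p q l (2*i)| + |dI S p q l (2*i+1)|) ≤
      ∑ i ∈ Finset.range (2^J), |dI S p q l i| := by
    have h1 : ∀ n, ∑ i ∈ Finset.range n, (|dI S p q l (2*i)| + |dI S p q l (2*i+1)|) =
      ∑ i ∈ Finset.range (2*n), |dI S p q l i| := by
      intro n
      induction n with
      | zero => simp
      | succ n ih => rw [Finset.sum_range_succ, ih, show 2*(n+1) = 2*n+1+1 by ring,
          Finset.sum_range_succ, Finset.sum_range_succ]; ring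
    rw [h1]
    have h0 : ∀ i, 2^J ≤ i → dI S p q l i = 0 := by
      intro i hi
      unfold dI
      rw [Finset.filter_false_of_mem, Finset.sum_empty]
      rintro b hb ⟨h, -⟩
      have := (Nat.div_le_self (p b) (2^l)).trans_lt (hp b hb)
      omega
    apply le_of_eq
    symm
    apply Finset.sum_subset
    · intro i hi; simp only [Finset.mem_range] at *; omega
    · intro i _ hi
      simp only [Finset.mem_range, not_lt] at hi
      rw [h0 i hi, abs_zero]
  have : (((S.filter (fun b => p b / 2^(l+1) = q b / 2^(l+1))).card : ℕ) : ℤ) ≤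
      ((S.filter (fun b => p b / 2^l = q b / 2^l)).card + ∑ i ∈ Finset.range (2^J), (Zf i).card : ℕ) := by
    exact_mod_cast hcard2
  push_cast at this
  have h5 : ∑ i ∈ Finset.range (2^J), ((Zf i).card : ℤ) ≤ ∑ i ∈ Finset.range (2^J), |dI S p q (l+1) i| +
     ∑ i ∈ Finset.range (2^J), (|dI S p q l (2*i)| + |dI S p q l (2*i+1)|) := by
    rw [← Finset.sum_add_distrib]
    exact Finset.sum_le_sum fun i _ => hb1 i
  linarith

lemma tree_bound (h4 : ∀ b ∈ S, ∀ b' ∈ S, b ≠ b' → Cyc (p b) (p b') (q b) (q b'))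
    (hne : ∀ b ∈ S, p b ≠ q b) (hp : ∀ b ∈ S, p b < 2^J) (hq : ∀ b ∈ S, q b < 2^J) :
    (S.card : ℤ)^2 ≤ 8 * (J+1) * ∑ l ∈ Finset.range (J+1), ∑ i ∈ Finset.range (2^J), (dI S p q l i)^2 := by
  set Θ : ℕ → ℤ := fun l => ∑ i ∈ Finset.range (2^J), |dI S p q l i| with hΘ
  have hΘ0 : ∀ l, 0 ≤ Θ l := fun l => Finset.sum_nonneg fun _ _ => abs_nonneg _
  have step : ∀ n, ((S.filter (fun b => p b / 2^n = q b / 2^n)).card : ℤ) + Θ n ≤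
      2 * ∑ l ∈ Finset.range (n+1), Θ l := by
    intro n
    induction n with
    | zero =>
      have : S.filter (fun b => p b / 2^0 = q b / 2^0) = ∅ := by
        apply Finset.filter_false_of_mem
        intro b hb; simpa using hne b hb
      rw [this]; simp; linarith [hΘ0 0]
    | succ n ih =>
      rw [Finset.sum_range_succ]
      have := k_step h4 hne hp n
      simp only [hΘ] at *
      linarith
  have hJ : S.filter (fun b => p b / 2^J = q b / 2^J) = S := by
    apply Finset.filter_true_of_mem
    intro b hb
    rw [Nat.div_eq_of_lt (hp b hb), Nat.div_eq_of_lt (hq b hb)]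
  have h1 := step J
  rw [hJ] at h1
  have h2 : (S.card : ℤ) ≤ 2 * ∑ l ∈ Finset.range (J+1), Θ l := by linarith [hΘ0 J]
  have h3 : (∑ l ∈ Finset.range (J+1), Θ l)^2 ≤ (J+1) * ∑ l ∈ Finset.range (J+1), (Θ l)^2 := by
    have := sq_sum_le_card_mul_sum_sq (s := Finset.range (J+1)) (f := Θ)
    simpa using this
  have h4' : ∑ l ∈ Finset.range (J+1), (Θ l)^2 ≤ ∑ l ∈ Finset.range (J+1), 2 * ∑ i ∈ Finset.range (2^J), (dI S p q l i)^2 :=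
    Finset.sum_le_sum fun l _ => theta_sq h4 hne l
  rw [← Finset.mul_sum] at h4'
  calc (S.card : ℤ)^2 ≤ (2 * ∑ l ∈ Finset.range (J+1), Θ l)^2 :=
        pow_le_pow_left₀ (by positivity) h2 2
    _ = 4 * (∑ l ∈ Finset.range (J+1), Θ l)^2 := by ring
    _ ≤ 4 * ((J+1) * ∑ l ∈ Finset.range (J+1), (Θ l)^2) := by linarith
    _ ≤ 4 * ((J+1) * (2 * ∑ l ∈ Finset.range (J+1), ∑ i ∈ Finset.range (2^J), (dI S p q l i)^2)) := by
        gcongr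
    _ = _ := by ring
end tree

end WM

namespace WM

section MT
variable {α β : Type*} [DecidableEq α] [DecidableEq β]

/-- indicator of an edge located in the dyadic interval `(l,i)`. -/
def chi (G : Finset (α × β)) (x : α → β → ℕ) (l i : ℕ) (w : α) (b : β) : ℤ :=
  if (w, b) ∈ G ∧ x w b / 2 ^ l = i then 1 else 0

/-- edge indicator. -/
def chi0 (G : Finset (α × β)) (w : α) (b : β) : ℤ := if (w, b) ∈ G then 1 else 0

lemma chi_nonneg (G : Finset (α × β)) (x : α → β → ℕ) (l i : ℕ) (w : α) (b : β) :
    0 ≤ chi G x l i w b := by unfold chi; split_ifs <;> norm_num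

lemma chi_sum_le (G : Finset (α × β)) (x : α → β → ℕ) (l n : ℕ) (w w' : α) (b b' : β) :
    ∑ i ∈ Finset.range n, chi G x l i w b * chi G x l i w' b' ≤ chi0 G w b * chi0 G w' b' := by
  by_cases h : (w, b) ∈ G
  · by_cases h' : (w', b') ∈ G
    · have : ∀ i ∈ Finset.range n, chi G x l i w b * chi G x l i w' b' ≤ if x w b / 2^l = i then 1 else 0 := by
        intro i _
        unfold chi
        simp only [h, h', true_and]
        split_ifs <;> norm_num
      refine (Finset.sum_le_sum this).trans ?_
      rw [Finset.sum_ite_eq]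
      simp only [chi0, h, h']
      split_ifs <;> norm_num
    · simp [chi, chi0, h']
  · simp [chi, chi0, h]

variable {G : Finset (α × β)} {x : α → β → ℕ} {W : Finset α} {B : Finset β} {J : ℕ}

lemma term_le (hC : ∀ w w' b b', w ≠ w' → b ≠ b' → (w, b) ∈ G → (w, b') ∈ G → (w', b) ∈ G →
      (w', b') ∈ G → Cyc (x w b) (x w b') (x w' b) (x w' b')) (l i : ℕ) (w w' : α) (b b' : β) :
    (chi G x l i w b * chi G x l i w b' * sg (x w b) (x w b')) *
      (chi G x l i w' b * chi G x l i w' b' * sg (x w' b) (x w' b')) +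
    (chi G x l i w b * chi G x l i w' b * sg (x w b) (x w' b)) *
      (chi G x l i w b' * chi G x l i w' b' * sg (x w b') (x w' b')) ≤
    (if w' = w then chi G x l i w b * chi G x l i w b' else 0) +
    (if b' = b then chi G x l i w b * chi G x l i w' b else 0) := by
  by_cases hz : chi G x l i w b = 0 ∨ chi G x l i w b' = 0 ∨ chi G x l i w' b = 0 ∨ chi G x l i w' b' = 0
  · have h1 := chi_nonneg G x l i w b
    have h2 := chi_nonneg G x l i w b'
    have h3 := chi_nonneg G x l i w' b
    have h5 := mul_nonneg h1 h2
    have h6 := mul_nonneg h1 h3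
    have : (chi G x l i w b * chi G x l i w b' * sg (x w b) (x w b')) *
      (chi G x l i w' b * chi G x l i w' b' * sg (x w' b) (x w' b')) +
    (chi G x l i w b * chi G x l i w' b * sg (x w b) (x w' b)) *
      (chi G x l i w b' * chi G x l i w' b' * sg (x w b') (x w' b')) = 0 := by
      rcases hz with h | h | h | h <;> rw [h] <;> ring
    rw [this]
    split_ifs <;> linarith
  · push Not at hz
    have one : ∀ w b, chi G x l i w b ≠ 0 → chi G x l i w b = 1 ∧ (w, b) ∈ G := by
      intro w b h
      unfold chi at h ⊢
      by_cases h1 : (w, b) ∈ G ∧ x w b / 2 ^ l = i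
      · exact ⟨if_pos h1, h1.1⟩
      · exact absurd (if_neg h1) h
    obtain ⟨e1, g1⟩ := one _ _ hz.1
    obtain ⟨e2, g2⟩ := one _ _ hz.2.1
    obtain ⟨e3, g3⟩ := one _ _ hz.2.2.1
    obtain ⟨e4, g4⟩ := one _ _ hz.2.2.2
    rw [e1, e2, e3, e4]
    simp only [one_mul]
    by_cases hw : w' = w
    · subst hw
      by_cases hb : b' = b
      · subst hb; simp [sg_self]
      · have := sg_sq_le (x w' b) (x w' b')
        simp only [sg_self, if_true, hb, if_false]; linarith
    · by_cases hb : b' = b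
      · subst hb
        have := sg_sq_le (x w b') (x w' b')
        simp only [sg_self, if_true, hw, if_false]; linarith
      · have := (hC w w' b b' (Ne.symm hw) (Ne.symm hb) g1 g2 g3 g4).prod
        simp only [hw, hb, if_false]; linarith

/-- common neighbours -/
def comm (G : Finset (α × β)) (B : Finset β) (w w' : α) : Finset β :=
  B.filter (fun b => (w, b) ∈ G ∧ (w', b) ∈ G)

lemma dI_eq (l i : ℕ) (w w' : α) : dI (comm G B w w') (x w) (x w') l i =
    ∑ b ∈ B, chi G x l i w b * chi G x l i w' b * sg (x w b) (x w' b) := by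
  unfold dI comm
  rw [Finset.filter_filter, Finset.sum_filter]
  apply Finset.sum_congr rfl
  intro b _
  unfold chi
  by_cases h1 : (w, b) ∈ G <;> by_cases h2 : (w', b) ∈ G <;> by_cases h3 : x w b / 2^l = i <;>
    by_cases h4 : x w' b / 2^l = i <;> simp [h1, h2, h3, h4]

lemma quad_li (hC : ∀ w w' b b', w ≠ w' → b ≠ b' → (w, b) ∈ G → (w, b') ∈ G → (w', b) ∈ G →
      (w', b') ∈ G → Cyc (x w b) (x w b') (x w' b) (x w' b')) (l i : ℕ) :
    ∑ w ∈ W, ∑ w' ∈ W, (dI (comm G B w w') (x w) (x w') l i)^2 ≤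
      ∑ w ∈ W, ∑ b ∈ B, ∑ b' ∈ B, chi G x l i w b * chi G x l i w b' +
      ∑ w ∈ W, ∑ w' ∈ W, ∑ b ∈ B, chi G x l i w b * chi G x l i w' b := by
  have h0 : 0 ≤ ∑ b ∈ B, ∑ b' ∈ B, (∑ w ∈ W, chi G x l i w b * chi G x l i w b' * sg (x w b) (x w b'))^2 :=
    Finset.sum_nonneg fun _ _ => Finset.sum_nonneg fun _ _ => sq_nonneg _
  have e1 : ∑ b ∈ B, ∑ b' ∈ B, (∑ w ∈ W, chi G x l i w b * chi G x l i w b' * sg (x w b) (x w b'))^2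
      = ∑ w ∈ W, ∑ w' ∈ W, ∑ b ∈ B, ∑ b' ∈ B,
        (chi G x l i w b * chi G x l i w b' * sg (x w b) (x w b')) *
        (chi G x l i w' b * chi G x l i w' b' * sg (x w' b) (x w' b')) := by
    simp only [sq, Finset.sum_mul_sum]
    have : ∀ b ∈ B, ∑ b' ∈ B, ∑ w ∈ W, ∑ w' ∈ W, (chi G x l i w b * chi G x l i w b' * sg (x w b) (x w b')) *
        (chi G x l i w' b * chi G x l i w' b' * sg (x w' b) (x w' b')) =
        ∑ w ∈ W, ∑ w' ∈ W, ∑ b' ∈ B, (chi G x l i w b * chi G x l i w b' * sg (x w b) (x w b')) *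
        (chi G x l i w' b * chi G x l i w' b' * sg (x w' b) (x w' b')) := by
      intro b _
      rw [Finset.sum_comm]
      apply Finset.sum_congr rfl; intro w _
      rw [Finset.sum_comm]
    rw [Finset.sum_congr rfl this, Finset.sum_comm]
    apply Finset.sum_congr rfl; intro w _
    rw [Finset.sum_comm]
  have e2 : ∑ w ∈ W, ∑ w' ∈ W, (dI (comm G B w w') (x w) (x w') l i)^2 =
      ∑ w ∈ W, ∑ w' ∈ W, ∑ b ∈ B, ∑ b' ∈ B,
       (chi G x l i w b * chi G x l i w' b * sg (x w b) (x w' b)) *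
      (chi G x l i w b' * chi G x l i w' b' * sg (x w b') (x w' b')) := by
    simp only [dI_eq, sq, Finset.sum_mul_sum]
  have e3 : ∑ w ∈ W, ∑ w' ∈ W, ∑ b ∈ B, ∑ b' ∈ B, ((if w' = w then chi G x l i w b * chi G x l i w b' else 0) +
    (if b' = b then chi G x l i w b * chi G x l i w' b else 0)) =
     ∑ w ∈ W, ∑ b ∈ B, ∑ b' ∈ B, chi G x l i w b * chi G x l i w b' +
      ∑ w ∈ W, ∑ w' ∈ W, ∑ b ∈ B, chi G x l i w b * chi G x l i w' b := by
    simp only [Finset.sum_add_distrib]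
    congr 1
    · apply Finset.sum_congr rfl; intro w hw
      rw [Finset.sum_eq_single w]
      · simp
      · intro w' _ h; simp [h]
      · intro h; exact absurd hw h
    · apply Finset.sum_congr rfl; intro w hw
      apply Finset.sum_congr rfl; intro w' hw'
      apply Finset.sum_congr rfl; intro b hb
      simp [hb]
  rw [← e3, e2]
  rw [e1] at h0
  have : ∑ w ∈ W, ∑ w' ∈ W, ∑ b ∈ B, ∑ b' ∈ B,
    ((chi G x l i w b * chi G x l i w b' * sg (x w b) (x w b')) *
      (chi G x l i w' b * chi G x l i w' b' * sg (x w' b) (x w' b')) +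
    (chi G x l i w b * chi G x l i w' b * sg (x w b) (x w' b)) *
      (chi G x l i w b' * chi G x l i w' b' * sg (x w b') (x w' b'))) ≤
    ∑ w ∈ W, ∑ w' ∈ W, ∑ b ∈ B, ∑ b' ∈ B, ((if w' = w then chi G x l i w b * chi G x l i w b' else 0) +
    (if b' = b then chi G x l i w b * chi G x l i w' b else 0)) :=
    Finset.sum_le_sum fun w _ => Finset.sum_le_sum fun w' _ => Finset.sum_le_sum fun b _ =>
      Finset.sum_le_sum fun b' _ => term_le hC l i w w' b b'
  refine le_trans ?_ this
  simp only [Finset.sum_add_distrib]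
  linarith

/-- sum of squared degrees, both sides -/
def Ys (G : Finset (α × β)) (W : Finset α) (B : Finset β) : ℤ :=
  ∑ w ∈ W, ∑ b ∈ B, ∑ b' ∈ B, chi0 G w b * chi0 G w b'
def Xs (G : Finset (α × β)) (W : Finset α) (B : Finset β) : ℤ :=
  ∑ w ∈ W, ∑ w' ∈ W, ∑ b ∈ B, chi0 G w b * chi0 G w' b

lemma quad_l (hC : ∀ w w' b b', w ≠ w' → b ≠ b' → (w, b) ∈ G → (w, b') ∈ G → (w', b) ∈ G →
      (w', b') ∈ G → Cyc (x w b) (x w b') (x w' b) (x w' b')) (l n : ℕ) :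
    ∑ i ∈ Finset.range n, ∑ w ∈ W, ∑ w' ∈ W, (dI (comm G B w w') (x w) (x w') l i)^2 ≤
      Ys G W B + Xs G W B := by
  refine (Finset.sum_le_sum fun i _ => quad_li hC l i).trans ?_
  rw [Finset.sum_add_distrib]
  unfold Ys Xs
  apply add_le_add
  · rw [Finset.sum_comm]
    apply Finset.sum_le_sum; intro w _
    rw [Finset.sum_comm]
    apply Finset.sum_le_sum; intro b _
    rw [Finset.sum_comm]
    apply Finset.sum_le_sum; intro b' _
    exact chi_sum_le G x l n w w b b'
  · rw [Finset.sum_comm]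
    apply Finset.sum_le_sum; intro w _
    rw [Finset.sum_comm]
    apply Finset.sum_le_sum; intro w' _
    rw [Finset.sum_comm]
    apply Finset.sum_le_sum; intro b _
    exact chi_sum_le G x l n w w' b b

lemma comm_card (w w' : α) : ((comm G B w w').card : ℤ) = ∑ b ∈ B, chi0 G w b * chi0 G w' b := by
  unfold comm
  rw [Finset.card_filter]; push_cast
  apply Finset.sum_congr rfl; intro b _
  unfold chi0
  by_cases h1 : (w, b) ∈ G <;> by_cases h2 : (w', b) ∈ G <;> simp [h1, h2]

lemma half (hC : ∀ w w' b b', w ≠ w' → b ≠ b' → (w, b) ∈ G → (w, b') ∈ G → (w', b) ∈ G →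
      (w', b') ∈ G → Cyc (x w b) (x w b') (x w' b) (x w' b'))
    (hne : ∀ w w' b, w ≠ w' → (w, b) ∈ G → (w', b) ∈ G → x w b ≠ x w' b)
    (hx : ∀ w b, (w, b) ∈ G → x w b < 2^J) :
    (∑ w ∈ W, ∑ w' ∈ W, if w' = w then 0 else ((comm G B w w').card : ℤ))^2 ≤
     8 * (J+1)^2 * W.card^2 * (Ys G W B + Xs G W B) := by
  have hk : ∀ w w', w' ≠ w → ((comm G B w w').card : ℤ)^2 ≤ 8 * (J+1) *
      ∑ l ∈ Finset.range (J+1), ∑ i ∈ Finset.range (2^J), (dI (comm G B w w') (x w) (x w') l i)^2 := by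
    intro w w' h
    apply tree_bound
    · intro b hb b' hb' hbb
      simp only [comm, Finset.mem_filter] at hb hb'
      exact hC w w' b b' (Ne.symm h) hbb hb.2.1 hb'.2.1 hb.2.2 hb'.2.2
    · intro b hb
      simp only [comm, Finset.mem_filter] at hb
      exact hne w w' b (Ne.symm h) hb.2.1 hb.2.2
    · intro b hb
      simp only [comm, Finset.mem_filter] at hb
      exact hx _ _ hb.2.1
    · intro b hb
      simp only [comm, Finset.mem_filter] at hb
      exact hx _ _ hb.2.2
  have h1 : (∑ w ∈ W, ∑ w' ∈ W, if w' = w then 0 else ((comm G B w w').card : ℤ))^2 ≤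
     W.card^2 * ∑ w ∈ W, ∑ w' ∈ W, (if w' = w then 0 else ((comm G B w w').card : ℤ))^2 := by
    rw [← Finset.sum_product', ← Finset.sum_product']
    refine sq_sum_le_card_mul_sum_sq.trans ?_
    rw [Finset.card_product]; push_cast
    rw [sq]
  have h2 : ∑ w ∈ W, ∑ w' ∈ W, (if w' = w then 0 else ((comm G B w w').card : ℤ))^2 ≤
     ∑ w ∈ W, ∑ w' ∈ W, 8 * ((J:ℤ)+1) *
      ∑ l ∈ Finset.range (J+1), ∑ i ∈ Finset.range (2^J), (dI (comm G B w w') (x w) (x w') l i)^2 := by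
    apply Finset.sum_le_sum; intro w _
    apply Finset.sum_le_sum; intro w' _
    split_ifs with h
    · simp only [ne_eq, OfNat.ofNat_ne_zero, not_false_eq_true, zero_pow]
      apply mul_nonneg (by positivity)
      exact Finset.sum_nonneg fun _ _ => Finset.sum_nonneg fun _ _ => sq_nonneg _
    · exact hk w w' h
  have h3 : ∑ w ∈ W, ∑ w' ∈ W, 8 * ((J:ℤ)+1) *
      ∑ l ∈ Finset.range (J+1), ∑ i ∈ Finset.range (2^J), (dI (comm G B w w') (x w) (x w') l i)^2
      = 8 * ((J:ℤ)+1) * ∑ l ∈ Finset.range (J+1), ∑ i ∈ Finset.range (2^J), ∑ w ∈ W, ∑ w' ∈ W, (dI (comm G B w w') (x w) (x w') l i)^2 := by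
    simp only [← Finset.mul_sum]
    congr 1
    have : ∀ w ∈ W, ∑ w' ∈ W, ∑ l ∈ Finset.range (J+1), ∑ i ∈ Finset.range (2^J), (dI (comm G B w w') (x w) (x w') l i)^2
       = ∑ l ∈ Finset.range (J+1), ∑ i ∈ Finset.range (2^J), ∑ w' ∈ W, (dI (comm G B w w') (x w) (x w') l i)^2 := by
      intro w _
      rw [Finset.sum_comm]
      apply Finset.sum_congr rfl; intro l _
      rw [Finset.sum_comm]
    rw [Finset.sum_congr rfl this, Finset.sum_comm]
    apply Finset.sum_congr rfl; intro l _
    rw [Finset.sum_comm]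
  have h4 : ∑ l ∈ Finset.range (J+1), ∑ i ∈ Finset.range (2^J), ∑ w ∈ W, ∑ w' ∈ W, (dI (comm G B w w') (x w) (x w') l i)^2
      ≤ ((J:ℤ)+1) * (Ys G W B + Xs G W B) := by
    refine (Finset.sum_le_sum fun l _ => quad_l hC l (2^J)).trans ?_
    simp
  calc _ ≤ _ := h1
    _ ≤ W.card^2 * (8 * ((J:ℤ)+1) * (((J:ℤ)+1) * (Ys G W B + Xs G W B))) := by
      apply mul_le_mul_of_nonneg_left _ (by positivity)
      refine h2.trans ?_
      rw [h3]
      exact mul_le_mul_of_nonneg_left h4 (by positivity)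
    _ = _ := by ring

lemma Xs_eq : Xs G W B = (∑ w ∈ W, ∑ w' ∈ W, if w' = w then 0 else ((comm G B w w').card : ℤ))
    + ∑ w ∈ W, ∑ b ∈ B, chi0 G w b := by
  unfold Xs
  rw [← Finset.sum_add_distrib]
  apply Finset.sum_congr rfl; intro w hw
  have : ∑ b ∈ B, chi0 G w b = ∑ w' ∈ W, if w' = w then ∑ b ∈ B, chi0 G w b else 0 := by
    simp [hw]
  rw [this, ← Finset.sum_add_distrib]
  apply Finset.sum_congr rfl; intro w' _
  split_ifs with h
  · subst h
    rw [zero_add]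
    apply Finset.sum_congr rfl; intro b _
    unfold chi0; split_ifs <;> norm_num
  · rw [comm_card]; ring

/-- swapped graph -/
def swp (G : Finset (α × β)) : Finset (β × α) := G.map (Equiv.prodComm α β).toEmbedding

lemma mem_swp (w : α) (b : β) : (b, w) ∈ swp G ↔ (w, b) ∈ G := by
  unfold swp; simp [Finset.mem_map]

lemma chi0_swp (w : α) (b : β) : chi0 (swp G) b w = chi0 G w b := by
  unfold chi0; simp only [mem_swp]

lemma Xs_swp : Xs (swp G) B W = Ys G W B := by
  unfold Xs Ys
  simp only [chi0_swp]
  have : ∀ b ∈ B, ∑ b' ∈ B, ∑ w ∈ W, chi0 G w b * chi0 G w b' = ∑ w ∈ W, ∑ b' ∈ B, chi0 G w b * chi0 G w b' :=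
    fun b _ => Finset.sum_comm
  rw [Finset.sum_congr rfl this, Finset.sum_comm]

lemma Ys_swp : Ys (swp G) B W = Xs G W B := by
  unfold Xs Ys
  simp only [chi0_swp]
  rw [Finset.sum_comm]
  apply Finset.sum_congr rfl; intro w _
  rw [Finset.sum_comm]

lemma deg_cs : (∑ w ∈ W, ∑ b ∈ B, chi0 G w b)^2 ≤ B.card * Xs G W B := by
  rw [Finset.sum_comm]
  refine sq_sum_le_card_mul_sum_sq.trans ?_
  apply mul_le_mul_of_nonneg_left _ (by positivity)
  apply le_of_eq
  unfold Xs
  simp only [sq, Finset.sum_mul_sum]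
  rw [Finset.sum_comm]
  apply Finset.sum_congr rfl; intro w _
  rw [Finset.sum_comm]

lemma mt_arith {T X' Y' Bc : ℤ} {J n : ℕ} (hT0 : 0 ≤ T) (hX0 : 0 ≤ X') (hY0 : 0 ≤ Y')
    (h1' : X'^2 ≤ 8 * (J+1)^2 * n^2 * (X' + Y' + 2 * T))
    (h2' : Y'^2 ≤ 8 * (J+1)^2 * n^2 * (X' + Y' + 2 * T))
    (h3 : T^2 ≤ Bc * (X' + T)) (hB0 : (0:ℤ) ≤ Bc) (hBn : Bc ≤ n) :
    T^2 ≤ 100 * (J+1)^2 * n^2 * Bc := by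
  set S := X' + Y' with hS
  have hS2 : S^2 ≤ 32 * (J+1)^2 * n^2 * (S + 2 * T) := by
    have : S^2 ≤ 2 * (X'^2 + Y'^2) := by rw [hS]; nlinarith [sq_nonneg (X' - Y')]
    linarith
  by_cases hc : 2 * T ≤ S
  · have hSb : S ≤ 64 * (J+1)^2 * n^2 := by
      by_contra hcon
      push Not at hcon
      have hSp : 0 < S := lt_of_le_of_lt (by positivity) hcon
      have : 32 * ((J:ℤ)+1)^2 * n^2 * (S + 2 * T) ≤ 32 * ((J:ℤ)+1)^2 * n^2 * (2 * S) := by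
        apply mul_le_mul_of_nonneg_left (by linarith) (by positivity)
      nlinarith
    have : X' + T ≤ 100 * (J+1)^2 * n^2 := by
      have : 0 ≤ ((J:ℤ)+1)^2 * n^2 := by positivity
      linarith
    calc T^2 ≤ Bc * (X' + T) := h3
      _ ≤ Bc * (100 * (J+1)^2 * n^2) := mul_le_mul_of_nonneg_left this hB0
      _ = _ := by ring
  · push Not at hc
    have hT3 : T^2 ≤ Bc * (3 * T) := h3.trans (mul_le_mul_of_nonneg_left (by linarith) hB0)
    have hT4 : T ≤ 3 * Bc := by
      rcases hT0.eq_or_lt with h | h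
      · rw [← h]; positivity
      · nlinarith
    have h5 : T^2 ≤ 9 * (Bc * Bc) := by nlinarith
    have h6 : Bc ≤ ((J:ℤ)+1)^2 * n^2 := by
      have : (n:ℤ) ≤ n^2 := by exact_mod_cast Nat.le_self_pow (by norm_num) n
      have h7 : (1:ℤ) ≤ ((J:ℤ)+1)^2 := by
        have : (0:ℤ) ≤ J := by positivity
        nlinarith
      nlinarith
    nlinarith
/-- **Combinatorial theorem** (Marcus–Tardos type bound). -/
theorem marcus_tardos (hC : ∀ w w' b b', w ≠ w' → b ≠ b' → (w, b) ∈ G → (w, b') ∈ G → (w', b) ∈ G →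
      (w', b') ∈ G → Cyc (x w b) (x w b') (x w' b) (x w' b'))
    (hne : ∀ w w' b, w ≠ w' → (w, b) ∈ G → (w', b) ∈ G → x w b ≠ x w' b)
    (hne' : ∀ w b b', b ≠ b' → (w, b) ∈ G → (w, b') ∈ G → x w b ≠ x w b')
    (hx : ∀ w b, (w, b) ∈ G → x w b < 2^J) (hG : G ⊆ W ×ˢ B) (n : ℕ) (hW : W.card ≤ n)
    (hB : B.card ≤ n) :
    (G.card : ℤ)^2 ≤ 100 * (J+1)^2 * n^2 * B.card := by
  set T : ℤ := ∑ w ∈ W, ∑ b ∈ B, chi0 G w b with hT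
  have hTG : (G.card : ℤ) = T := by
    rw [hT, ← Finset.sum_product']
    unfold chi0
    rw [← Finset.sum_filter]
    simp only [Prod.mk.eta, Finset.sum_const, nsmul_eq_mul, mul_one]
    congr 1
    rw [Finset.filter_mem_eq_inter, Finset.inter_eq_right.2 hG]
  have hT0 : 0 ≤ T := by rw [← hTG]; positivity
  set X' := ∑ w ∈ W, ∑ w' ∈ W, if w' = w then 0 else ((comm G B w w').card : ℤ) with hX'
  set Y' := ∑ b ∈ B, ∑ b' ∈ B, if b' = b then 0 else ((comm (swp G) W b b').card : ℤ) with hY'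
  have hX0 : 0 ≤ X' := Finset.sum_nonneg fun _ _ => Finset.sum_nonneg fun _ _ => by split_ifs <;> positivity
  have hY0 : 0 ≤ Y' := Finset.sum_nonneg fun _ _ => Finset.sum_nonneg fun _ _ => by split_ifs <;> positivity
  have eX : Xs G W B = X' + T := Xs_eq
  have eY : Ys G W B = Y' + T := by
    rw [← Xs_swp, Xs_eq]
    have e : ∑ b ∈ B, ∑ w ∈ W, chi0 (swp G) b w = T := by
      rw [Finset.sum_comm, hT]
      exact Finset.sum_congr rfl fun w _ => Finset.sum_congr rfl fun b _ => chi0_swp w b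
    rw [e]
  have h1 : X'^2 ≤ 8 * (J+1)^2 * W.card^2 * (Ys G W B + Xs G W B) := half hC hne hx
  have h2 : Y'^2 ≤ 8 * (J+1)^2 * B.card^2 * (Ys (swp G) B W + Xs (swp G) B W) := by
    apply half (x := fun b w => x w b)
    · intro b b' w w' hb hw
      simp only [mem_swp]
      intro g1 g2 g3 g4
      exact (hC w w' b b' hw hb g1 g3 g2 g4).swap
    · intro b b' w hb
      simp only [mem_swp]
      exact hne' w b b' hb
    · intro b w
      simp only [mem_swp]
      exact hx w b
  rw [Xs_swp, Ys_swp] at h2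
  rw [eX, eY] at h1 h2
  have h3 : T^2 ≤ B.card * (X' + T) := by
    rw [← eX]
    exact deg_cs
  clear_value T X' Y'
  have hn : (W.card : ℤ)^2 ≤ n^2 := by
    have : (W.card : ℤ) ≤ n := by exact_mod_cast hW
    exact pow_le_pow_left₀ (by positivity) this 2
  have hm : (B.card : ℤ)^2 ≤ n^2 := by
    have : (B.card : ℤ) ≤ n := by exact_mod_cast hB
    exact pow_le_pow_left₀ (by positivity) this 2
  have h1' : X'^2 ≤ 8 * (J+1)^2 * n^2 * (X' + Y' + 2 * T) := by
    refine h1.trans ?_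
    have e : Y' + T + (X' + T) = X' + Y' + 2 * T := by ring
    rw [e]
    have e0 : 0 ≤ X' + Y' + 2 * T := by linarith
    exact mul_le_mul_of_nonneg_right (mul_le_mul_of_nonneg_left hn (by positivity)) e0
  have h2' : Y'^2 ≤ 8 * (J+1)^2 * n^2 * (X' + Y' + 2 * T) := by
    refine h2.trans ?_
    have e : X' + T + (Y' + T) = X' + Y' + 2 * T := by ring
    rw [e]
    have e0 : 0 ≤ X' + Y' + 2 * T := by linarith
    exact mul_le_mul_of_nonneg_right (mul_le_mul_of_nonneg_left hm (by positivity)) e0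
  rw [hTG]
  exact mt_arith hT0 hX0 hY0 h1' h2' h3 (by positivity) (by exact_mod_cast hB)
end MT
end WM

namespace WM

section hit
variable {ι γ : Type*} [DecidableEq ι] [DecidableEq γ]

lemma greedy_step (Rs : Finset ι) (A : ι → Finset γ) (X : Finset γ) (a : ℝ)
    (hA : ∀ r ∈ Rs, A r ⊆ X ∧ a ≤ (A r).card) (ha : 0 < a) (hX : 0 < X.card) (s : ℕ) :
    ∃ H ⊆ X, H.card ≤ s ∧
      ((Rs.filter (fun r => A r ∩ H = ∅)).card : ℝ) ≤ Rs.card * (1 - a / X.card)^s := by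
  have hXr : (0:ℝ) < X.card := by exact_mod_cast hX
  induction s with
  | zero => exact ⟨∅, by simp, by simp, by simp⟩
  | succ s ih =>
    obtain ⟨H, hHX, hHs, hH⟩ := ih
    set U := Rs.filter (fun r => A r ∩ H = ∅) with hU
    -- find popular x
    have hdc : ∑ x ∈ X, ((U.filter (fun r => x ∈ A r)).card : ℝ) ≥ a * U.card := by
      have : ∑ x ∈ X, (U.filter (fun r => x ∈ A r)).card = ∑ r ∈ U, (A r).card := by
        simp only [Finset.card_filter]
        rw [Finset.sum_comm]
        apply Finset.sum_congr rfl; intro r hr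
        have hr' : r ∈ Rs := (Finset.mem_filter.1 hr).1
        rw [← Finset.card_filter, Finset.filter_mem_eq_inter, Finset.inter_eq_right.2 (hA r hr').1]
      have h2 : ∑ x ∈ X, ((U.filter (fun r => x ∈ A r)).card : ℝ) = ∑ r ∈ U, ((A r).card : ℝ) := by
        exact_mod_cast this
      rw [h2, ge_iff_le, mul_comm, ← nsmul_eq_mul]
      apply Finset.card_nsmul_le_sum
      intro r hr
      exact (hA r (Finset.mem_filter.1 hr).1).2
    obtain ⟨x, hx, hxx⟩ : ∃ x ∈ X, a * U.card / X.card ≤ ((U.filter (fun r => x ∈ A r)).card : ℝ) := by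
      by_contra hcon
      push Not at hcon
      have hne : X.Nonempty := Finset.card_pos.1 hX
      have := Finset.sum_lt_sum_of_nonempty hne hcon
      rw [Finset.sum_const, nsmul_eq_mul, mul_div_cancel₀ _ hXr.ne'] at this
      linarith
    refine ⟨insert x H, Finset.insert_subset hx hHX, (Finset.card_insert_le _ _).trans (by omega), ?_⟩
    have hsub : (Rs.filter (fun r => A r ∩ insert x H = ∅)) ⊆ U \ (U.filter (fun r => x ∈ A r)) := by
      intro r hr
      simp only [Finset.mem_filter] at hr
      simp only [Finset.mem_sdiff, hU, Finset.mem_filter, not_and]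
      have h1 : A r ∩ H = ∅ := by
        rw [← Finset.subset_empty, ← hr.2]
        exact Finset.inter_subset_inter_left (Finset.subset_insert _ _)
      refine ⟨⟨hr.1, h1⟩, fun _ hxr => ?_⟩
      have : x ∈ A r ∩ insert x H := Finset.mem_inter.2 ⟨hxr, Finset.mem_insert_self _ _⟩
      rw [hr.2] at this
      exact absurd this (Finset.notMem_empty _)
    have hc := Finset.card_le_card hsub
    rw [Finset.card_sdiff_of_subset (Finset.filter_subset _ _)] at hc
    have hc2 : ((Rs.filter (fun r => A r ∩ insert x H = ∅)).card : ℝ) ≤ U.card - (U.filter (fun r => x ∈ A r)).card := by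
      have h3 : (U.filter (fun r => x ∈ A r)).card ≤ U.card := Finset.card_filter_le _ _
      rw [← Nat.cast_sub h3]; exact_mod_cast hc
    by_cases hUe : Rs = ∅
    · subst hUe; simp
    obtain ⟨r0, hr0⟩ := Finset.nonempty_iff_ne_empty.2 hUe
    have haN : a / X.card ≤ 1 := by
      rw [div_le_one hXr]
      exact (hA r0 hr0).2.trans (by exact_mod_cast Finset.card_le_card (hA r0 hr0).1)
    calc ((Rs.filter (fun r => A r ∩ insert x H = ∅)).card : ℝ) ≤ U.card * (1 - a / X.card) := by
          have : a * U.card / X.card = U.card * (a / X.card) := by ring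
          rw [mul_sub, mul_one]; linarith
      _ ≤ (Rs.card * (1 - a / X.card)^s) * (1 - a / X.card) :=
          mul_le_mul_of_nonneg_right hH (by linarith)
      _ = _ := by ring

/-- Greedy hitting sets. -/
lemma hitting (Rs : Finset ι) (A : ι → Finset γ) (X : Finset γ) (a : ℝ)
    (hA : ∀ r ∈ Rs, A r ⊆ X ∧ a ≤ (A r).card) (ha : 0 < a) :
    ∃ H ⊆ X, (∀ r ∈ Rs, ∃ x ∈ A r, x ∈ H) ∧
      (H.card : ℝ) ≤ (X.card / a) * (Real.log Rs.card + 2) := by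
  rcases Rs.eq_empty_or_nonempty with he | ⟨r0, hr0⟩
  · subst he
    exact ⟨∅, by simp, by simp, by simp; positivity⟩
  have haN : a ≤ X.card := (hA r0 hr0).2.trans (by exact_mod_cast Finset.card_le_card (hA r0 hr0).1)
  have hXr : (0:ℝ) < X.card := lt_of_lt_of_le ha haN
  have hX : 0 < X.card := by exact_mod_cast hXr
  have hR1 : (1:ℝ) ≤ Rs.card := by
    exact_mod_cast Finset.card_pos.2 ⟨r0, hr0⟩
  have hlog : 0 ≤ Real.log Rs.card := Real.log_nonneg hR1
  set s := ⌊(X.card / a) * Real.log Rs.card⌋₊ + 1 with hs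
  obtain ⟨H, hHX, hHs, hH⟩ := greedy_step Rs A X a hA ha hX s
  refine ⟨H, hHX, ?_, ?_⟩
  · have hlt : ((Rs.filter (fun r => A r ∩ H = ∅)).card : ℝ) < 1 := by
      refine lt_of_le_of_lt hH ?_
      have h1 : 1 - a / X.card ≤ Real.exp (-(a / X.card)) := by
        have := Real.add_one_le_exp (-(a / X.card)); linarith
      have h0 : 0 ≤ 1 - a / X.card := by
        have : a / X.card ≤ 1 := by rw [div_le_one hXr]; exact haN
        linarith
      have h2 : (1 - a / X.card)^s ≤ Real.exp (-(s * (a / X.card))) := by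
        calc (1 - a / X.card)^s ≤ Real.exp (-(a / X.card))^s := pow_le_pow_left₀ h0 h1 s
          _ = _ := by rw [← Real.exp_nat_mul]; ring_nf
      have h3 : Real.log Rs.card < s * (a / X.card) := by
        have : (X.card / a) * Real.log Rs.card < s := by
          rw [hs]; push_cast; exact Nat.lt_floor_add_one _
        calc Real.log Rs.card = ((X.card / a) * Real.log Rs.card) * (a / X.card) := by
              field_simp
          _ < _ := mul_lt_mul_of_pos_right this (by positivity)
      calc (Rs.card:ℝ) * (1 - a / X.card)^s ≤ Rs.card * Real.exp (-(s * (a / X.card))) :=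
            mul_le_mul_of_nonneg_left h2 (by positivity)
        _ = Real.exp (Real.log Rs.card) * Real.exp (-(s * (a / X.card))) := by
            rw [Real.exp_log (by linarith)]
        _ = Real.exp (Real.log Rs.card - s * (a / X.card)) := by
            rw [← Real.exp_add]; ring_nf
        _ < 1 := by rw [Real.exp_lt_one_iff]; linarith
    have hz : (Rs.filter (fun r => A r ∩ H = ∅)).card = 0 := by
      have : (Rs.filter (fun r => A r ∩ H = ∅)).card < 1 := by exact_mod_cast hlt
      omega
    rw [Finset.card_eq_zero, Finset.filter_eq_empty_iff] at hz
    intro r hr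
    obtain ⟨x, hx⟩ := Finset.nonempty_iff_ne_empty.2 (hz hr)
    exact ⟨x, (Finset.mem_inter.1 hx).1, (Finset.mem_inter.1 hx).2⟩
  · have h1 : (H.card : ℝ) ≤ s := by exact_mod_cast hHs
    have h2 : (s:ℝ) ≤ (X.card / a) * Real.log Rs.card + 1 := by
      rw [hs]; push_cast
      have := Nat.floor_le (show 0 ≤ (X.card / a) * Real.log Rs.card by positivity)
      linarith
    have h3 : 1 ≤ (X.card:ℝ) / a := by rw [le_div_iff₀ ha]; linarith
    nlinarith

/-- Bound for the number of rectangles in a dyadic class. -/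
lemma class_bound (Rs : Finset ι) (X : Finset γ) (WR : ι → Finset γ) (BR : ι → γ → Finset γ)
    (pos : ι → ℕ) (a m : ℝ) (J : ℕ) (ha : 0 < a) (hm : 0 < m) (ham : a ≤ 2 * m)
    (hW : ∀ R ∈ Rs, WR R ⊆ X ∧ a ≤ (WR R).card)
    (hB : ∀ R ∈ Rs, ∀ w ∈ WR R, BR R w ⊆ X ∧ m / 4 ≤ (BR R w).card)
    (hpos : ∀ R ∈ Rs, pos R < 2^J)
    (hinj : ∀ R ∈ Rs, ∀ R' ∈ Rs, ∀ w ∈ WR R, w ∈ WR R' → ∀ b ∈ BR R w, b ∈ BR R' w → R = R')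
    (hd1 : ∀ R ∈ Rs, ∀ R' ∈ Rs, ∀ w ∈ WR R, ∀ w' ∈ WR R', ∀ b ∈ BR R w, b ∈ BR R' w' → w ≠ w' →
      R ≠ R' → pos R ≠ pos R')
    (hd2 : ∀ R ∈ Rs, ∀ R' ∈ Rs, ∀ w ∈ WR R, w ∈ WR R' → ∀ b ∈ BR R w, ∀ b' ∈ BR R' w, b ≠ b' →
      R ≠ R' → pos R ≠ pos R')
    (hC : ∀ R11 ∈ Rs, ∀ R12 ∈ Rs, ∀ R21 ∈ Rs, ∀ R22 ∈ Rs, ∀ w w' b b', w ≠ w' → b ≠ b' →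
      w ∈ WR R11 → w ∈ WR R12 → w' ∈ WR R21 → w' ∈ WR R22 →
      b ∈ BR R11 w → b' ∈ BR R12 w → b ∈ BR R21 w' → b' ∈ BR R22 w' →
      R11 ≠ R12 → R11 ≠ R21 → R22 ≠ R12 → R22 ≠ R21 → Cyc (pos R11) (pos R12) (pos R21) (pos R22)) :
    (Rs.card : ℝ)^2 * (a^2 * m) ≤ 25600 * (J+1)^2 * (X.card)^3 * (Real.log Rs.card + 2)^3 := by
  set Λ := Real.log Rs.card + 2 with hΛ
  have hΛ0 : 0 ≤ Λ := by
    rw [hΛ]; have := Real.log_natCast_nonneg Rs.card; linarith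
  rcases Rs.eq_empty_or_nonempty with he | ⟨R0, hR0⟩
  · rw [he]; simp only [Finset.card_empty, Nat.cast_zero, ne_eq, OfNat.ofNat_ne_zero,
      not_false_eq_true, zero_pow, zero_mul]
    positivity
  obtain ⟨W', hW'X, hW', hW'c⟩ := hitting Rs WR X a hW ha
  have : Nonempty γ := ⟨(hW' R0 hR0).choose⟩
  choose! wR hwR hwR' using hW'
  obtain ⟨B', hB'X, hB', hB'c⟩ := hitting Rs (fun R => BR R (wR R)) X (m/4)
    (fun R hR => hB R hR (wR R) (hwR R hR)) (by positivity)
  choose! bR hbR hbR' using hB'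
  have hinj' : Set.InjOn (fun R => (wR R, bR R)) Rs := by
    intro R hR R' hR' h
    simp only [Prod.mk.injEq] at h
    exact hinj R hR R' hR' (wR R) (hwR R hR) (h.1 ▸ hwR R' hR') (bR R) (hbR R hR)
      (by have := hbR R' hR'; rw [← h.1, ← h.2] at this; exact this)
  set G := Rs.image (fun R => (wR R, bR R)) with hG
  have hGc : G.card = Rs.card := Finset.card_image_of_injOn hinj'
  classical
  obtain ⟨x, hx⟩ : ∃ x : γ → γ → ℕ, ∀ R ∈ Rs, x (wR R) (bR R) = pos R := by
    refine ⟨fun w b => if h : ∃ R ∈ Rs, (wR R, bR R) = (w, b) then pos h.choose else 0, ?_⟩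
    intro R hR
    have h : ∃ R' ∈ Rs, (wR R', bR R') = (wR R, bR R) := ⟨R, hR, rfl⟩
    simp only [dif_pos h]
    rw [hinj' h.choose_spec.1 hR h.choose_spec.2]
  have memG : ∀ w b, (w, b) ∈ G → ∃ R ∈ Rs, w = wR R ∧ b = bR R ∧ x w b = pos R := by
    intro w b h
    obtain ⟨R, hR, he⟩ := Finset.mem_image.1 h
    simp only [Prod.mk.injEq] at he
    exact ⟨R, hR, he.1.symm, he.2.symm, by rw [← he.1, ← he.2]; exact hx R hR⟩
  have mt := marcus_tardos (G := G) (x := x) (W := W') (B := B') (J := J) (by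
      intro w w' b b' hw hb g1 g2 g3 g4
      obtain ⟨R1, hR1, e1, f1, p1⟩ := memG _ _ g1
      obtain ⟨R2, hR2, e2, f2, p2⟩ := memG _ _ g2
      obtain ⟨R3, hR3, e3, f3, p3⟩ := memG _ _ g3
      obtain ⟨R4, hR4, e4, f4, p4⟩ := memG _ _ g4
      rw [p1, p2, p3, p4]
      refine hC R1 hR1 R2 hR2 R3 hR3 R4 hR4 w w' b b' hw hb ?_ ?_ ?_ ?_ ?_ ?_ ?_ ?_
        (fun h => hb (by rw [f1, f2, h])) (fun h => hw (by rw [e1, e3, h]))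
        (fun h => hw (by rw [e2, e4, h])) (fun h => hb (by rw [f3, f4, h]))
      · rw [e1]; exact hwR R1 hR1
      · rw [e2]; exact hwR R2 hR2
      · rw [e3]; exact hwR R3 hR3
      · rw [e4]; exact hwR R4 hR4
      · rw [e1, f1]; exact hbR R1 hR1
      · rw [e2, f2]; exact hbR R2 hR2
      · rw [e3, f3]; exact hbR R3 hR3
      · rw [e4, f4]; exact hbR R4 hR4)
    (by
      intro w w' b hw g1 g2
      obtain ⟨R1, hR1, e1, f1, p1⟩ := memG _ _ g1
      obtain ⟨R2, hR2, e2, f2, p2⟩ := memG _ _ g2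
      rw [p1, p2]
      refine hd1 R1 hR1 R2 hR2 w ?_ w' ?_ b ?_ ?_ hw (fun h => hw (by rw [e1, e2, h]))
      · rw [e1]; exact hwR R1 hR1
      · rw [e2]; exact hwR R2 hR2
      · rw [e1, f1]; exact hbR R1 hR1
      · rw [e2, f2]; exact hbR R2 hR2)
    (by
      intro w b b' hb g1 g2
      obtain ⟨R1, hR1, e1, f1, p1⟩ := memG _ _ g1
      obtain ⟨R2, hR2, e2, f2, p2⟩ := memG _ _ g2
      rw [p1, p2]
      refine hd2 R1 hR1 R2 hR2 w ?_ ?_ b ?_ b' ?_ hb (fun h => hb (by rw [f1, f2, h]))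
      · rw [e1]; exact hwR R1 hR1
      · rw [e2]; exact hwR R2 hR2
      · rw [e1, f1]; exact hbR R1 hR1
      · rw [e2, f2]; exact hbR R2 hR2)
    (by
      intro w b g1
      obtain ⟨R1, hR1, e1, f1, p1⟩ := memG _ _ g1
      rw [p1]; exact hpos R1 hR1)
    (by
      intro y hy
      obtain ⟨R, hR, he⟩ := Finset.mem_image.1 hy
      rw [← he]
      exact Finset.mem_product.2 ⟨hwR' R hR, hbR' R hR⟩)
    (max W'.card B'.card) (le_max_left _ _) (le_max_right _ _)
  rw [hGc] at mt
  have mt' : (Rs.card : ℝ)^2 ≤ 100 * (J+1)^2 * (max W'.card B'.card : ℕ)^2 * B'.card := by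
    exact_mod_cast mt
  set n := max W'.card B'.card
  set N : ℝ := (X.card : ℝ)
  have hN0 : 0 ≤ N := by positivity
  have hBb : (B'.card : ℝ) * m ≤ 4 * N * Λ := by
    calc (B'.card : ℝ) * m ≤ (N / (m/4) * Λ) * m := mul_le_mul_of_nonneg_right hB'c hm.le
      _ = 4 * N * Λ := by field_simp
  have hn : (n : ℝ) * a ≤ 8 * N * Λ := by
    have h1 : (W'.card : ℝ) * a ≤ N * Λ := by
      calc (W'.card : ℝ) * a ≤ (N / a * Λ) * a := mul_le_mul_of_nonneg_right hW'c ha.le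
        _ = N * Λ := by field_simp
    have h2 : (B'.card : ℝ) * a ≤ 8 * N * Λ := by
      calc (B'.card : ℝ) * a ≤ B'.card * (2 * m) := mul_le_mul_of_nonneg_left ham (by positivity)
        _ ≤ 8 * N * Λ := by linarith
    have h3 : 0 ≤ N * Λ := by positivity
    rcases max_choice W'.card B'.card with h | h
    · rw [show n = W'.card from h]; linarith
    · rw [show n = B'.card from h]; linarith
  calc (Rs.card : ℝ)^2 * (a^2 * m) ≤ (100 * (J+1)^2 * n^2 * B'.card) * (a^2 * m) :=
        mul_le_mul_of_nonneg_right mt' (by positivity)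
    _ = 100 * (J+1)^2 * (n * a)^2 * (B'.card * m) := by ring
    _ ≤ 100 * (J+1)^2 * (8 * N * Λ)^2 * (4 * N * Λ) := by
        gcongr
    _ = _ := by ring
end hit
end WM

namespace WM

section star
variable {ι γ κ : Type*} [DecidableEq ι] [DecidableEq γ] [DecidableEq κ]

lemma star_arith (Zc J u v N : ℕ) (L Λ : ℝ) (hL0 : 0 ≤ L) (hL : L ≤ Λ) (hΛ0 : 0 ≤ Λ)
    (cb : (Zc:ℝ)^2 * ((2^u)^2 * 2^v) ≤ 25600 * (J+1)^2 * (N)^3 * L^3) :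
    (Zc:ℝ) * (2 * 2^u * √(2 * 2^v)) ≤ 453 * (J+1) * √((N:ℝ)^3 * Λ^3) := by
  refine le_of_sq_le_sq ?_ (by positivity)
  have s1 : (√(2 * 2^v))^2 = (2:ℝ) * 2^v := Real.sq_sqrt (by positivity)
  have s2 : (√((N:ℝ)^3 * Λ^3))^2 = (N:ℝ)^3 * Λ^3 := Real.sq_sqrt (by positivity)
  calc ((Zc:ℝ) * (2 * 2^u * √(2 * 2^v)))^2 = 4 * (Zc:ℝ)^2 * (2^u)^2 * (√(2 * 2^v))^2 := by ring
    _ = 8 * ((Zc:ℝ)^2 * ((2^u)^2 * 2^v)) := by rw [s1]; ring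
    _ ≤ 8 * (25600 * (J+1)^2 * (N)^3 * L^3) := by
        apply mul_le_mul_of_nonneg_left cb (by norm_num)
    _ ≤ 8 * (25600 * (J+1)^2 * (N)^3 * Λ^3) := by
        gcongr
    _ ≤ (453 * (J+1))^2 * (N^3 * Λ^3) := by
        have : 0 ≤ ((J:ℝ)+1)^2 * (N)^3 * Λ^3 := by positivity
        nlinarith
    _ = (453 * (J+1) * √(N^3 * Λ^3))^2 := by rw [mul_pow _ (√_), s2]

set_option maxHeartbeats 2000000 in
lemma star_abs (Rs : Finset ι) (X : Finset γ) (WR : ι → Finset γ) (BR : ι → γ → Finset γ)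
    (M : ι → ℕ) (pos : ι → ℕ) (J : ℕ) (col : ι → κ) (Cs : Finset κ) (hcol : ∀ R ∈ Rs, col R ∈ Cs)
    (hW : ∀ R ∈ Rs, WR R ⊆ X) (hWM : ∀ R ∈ Rs, (WR R).card ≤ M R) (hMN : ∀ R ∈ Rs, M R ≤ X.card)
    (hB : ∀ R ∈ Rs, ∀ w ∈ WR R, BR R w ⊆ X ∧ M R ≤ 4 * (BR R w).card)
    (hpos : ∀ R ∈ Rs, pos R < 2^J)
    (hinj : ∀ R ∈ Rs, ∀ R' ∈ Rs, col R = col R' → ∀ w ∈ WR R, w ∈ WR R' → ∀ b ∈ BR R w, b ∈ BR R' w → R = R')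
    (hd1 : ∀ R ∈ Rs, ∀ R' ∈ Rs, col R = col R' → ∀ w ∈ WR R, ∀ w' ∈ WR R', ∀ b ∈ BR R w, b ∈ BR R' w' → w ≠ w' →
      R ≠ R' → pos R ≠ pos R')
    (hd2 : ∀ R ∈ Rs, ∀ R' ∈ Rs, col R = col R' → ∀ w ∈ WR R, w ∈ WR R' → ∀ b ∈ BR R w, ∀ b' ∈ BR R' w, b ≠ b' →
      R ≠ R' → pos R ≠ pos R')
    (hC : ∀ R11 ∈ Rs, ∀ R12 ∈ Rs, ∀ R21 ∈ Rs, ∀ R22 ∈ Rs,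
      col R11 = col R12 → col R11 = col R21 → col R11 = col R22 → ∀ w w' b b', w ≠ w' → b ≠ b' →
      w ∈ WR R11 → w ∈ WR R12 → w' ∈ WR R21 → w' ∈ WR R22 →
      b ∈ BR R11 w → b' ∈ BR R12 w → b ∈ BR R21 w' → b' ∈ BR R22 w' →
      R11 ≠ R12 → R11 ≠ R21 → R22 ≠ R12 → R22 ≠ R21 → Cyc (pos R11) (pos R12) (pos R21) (pos R22)) :
    ∑ R ∈ Rs, ((WR R).card : ℝ) * √(M R) ≤
      Cs.card * (Nat.log 2 X.card + 1)^2 * (453 * (J+1) * √((X.card)^3 * (Real.log Rs.card + 2)^3)) := by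
  set Λ := Real.log Rs.card + 2 with hΛ
  set N := X.card with hN
  have hΛ0 : 0 ≤ Λ := by
    rw [hΛ]; have := Real.log_natCast_nonneg Rs.card; linarith
  set Rs' := Rs.filter (fun R => 0 < (WR R).card) with hRs'
  have e0 : ∑ R ∈ Rs, ((WR R).card : ℝ) * √(M R) = ∑ R ∈ Rs', ((WR R).card : ℝ) * √(M R) := by
    symm; apply Finset.sum_filter_of_ne
    intro R _ h
    by_contra hc
    have : (WR R).card = 0 := by omega
    rw [this] at h; simp at h
  set T := Cs ×ˢ (Finset.range (Nat.log 2 N + 1) ×ˢ Finset.range (Nat.log 2 N + 1)) with hT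
  set cl : ι → κ × (ℕ × ℕ) := fun R => (col R, (Nat.log 2 (WR R).card, Nat.log 2 (M R))) with hcl
  have hmap : ∀ R ∈ Rs', cl R ∈ T := by
    intro R hR
    have hR1 := (Finset.mem_filter.1 hR).1
    simp only [hT, hcl, Finset.mem_product, Finset.mem_range]
    refine ⟨hcol R hR1, ?_, ?_⟩
    · exact Nat.lt_succ_of_le (Nat.log_mono_right ((hWM R hR1).trans (hMN R hR1)))
    · exact Nat.lt_succ_of_le (Nat.log_mono_right (hMN R hR1))
  rw [e0, ← Finset.sum_fiberwise_of_maps_to hmap]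
  have key : ∀ c ∈ T, ∑ R ∈ Rs' with cl R = c, ((WR R).card : ℝ) * √(M R) ≤
      453 * (J+1) * √(N^3 * Λ^3) := by
    rintro ⟨c, u, v⟩ hc
    set Z := Rs'.filter (fun R => cl R = (c, u, v)) with hZ
    have hZm : ∀ R ∈ Z, R ∈ Rs ∧ 0 < (WR R).card ∧ col R = c ∧ Nat.log 2 (WR R).card = u ∧ Nat.log 2 (M R) = v := by
      intro R hR
      simp only [hZ, hRs', hcl, Finset.mem_filter, Prod.mk.injEq] at hR
      exact ⟨hR.1.1, hR.1.2, hR.2.1, hR.2.2.1, hR.2.2.2⟩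
    rcases Z.eq_empty_or_nonempty with he | ⟨R0, hR0⟩
    · rw [he]; simp; positivity
    have hlow : ∀ R ∈ Z, 2^u ≤ (WR R).card ∧ (WR R).card ≤ 2 * 2^u ∧ 2^v ≤ M R ∧ M R ≤ 2 * 2^v := by
      intro R hR
      obtain ⟨h1, h2, h3, h4, h5⟩ := hZm R hR
      have h6 : 0 < M R := lt_of_lt_of_le h2 (hWM R h1)
      refine ⟨?_, ?_, ?_, ?_⟩
      · rw [← h4]; exact Nat.pow_log_le_self 2 h2.ne'
      · rw [← h4]; have := Nat.lt_pow_succ_log_self (b := 2) (by norm_num) (WR R).card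
        rw [pow_succ] at this; omega
      · rw [← h5]; exact Nat.pow_log_le_self 2 h6.ne'
      · rw [← h5]; have := Nat.lt_pow_succ_log_self (b := 2) (by norm_num) (M R)
        rw [pow_succ] at this; omega
    have cb := class_bound Z X WR BR pos ((2:ℝ)^u) ((2:ℝ)^v) J (by positivity) (by positivity)
      (by
        obtain ⟨h1, h2, h3, h4⟩ := hlow R0 hR0
        have h5 := hWM R0 (hZm R0 hR0).1
        have : 2^u ≤ 2 * 2^v := h1.trans (h5.trans h4)
        exact_mod_cast this)
      (fun R hR => ⟨hW R (hZm R hR).1, by exact_mod_cast (hlow R hR).1⟩)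
      (fun R hR w hw => ⟨(hB R (hZm R hR).1 w hw).1, by
        have h1 := (hB R (hZm R hR).1 w hw).2
        have h2 := (hlow R hR).2.2.1
        have h3 : ((2:ℝ)^v) ≤ 4 * (BR R w).card := by exact_mod_cast h2.trans h1
        linarith⟩)
      (fun R hR => hpos R (hZm R hR).1)
      (fun R hR R' hR' => hinj R (hZm R hR).1 R' (hZm R' hR').1 ((hZm R hR).2.2.1.trans (hZm R' hR').2.2.1.symm))
      (fun R hR R' hR' => hd1 R (hZm R hR).1 R' (hZm R' hR').1 ((hZm R hR).2.2.1.trans (hZm R' hR').2.2.1.symm))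
      (fun R hR R' hR' => hd2 R (hZm R hR).1 R' (hZm R' hR').1 ((hZm R hR).2.2.1.trans (hZm R' hR').2.2.1.symm))
      (fun R1 h1 R2 h2 R3 h3 R4 h4 => hC R1 (hZm R1 h1).1 R2 (hZm R2 h2).1 R3 (hZm R3 h3).1 R4 (hZm R4 h4).1
        ((hZm R1 h1).2.2.1.trans (hZm R2 h2).2.2.1.symm) ((hZm R1 h1).2.2.1.trans (hZm R3 h3).2.2.1.symm)
        ((hZm R1 h1).2.2.1.trans (hZm R4 h4).2.2.1.symm))
    have hlog : Real.log Z.card + 2 ≤ Λ := by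
      have : Real.log Z.card ≤ Real.log Rs.card := by
        apply Real.log_le_log
        · exact_mod_cast Finset.card_pos.2 ⟨R0, hR0⟩
        · exact_mod_cast Finset.card_le_card (fun R hR => (hZm R hR).1)
      rw [hΛ]; linarith
    have hlog0 : 0 ≤ Real.log Z.card + 2 := by
      have := Real.log_natCast_nonneg Z.card; linarith
    have hsum : ∑ R ∈ Z, ((WR R).card : ℝ) * √(M R) ≤ Z.card * (2 * 2^u * √(2 * 2^v)) := by
      rw [← nsmul_eq_mul]
      apply Finset.sum_le_card_nsmul
      intro R hR
      obtain ⟨h1, h2, h3, h4⟩ := hlow R hR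
      apply mul_le_mul
      · exact_mod_cast h2
      · apply Real.sqrt_le_sqrt; exact_mod_cast h4
      · positivity
      · positivity
    refine hsum.trans ?_
    exact star_arith Z.card J u v N (Real.log Z.card + 2) Λ hlog0 (by assumption) hΛ0 cb
  refine (Finset.sum_le_card_nsmul _ _ _ key).trans ?_
  rw [nsmul_eq_mul, hT, Finset.card_product, Finset.card_product, Finset.card_range]
  push_cast
  rw [← sq]
end star
end WM

namespace WM

lemma mvt {u : ℝ → ℝ} (hu : Differentiable ℝ u) (x y : ℝ) :
    ∃ ξ, min x y ≤ ξ ∧ ξ ≤ max x y ∧ 0 ≤ (ξ - y) * (x - y) ∧ u x - u y = deriv u ξ * (x - y) := by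
  rcases lt_trichotomy x y with h | h | h
  · obtain ⟨ξ, hξ, he⟩ := exists_deriv_eq_slope u h hu.continuous.continuousOn hu.differentiableOn
    refine ⟨ξ, by simp [hξ.1.le], by simp [hξ.2.le], ?_, ?_⟩
    · nlinarith [hξ.1, hξ.2]
    · rw [he]; field_simp [sub_ne_zero.2 h.ne']; 
      ring
  · subst h; exact ⟨x, by simp, by simp, by simp, by simp⟩
  · obtain ⟨ξ, hξ, he⟩ := exists_deriv_eq_slope u h hu.continuous.continuousOn hu.differentiableOn
    refine ⟨ξ, by simp [hξ.1.le], by simp [hξ.2.le], ?_, ?_⟩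
    · nlinarith [hξ.1, hξ.2]
    · rw [he, div_mul_cancel₀ _ (sub_ne_zero.2 h.ne')]

lemma c2_diff {h : ℝ → ℝ} (hC : ContDiff ℝ 2 h) :
    Differentiable ℝ h ∧ Differentiable ℝ (deriv h) ∧ Continuous (deriv (deriv h)) := by
  have h1 : ContDiff ℝ 1 (deriv h) := by
    have : ContDiff ℝ (1+1) h := by simpa [one_add_one_eq_two] using hC
    exact (contDiff_succ_iff_deriv.1 this).2.2
  refine ⟨hC.differentiable (by norm_num), h1.differentiable (by norm_num), ?_⟩
  exact h1.continuous_deriv (by norm_num)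

lemma mem_of_between {a b x y ξ : ℝ} (hx : x ∈ Icc a b) (hy : y ∈ Icc a b)
    (h1 : min x y ≤ ξ) (h2 : ξ ≤ max x y) : ξ ∈ Icc a b :=
  ⟨(le_min hx.1 hy.1).trans h1, h2.trans (max_le hx.2 hy.2)⟩

lemma lip_bound {u : ℝ → ℝ} (hu : Differentiable ℝ u) {a b M η : ℝ} (hM : ∀ θ ∈ Icc a b, |deriv u θ| ≤ M)
    {x y : ℝ} (hx : x ∈ Icc a b) (hy : y ∈ Icc a b) (hη : |x - y| ≤ η) : |u x - u y| ≤ M * η := by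
  obtain ⟨ξ, h1, h2, _, h3⟩ := mvt hu x y
  have hξ := hM ξ (mem_of_between hx hy h1 h2)
  rw [h3, abs_mul]
  exact mul_le_mul hξ hη (abs_nonneg _) ((abs_nonneg _).trans hξ)

lemma zero_between {u : ℝ → ℝ} (hu : Continuous u) {x y : ℝ} (hxy : x < y) (h : u x * u y < 0) :
    ∃ z, x < z ∧ z < y ∧ u z = 0 := by
  have h0 : (0:ℝ) ∈ uIcc (u x) (u y) := by
    rw [mem_uIcc]
    rcases le_total 0 (u x) with h1 | h1 <;> rcases le_total 0 (u y) with h2 | h2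
    · nlinarith
    · right; exact ⟨h2, h1⟩
    · left; exact ⟨h1, h2⟩
    · nlinarith
  obtain ⟨z, hz, hz0⟩ := intermediate_value_uIcc hu.continuousOn h0
  rw [uIcc_of_le hxy.le] at hz
  refine ⟨z, lt_of_le_of_ne hz.1 ?_, lt_of_le_of_ne hz.2 ?_, hz0⟩
  · rintro rfl; rw [hz0] at h; simp at h
  · rintro rfl; rw [hz0] at h; simp at h

lemma abs_sub_le_len {a b x y : ℝ} (hx : x ∈ Icc a b) (hy : y ∈ Icc a b) : |x - y| ≤ b - a := by
  rw [abs_le]; constructor <;> linarith [hx.1, hx.2, hy.1, hy.2]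

/-- `h` behaves like a difference of two cinematic functions at distance `d`. -/
structure GH (a b K d : ℝ) (h : ℝ → ℝ) : Prop where
  hC : ContDiff ℝ 2 h
  hK : 1 ≤ K
  len : 1000 * K^2 * (b - a) ≤ 1
  up : ∀ θ ∈ Icc a b, |h θ| + |deriv h θ| + |deriv (deriv h) θ| ≤ K * d
  lo : ∀ θ ∈ Icc a b, d ≤ K * (|h θ| + |deriv h θ| + |deriv (deriv h) θ|)

lemma GH.neg {a b K d : ℝ} {h : ℝ → ℝ} (H : GH a b K d h) : GH a b K d (fun x => - h x) := by
  have e1 : deriv (fun x => - h x) = fun x => - deriv h x := by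
    funext x; exact deriv.fun_neg
  have e2 : deriv (deriv (fun x => - h x)) = fun x => - deriv (deriv h) x := by
    rw [e1]; funext x; exact deriv.fun_neg
  refine ⟨H.hC.neg, H.hK, H.len, ?_, ?_⟩
  · intro θ hθ; rw [e2, e1]; simpa using H.up θ hθ
  · intro θ hθ; rw [e2, e1]; simpa using H.lo θ hθ

lemma GH.no_alt {a b K d : ℝ} {h : ℝ → ℝ} (H : GH a b K d h) {x1 x2 x3 x4 : ℝ}
    (m1 : x1 ∈ Icc a b) (m4 : x4 ∈ Icc a b) (h12 : x1 < x2) (h23 : x2 < x3) (h34 : x3 < x4)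
    (s1 : 0 < h x1) (s2 : h x2 < 0) (s3 : 0 < h x3) (s4 : h x4 < 0) : False := by
  obtain ⟨D0, D1, D2⟩ := c2_diff H.hC
  have hd : 0 < K * d := by
    have := H.up x1 m1
    have := abs_pos_of_pos s1
    have := abs_nonneg (deriv h x1)
    have := abs_nonneg (deriv (deriv h) x1)
    linarith
  obtain ⟨z1, a1, b1, c1⟩ := zero_between D0.continuous h12 (by nlinarith)
  obtain ⟨z2, a2, b2, c2⟩ := zero_between D0.continuous h23 (by nlinarith)
  obtain ⟨z3, a3, b3, c3⟩ := zero_between D0.continuous h34 (by nlinarith)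
  obtain ⟨y1, hy1, e1⟩ := exists_deriv_eq_zero (f := h) (b1.trans a2) D0.continuous.continuousOn (c1.trans c2.symm)
  obtain ⟨y2, hy2, e2⟩ := exists_deriv_eq_zero (f := h) (b2.trans a3) D0.continuous.continuousOn (c2.trans c3.symm)
  obtain ⟨y, hy, e⟩ := exists_deriv_eq_zero (f := deriv h) (hy1.2.trans hy2.1) D1.continuous.continuousOn (e1.trans e2.symm)
  have my : y ∈ Icc a b := ⟨by linarith [m1.1, hy.1, hy1.1], by linarith [m4.2, hy.2, hy2.2]⟩
  have mz : z2 ∈ Icc a b := ⟨by linarith [m1.1], by linarith [m4.2]⟩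
  have my1 : y1 ∈ Icc a b := ⟨by linarith [m1.1, hy.1, hy1.1], by linarith [m4.2, hy1.2]⟩
  have B1 : |h y - h z2| ≤ K * d * (b - a) := lip_bound D0 (fun θ hθ => by
    have := H.up θ hθ
    have := abs_nonneg (h θ)
    have := abs_nonneg (deriv (deriv h) θ)
    linarith) my mz (abs_sub_le_len my mz)
  have B2 : |deriv h y - deriv h y1| ≤ K * d * (b - a) := lip_bound D1 (fun θ hθ => by
    have := H.up θ hθ
    have := abs_nonneg (h θ)
    have := abs_nonneg (deriv h θ)
    linarith) my my1 (abs_sub_le_len my my1)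
  rw [c2, sub_zero] at B1
  rw [e1, sub_zero] at B2
  have := H.lo y my
  rw [e, abs_zero, add_zero] at this
  have hK := H.hK
  have hd' : 0 < d := by
    by_contra hc
    nlinarith
  have : d ≤ K * (2 * (K * d * (b - a))) := this.trans (by gcongr; linarith)
  have := H.len
  nlinarith

lemma GH.const_sign {a b K d : ℝ} {h : ℝ → ℝ} (H : GH a b K d h) {x t Δ : ℝ} (hx : x ∈ Icc a b)
    (ht : 0 < t) (hd : t / 8 < d) (hΔ : 640 * K * Δ ≤ t) (h0 : |h x| ≤ 10 * Δ) (h1 : |deriv h x| ≤ 10 * Δ) :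
    (∀ θ ∈ Icc a b, t / (16 * K) ≤ deriv (deriv h) θ) ∨
    (∀ θ ∈ Icc a b, deriv (deriv h) θ ≤ - (t / (16 * K))) := by
  obtain ⟨D0, D1, D2⟩ := c2_diff H.hC
  have hK := H.hK
  have hlen := H.len
  have habs : ∀ θ ∈ Icc a b, t / (16 * K) ≤ |deriv (deriv h) θ| := by
    intro θ hθ
    have B1 : |h θ - h x| ≤ K * d * (b - a) := lip_bound D0 (fun θ hθ => by
      have := H.up θ hθ
      have := abs_nonneg (h θ)
      have := abs_nonneg (deriv (deriv h) θ)
      linarith) hθ hx (abs_sub_le_len hθ hx)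
    have B2 : |deriv h θ - deriv h x| ≤ K * d * (b - a) := lip_bound D1 (fun θ hθ => by
      have := H.up θ hθ
      have := abs_nonneg (h θ)
      have := abs_nonneg (deriv h θ)
      linarith) hθ hx (abs_sub_le_len hθ hx)
    have C1 : |h θ| ≤ 10 * Δ + K * d * (b - a) := by
      have := abs_sub_abs_le_abs_sub (h θ) (h x); linarith
    have C2 : |deriv h θ| ≤ 10 * Δ + K * d * (b - a) := by
      have := abs_sub_abs_le_abs_sub (deriv h θ) (deriv h x); linarith
    have L := H.lo θ hθ
    rw [div_le_iff₀ (by positivity)]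
    have : K * (|h θ| + |deriv h θ|) ≤ K * (20 * Δ + 2 * (K * d * (b - a))) :=
      mul_le_mul_of_nonneg_left (by linarith) (by linarith)
    nlinarith
  have hpos : 0 < t / (16 * K) := by positivity
  have ns : ∀ θ ∈ Icc a b, ∀ θ' ∈ Icc a b, 0 < deriv (deriv h) θ → deriv (deriv h) θ' < 0 → False := by
    intro θ hθ θ' hθ' p1 p2
    rcases lt_trichotomy θ θ' with h | h | h
    · obtain ⟨z, q1, q2, q3⟩ := zero_between D2 h (by nlinarith)
      have := habs z ⟨by linarith [hθ.1], by linarith [hθ'.2]⟩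
      rw [q3, abs_zero] at this; linarith
    · subst h; linarith
    · obtain ⟨z, q1, q2, q3⟩ := zero_between D2 h (by nlinarith)
      have := habs z ⟨by linarith [hθ'.1], by linarith [hθ.2]⟩
      rw [q3, abs_zero] at this; linarith
  have hx' := habs x hx
  rcases le_abs.1 hx' with hx1 | hx1
  · left
    intro θ hθ
    rcases le_abs.1 (habs θ hθ) with h2 | h2
    · exact h2
    · exact (ns x hx θ hθ (by linarith) (by linarith)).elim
  · right
    intro θ hθ
    rcases le_abs.1 (habs θ hθ) with h2 | h2
    · exact (ns θ hθ x hx (by linarith) (by linarith)).elim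
    · linarith

lemma taylor_lower {h : ℝ → ℝ} (hC : ContDiff ℝ 2 h) {a b c x y : ℝ} (hc : ∀ θ ∈ Icc a b, c ≤ deriv (deriv h) θ)
    (hx : x ∈ Icc a b) (hy : y ∈ Icc a b) : h y + deriv h y * (x - y) + c / 2 * (x - y)^2 ≤ h x := by
  obtain ⟨D0, D1, D2⟩ := c2_diff hC
  set g : ℝ → ℝ := fun s => h s - c / 2 * (s - y)^2 with hg
  have dg : ∀ s, HasDerivAt g (deriv h s - c * (s - y)) s := by
    intro s
    have h1 : HasDerivAt (fun s => c / 2 * (s - y)^2) (c / 2 * (2 * (s - y))) s := by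
      have := (((hasDerivAt_id s).sub_const y).pow 2).const_mul (c/2)
      simpa using this
    have := (D0 s).hasDerivAt.sub h1
    exact this.congr_deriv (by ring)
  have gd : Differentiable ℝ g := fun s => (dg s).differentiableAt
  obtain ⟨ξ, p1, p2, p3, p4⟩ := mvt gd x y
  have mξ := mem_of_between hx hy p1 p2
  rw [(dg ξ).deriv] at p4
  obtain ⟨τ, q1, q2, q3, q4⟩ := mvt D1 ξ y
  have mτ := mem_of_between mξ hy q1 q2
  have hcτ := hc τ mτ
  have e1 : g x = h x - c / 2 * (x - y)^2 := rfl
  have e2 : g y = h y := by simp [hg]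
  have : deriv h ξ - c * (ξ - y) = deriv h y + (deriv (deriv h) τ - c) * (ξ - y) := by linarith
  rw [this] at p4
  have : 0 ≤ (deriv (deriv h) τ - c) * ((ξ - y) * (x - y)) := mul_nonneg (by linarith) p3
  nlinarith

lemma lens {h : ℝ → ℝ} (hC : ContDiff ℝ 2 h) {a b K t Δ ρ q x y : ℝ} (hK : 1 ≤ K) (ht : 0 < t) (hΔ : 0 < Δ)
    (hρ : ρ * t = Δ^2) (hq : 10240 * K^2 ≤ q)
    (hc : ∀ θ ∈ Icc a b, t / (16 * K) ≤ deriv (deriv h) θ)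
    (hx : x ∈ Icc a b) (hy : y ∈ Icc a b) (h0 : |h y| ≤ 10 * ρ) (h1 : |deriv h y| ≤ 10 * Δ)
    (hxy : q * (Δ / (8 * K * t)) ≤ |x - y|) : 20 * ρ ≤ h x := by
  have T := taylor_lower hC hc hx hy
  set s := |x - y| with hs
  have hs2 : (x - y)^2 = s^2 := (sq_abs _).symm
  have hKt : 0 < 8 * K * t := by positivity
  have hs1 : q * Δ ≤ s * (8 * K * t) := by
    rw [← mul_div_assoc, div_le_iff₀ hKt] at hxy; exact hxy
  have hs0 : 0 ≤ s := abs_nonneg _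
  have A1 : - (10 * Δ * s) ≤ deriv h y * (x - y) := by
    have : |deriv h y * (x - y)| ≤ 10 * Δ * s := by
      rw [abs_mul]; gcongr
    exact (abs_le.1 this).1
  have A2 : - (10 * ρ) ≤ h y := (abs_le.1 h0).1
  have A3 : 40 * Δ ≤ t / (16 * K) / 2 * s := by
    rw [div_div, div_mul_eq_mul_div, le_div_iff₀ (by positivity)]
    have : 10240 * K^2 * Δ ≤ s * (8 * K * t) := le_trans (by gcongr) hs1
    have : K * (1280 * K * Δ) ≤ K * (t * s) := by linarith
    have := le_of_mul_le_mul_left this (by linarith)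
    linarith
  have A4 : 40 * Δ * s ≤ t / (16 * K) / 2 * s^2 := by nlinarith
  have A5 : ρ ≤ Δ * s := by
    have e : (Δ * s) * (8 * K * t) ≥ ρ * (8 * K * t) := by
      have : Δ * (q * Δ) ≤ Δ * (s * (8 * K * t)) := by gcongr
      have h8 : 8 * K ≤ q := by nlinarith
      have : ρ * (8 * K * t) = 8 * K * Δ^2 := by rw [← hρ]; ring
      nlinarith [sq_nonneg Δ]
    exact le_of_mul_le_mul_right e hKt
  rw [hs2] at T
  linarith
end WM

namespace WM

set_option maxHeartbeats 1000000 in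
lemma cyc_of_signs {p1 p2 q1 q2 : ℕ} (S : Set ℕ) (A B : ℕ → ℝ)
    (m1 : p1 ∈ S) (m2 : p2 ∈ S) (m3 : q1 ∈ S) (m4 : q2 ∈ S)
    (hA : ∀ x y z w : ℕ, x ∈ S → w ∈ S → x < y → y < z → z < w →
      ¬ (0 < A x ∧ A y < 0 ∧ 0 < A z ∧ A w < 0) ∧ ¬ (A x < 0 ∧ 0 < A y ∧ A z < 0 ∧ 0 < A w))
    (hB : ∀ x y z w : ℕ, x ∈ S → w ∈ S → x < y → y < z → z < w →
      ¬ (0 < B x ∧ B y < 0 ∧ 0 < B z ∧ B w < 0) ∧ ¬ (B x < 0 ∧ 0 < B y ∧ B z < 0 ∧ 0 < B w))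
    (A1 : 0 < A p1) (A2 : 0 < A p2) (A3 : A q1 < 0) (A4 : A q2 < 0)
    (B1 : 0 < B p1) (B2 : B p2 < 0) (B3 : 0 < B q1) (B4 : B q2 < 0) : Cyc p1 p2 q1 q2 := by
  have n1 : p1 ≠ q1 := by rintro rfl; linarith
  have n2 : p1 ≠ q2 := by rintro rfl; linarith
  have n3 : p2 ≠ q1 := by rintro rfl; linarith
  have n4 : p2 ≠ q2 := by rintro rfl; linarith
  have n5 : p1 ≠ p2 := by rintro rfl; linarith
  have n6 : q1 ≠ q2 := by rintro rfl; linarith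
  have a1 : ∀ x y z w : ℕ, x ∈ S → w ∈ S → 0 < A x → A y < 0 → 0 < A z → A w < 0 →
      ¬ (x < y ∧ y < z ∧ z < w) ∧ ¬ (w < z ∧ z < y ∧ y < x) := fun x y z w hx hw u1 u2 u3 u4 =>
    ⟨fun ⟨h1, h2, h3⟩ => (hA x y z w hx hw h1 h2 h3).1 ⟨u1, u2, u3, u4⟩,
     fun ⟨h1, h2, h3⟩ => (hA w z y x hw hx h1 h2 h3).2 ⟨u4, u3, u2, u1⟩⟩
  have b1 : ∀ x y z w : ℕ, x ∈ S → w ∈ S → 0 < B x → B y < 0 → 0 < B z → B w < 0 →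
      ¬ (x < y ∧ y < z ∧ z < w) ∧ ¬ (w < z ∧ z < y ∧ y < x) := fun x y z w hx hw u1 u2 u3 u4 =>
    ⟨fun ⟨h1, h2, h3⟩ => (hB x y z w hx hw h1 h2 h3).1 ⟨u1, u2, u3, u4⟩,
     fun ⟨h1, h2, h3⟩ => (hB w z y x hw hx h1 h2 h3).2 ⟨u4, u3, u2, u1⟩⟩
  have c1 := a1 p1 q1 p2 q2 m1 m4 A1 A3 A2 A4
  have c2 := a1 p1 q2 p2 q1 m1 m3 A1 A4 A2 A3
  have c3 := a1 p2 q1 p1 q2 m2 m4 A2 A3 A1 A4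
  have c4 := a1 p2 q2 p1 q1 m2 m3 A2 A4 A1 A3
  have d1 := b1 p1 p2 q1 q2 m1 m4 B1 B2 B3 B4
  have d2 := b1 p1 q2 q1 p2 m1 m2 B1 B4 B3 B2
  have d3 := b1 q1 p2 p1 q2 m3 m4 B3 B2 B1 B4
  have d4 := b1 q1 q2 p1 p2 m3 m2 B3 B4 B1 B2
  clear a1 b1 hA hB
  unfold Cyc
  rcases lt_or_gt_of_ne n1 with h1 | h1 <;> rcases lt_or_gt_of_ne n2 with h2 | h2 <;>
  rcases lt_or_gt_of_ne n3 with h3 | h3 <;> rcases lt_or_gt_of_ne n4 with h4 | h4 <;>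
  rcases lt_or_gt_of_ne n5 with h5 | h5 <;> rcases lt_or_gt_of_ne n6 with h6 | h6 <;>
  simp only [h1, h2, h3, h4, h5, h6, h1.not_gt, h2.not_gt, h3.not_gt, h4.not_gt, h5.not_gt, h6.not_gt, true_and, and_true,
    false_and, and_false, or_true, true_or, or_false, false_or, and_self, not_true_eq_false, not_false_eq_true] at c1 c2 c3 c4 d1 d2 d3 d4 ⊢

/-- pointwise `C²` distance -/
noncomputable def dd (θ : ℝ) (f g : ℝ → ℝ) : ℝ :=
  |f θ - g θ| + |deriv f θ - deriv g θ| + |deriv (deriv f) θ - deriv (deriv g) θ|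

structure Good (a b K : ℝ) (F : Finset (ℝ → ℝ)) : Prop where
  hK : 1 ≤ K
  hab : a ≤ b
  len : 1000 * K^2 * (b - a) ≤ 1
  smooth : ∀ f ∈ F, ContDiff ℝ 2 f
  lo : ∀ f ∈ F, ∀ g ∈ F, ∀ θ ∈ Icc a b, dd a f g ≤ K * dd θ f g
  hi : ∀ f ∈ F, ∀ g ∈ F, ∀ θ ∈ Icc a b, dd θ f g ≤ K * dd a f g

lemma deriv_lc {f g : ℝ → ℝ} (hf : Differentiable ℝ f) (hg : Differentiable ℝ g) (σ : ℝ) :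
    deriv (fun x => σ * (f x - g x)) = fun x => σ * (deriv f x - deriv g x) := by
  funext x
  exact (((hf x).hasDerivAt.sub (hg x).hasDerivAt).const_mul σ).deriv

lemma deriv_lc2 {f g : ℝ → ℝ} (hf : ContDiff ℝ 2 f) (hg : ContDiff ℝ 2 g) (σ : ℝ) :
    deriv (fun x => σ * (f x - g x)) = (fun x => σ * (deriv f x - deriv g x)) ∧
    deriv (deriv (fun x => σ * (f x - g x))) = fun x => σ * (deriv (deriv f) x - deriv (deriv g) x) := by
  have h1 := deriv_lc (c2_diff hf).1 (c2_diff hg).1 σ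
  refine ⟨h1, ?_⟩
  rw [h1]; exact deriv_lc (c2_diff hf).2.1 (c2_diff hg).2.1 σ

lemma Good.gh {a b K : ℝ} {F : Finset (ℝ → ℝ)} (H : Good a b K F) {f g : ℝ → ℝ} (hf : f ∈ F) (hg : g ∈ F)
    {σ : ℝ} (hσ : |σ| = 1) : GH a b K (dd a f g) (fun x => σ * (f x - g x)) := by
  obtain ⟨e1, e2⟩ := deriv_lc2 (H.smooth f hf) (H.smooth g hg) σ
  refine ⟨contDiff_const.mul ((H.smooth f hf).sub (H.smooth g hg)), H.hK, H.len, ?_, ?_⟩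
  · intro θ hθ
    rw [e2, e1]; simp only [abs_mul, hσ, one_mul]
    exact H.hi f hf g hg θ hθ
  · intro θ hθ
    rw [e2, e1]; simp only [abs_mul, hσ, one_mul]
    exact H.lo f hf g hg θ hθ

lemma Good.noalt {a b K : ℝ} {F : Finset (ℝ → ℝ)} (H : Good a b K F) {f g : ℝ → ℝ} (hf : f ∈ F) (hg : g ∈ F)
    {σ : ℝ} (hσ : |σ| = 1) {ℓ : ℝ} (hℓ : 0 < ℓ) (x y z w : ℕ) (hx : x ∈ {k : ℕ | a + k * ℓ ≤ b})
    (hw : w ∈ {k : ℕ | a + k * ℓ ≤ b}) (hxy : x < y) (hyz : y < z) (hzw : z < w) :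
    ¬ (0 < (fun k : ℕ => σ * (f (a + k * ℓ) - g (a + k * ℓ))) x ∧
       (fun k : ℕ => σ * (f (a + k * ℓ) - g (a + k * ℓ))) y < 0 ∧
       0 < (fun k : ℕ => σ * (f (a + k * ℓ) - g (a + k * ℓ))) z ∧
       (fun k : ℕ => σ * (f (a + k * ℓ) - g (a + k * ℓ))) w < 0) ∧
    ¬ ((fun k : ℕ => σ * (f (a + k * ℓ) - g (a + k * ℓ))) x < 0 ∧
       0 < (fun k : ℕ => σ * (f (a + k * ℓ) - g (a + k * ℓ))) y ∧
       (fun k : ℕ => σ * (f (a + k * ℓ) - g (a + k * ℓ))) z < 0 ∧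
       0 < (fun k : ℕ => σ * (f (a + k * ℓ) - g (a + k * ℓ))) w) := by
  have mono : ∀ i j : ℕ, i < j → a + i * ℓ < a + j * ℓ := fun i j h => by
    have : (i:ℝ) < j := by exact_mod_cast h
    nlinarith
  have mem : ∀ i : ℕ, a + i * ℓ ≤ b → a + i * ℓ ∈ Icc a b := fun i h => ⟨by
    have : (0:ℝ) ≤ i := by positivity
    nlinarith, h⟩
  have G := H.gh hf hg hσ
  constructor
  · rintro ⟨s1, s2, s3, s4⟩
    exact G.no_alt (mem x hx) (mem w hw) (mono _ _ hxy) (mono _ _ hyz) (mono _ _ hzw) s1 s2 s3 s4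
  · rintro ⟨s1, s2, s3, s4⟩
    exact G.neg.no_alt (mem x hx) (mem w hw) (mono _ _ hxy) (mono _ _ hyz) (mono _ _ hzw)
      (neg_pos.2 s1) (neg_neg_iff_pos.2 s2) (neg_pos.2 s3) (neg_neg_iff_pos.2 s4)
end WM

namespace WM
open scoped Classical

structure Lev (K t Δ ρ ℓ : ℝ) (q : ℕ) : Prop where
  hK : 1 ≤ K
  ht : 0 < t
  hΔ : 0 < Δ
  hρ : ρ * t = Δ^2
  hℓ : ℓ = Δ / (8 * K * t)
  hq : 10240 * K^2 ≤ q

lemma Lev.ρpos {K t Δ ρ ℓ : ℝ} {q : ℕ} (L : Lev K t Δ ρ ℓ q) : 0 < ρ := by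
  have h1 := L.ht
  have h2 := L.hρ
  have h3 : 0 < ρ * t := by rw [h2]; have := L.hΔ; positivity
  exact pos_of_mul_pos_left h3 h1.le

lemma Lev.ℓpos {K t Δ ρ ℓ : ℝ} {q : ℕ} (L : Lev K t Δ ρ ℓ q) : 0 < ℓ := by
  have h1 := L.ht
  have h2 := L.hΔ
  have h3 := L.hK
  rw [L.hℓ]; positivity

noncomputable def FR (X : Finset (ℝ → ℝ)) (a ℓ ρ Δ : ℝ) (R : ℕ × ℤ × ℤ) : Finset (ℝ → ℝ) :=
  X.filter (fun f => |f (a + R.1 * ℓ) - ρ * R.2.1| ≤ 5 * ρ ∧ |deriv f (a + R.1 * ℓ) - Δ * R.2.2| ≤ 5 * Δ)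

noncomputable def OR (X : Finset (ℝ → ℝ)) (a ℓ ρ Δ t : ℝ) (R : ℕ × ℤ × ℤ) : Finset (ℝ → ℝ) :=
  (FR X a ℓ ρ Δ R).filter (fun f => (FR X a ℓ ρ Δ R).card ≤
    2 * ((FR X a ℓ ρ Δ R).filter (fun h => t / 8 < dd a f h)).card)

noncomputable def BRs (X : Finset (ℝ → ℝ)) (a b K ℓ ρ Δ t σ : ℝ) (R : ℕ × ℤ × ℤ) (w : ℝ → ℝ) : Finset (ℝ → ℝ) :=
  (FR X a ℓ ρ Δ R).filter (fun h => ∀ θ ∈ Icc a b, t / (16 * K) ≤ σ * (deriv (deriv h) θ - deriv (deriv w) θ))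

noncomputable def WRs (X : Finset (ℝ → ℝ)) (a b K ℓ ρ Δ t σ : ℝ) (R : ℕ × ℤ × ℤ) : Finset (ℝ → ℝ) :=
  (FR X a ℓ ρ Δ R).filter (fun w => (FR X a ℓ ρ Δ R).card ≤ 4 * (BRs X a b K ℓ ρ Δ t σ R w).card)

lemma FR_close {X : Finset (ℝ → ℝ)} {a ℓ ρ Δ : ℝ} {R : ℕ × ℤ × ℤ} {f g : ℝ → ℝ}
    (hf : f ∈ FR X a ℓ ρ Δ R) (hg : g ∈ FR X a ℓ ρ Δ R) :
    |f (a + R.1 * ℓ) - g (a + R.1 * ℓ)| ≤ 10 * ρ ∧ |deriv f (a + R.1 * ℓ) - deriv g (a + R.1 * ℓ)| ≤ 10 * Δ := by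
  obtain ⟨_, f1, f2⟩ := Finset.mem_filter.1 hf
  obtain ⟨_, g1, g2⟩ := Finset.mem_filter.1 hg
  rw [abs_le] at *
  exact ⟨⟨by linarith [f1.1, g1.2], by linarith [f1.2, g1.1]⟩,
    abs_le.2 ⟨by linarith [f2.1, g2.2], by linarith [f2.2, g2.1]⟩⟩

lemma edge_lens {a b K t Δ ρ ℓ : ℝ} {q : ℕ} (L : Lev K t Δ ρ ℓ q) {F X : Finset (ℝ → ℝ)} (H : Good a b K F)
    (hX : X ⊆ F) {σ : ℝ} (hσ : |σ| = 1) {R : ℕ × ℤ × ℤ} (hR : a + R.1 * ℓ ≤ b) {w v : ℝ → ℝ}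
    (hw : w ∈ FR X a ℓ ρ Δ R) (hv : v ∈ BRs X a b K ℓ ρ Δ t σ R w) {k : ℕ} (hk : a + k * ℓ ≤ b)
    (hfar : (q:ℤ) ≤ |(k:ℤ) - R.1|) : 20 * ρ ≤ σ * (v (a + k * ℓ) - w (a + k * ℓ)) := by
  have hv1 := (Finset.mem_filter.1 hv).1
  have hv2 := (Finset.mem_filter.1 hv).2
  obtain ⟨c1, c2⟩ := FR_close hv1 hw
  have sw := H.smooth w (hX (Finset.mem_filter.1 hw).1)
  have sv := H.smooth v (hX (Finset.mem_filter.1 hv1).1)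
  obtain ⟨e1, e2⟩ := deriv_lc2 sv sw σ
  have hℓ := L.ℓpos
  have mem : ∀ i : ℕ, a + i * ℓ ≤ b → a + i * ℓ ∈ Icc a b := fun i h => ⟨by
    have : (0:ℝ) ≤ i * ℓ := mul_nonneg (Nat.cast_nonneg _) hℓ.le
    linarith, h⟩
  refine lens (h := fun x => σ * (v x - w x)) (a := a) (b := b) (K := K) (t := t) (Δ := Δ) (ρ := ρ) (q := q)
    (y := a + R.1 * ℓ) (contDiff_const.mul (sv.sub sw)) L.hK L.ht L.hΔ L.hρ L.hq ?_ (mem k hk) (mem R.1 hR) ?_ ?_ ?_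
  · intro θ hθ; rw [e2]; exact hv2 θ hθ
  · simp only [abs_mul, hσ, one_mul]; exact c1
  · rw [e1]; simp only [abs_mul, hσ, one_mul]; exact c2
  · rw [← L.hℓ, show a + (k:ℝ) * ℓ - (a + R.1 * ℓ) = ((k:ℝ) - R.1) * ℓ by ring, abs_mul, abs_of_pos hℓ]
    apply mul_le_mul_of_nonneg_right _ hℓ.le
    exact_mod_cast hfar

lemma int_close {q : ℕ} (hq : 10 < q) {i j : ℤ} (hm : i % q = j % q) {ρ x : ℝ} (hρ : 0 < ρ)
    (hi : |x - ρ * i| ≤ 5 * ρ) (hj : |x - ρ * j| ≤ 5 * ρ) : i = j := by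
  have h1 : ρ * |(i:ℝ) - j| ≤ ρ * 10 := by
    rw [← abs_of_pos hρ, ← abs_mul, abs_of_pos hρ]
    rw [abs_le] at *
    constructor <;> nlinarith [hi.1, hi.2, hj.1, hj.2]
  have h2 : |(i:ℝ) - j| ≤ 10 := le_of_mul_le_mul_left h1 hρ
  have h3 : |i - j| ≤ 10 := by exact_mod_cast h2
  have h4 : (q:ℤ) ∣ (i - j) := Int.ModEq.dvd (n := (q:ℤ)) (show j % q = i % q from hm.symm)
  by_contra hne
  have h5 := Int.le_of_dvd (abs_pos.2 (sub_ne_zero.2 hne)) ((dvd_abs _ _).2 h4)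
  omega

def colr (q : ℕ) (R : ℕ × ℤ × ℤ) : ℕ × ℤ × ℤ := (R.1 % q, R.2.1 % q, R.2.2 % q)

lemma share_far {K t Δ ρ ℓ : ℝ} {q : ℕ} (L : Lev K t Δ ρ ℓ q) {X : Finset (ℝ → ℝ)} {a : ℝ} {R R' : ℕ × ℤ × ℤ}
    (hc : colr q R = colr q R') {f : ℝ → ℝ} (h1 : f ∈ FR X a ℓ ρ Δ R) (h2 : f ∈ FR X a ℓ ρ Δ R') (hne : R ≠ R') :
    (q:ℤ) ≤ |(R'.1:ℤ) - R.1| := by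
  simp only [colr, Prod.mk.injEq] at hc
  obtain ⟨c1, c2, c3⟩ := hc
  have hq : 10 < q := by
    have := L.hq; have := L.hK
    have : (10:ℝ) < q := by nlinarith
    exact_mod_cast this
  have hk : R.1 ≠ R'.1 := by
    intro he
    apply hne
    obtain ⟨_, f1, f2⟩ := Finset.mem_filter.1 h1
    obtain ⟨_, g1, g2⟩ := Finset.mem_filter.1 h2
    rw [← he] at g1 g2
    have i1 := int_close hq c2 L.ρpos f1 g1
    have i2 := int_close hq c3 L.hΔ f2 g2
    exact Prod.ext he (Prod.ext i1 i2)
  have h4 : (q:ℤ) ∣ ((R'.1:ℤ) - R.1) := (Nat.modEq_iff_dvd (n := q)).1 c1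
  have hne0 : (R'.1:ℤ) - R.1 ≠ 0 := by
    intro h; apply hk; omega
  exact Int.le_of_dvd (abs_pos.2 hne0) ((dvd_abs _ _).2 h4)

lemma sig_v {a b K t Δ ρ ℓ : ℝ} {q : ℕ} (L : Lev K t Δ ρ ℓ q) {F X : Finset (ℝ → ℝ)} (H : Good a b K F)
    (hX : X ⊆ F) {σ : ℝ} (hσ : |σ| = 1) {R R' : ℕ × ℤ × ℤ} (hR : a + R.1 * ℓ ≤ b) (hR' : a + R'.1 * ℓ ≤ b)
    (hc : colr q R = colr q R') (hne : R ≠ R') {w v u : ℝ → ℝ}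
    (hw : w ∈ FR X a ℓ ρ Δ R) (hv : v ∈ BRs X a b K ℓ ρ Δ t σ R w)
    (hv' : v ∈ FR X a ℓ ρ Δ R') (hu : u ∈ FR X a ℓ ρ Δ R') :
    0 < σ * (u (a + R'.1 * ℓ) - w (a + R'.1 * ℓ)) := by
  have hv1 := (Finset.mem_filter.1 hv).1
  have e := edge_lens L H hX hσ hR hw hv hR' (share_far L hc hv1 hv' hne)
  have c := (FR_close hu hv').1
  have : |σ * (u (a + R'.1 * ℓ) - v (a + R'.1 * ℓ))| ≤ 10 * ρ := by rw [abs_mul, hσ, one_mul]; exact c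
  have := (abs_le.1 this).1
  have := L.ρpos
  nlinarith

lemma sig_w {a b K t Δ ρ ℓ : ℝ} {q : ℕ} (L : Lev K t Δ ρ ℓ q) {F X : Finset (ℝ → ℝ)} (H : Good a b K F)
    (hX : X ⊆ F) {σ : ℝ} (hσ : |σ| = 1) {R R' : ℕ × ℤ × ℤ} (hR : a + R.1 * ℓ ≤ b) (hR' : a + R'.1 * ℓ ≤ b)
    (hc : colr q R = colr q R') (hne : R ≠ R') {w v u : ℝ → ℝ}
    (hw : w ∈ FR X a ℓ ρ Δ R) (hv : v ∈ BRs X a b K ℓ ρ Δ t σ R w)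
    (hw' : w ∈ FR X a ℓ ρ Δ R') (hu : u ∈ FR X a ℓ ρ Δ R') :
    0 < σ * (v (a + R'.1 * ℓ) - u (a + R'.1 * ℓ)) := by
  have e := edge_lens L H hX hσ hR hw hv hR' (share_far L hc hw hw' hne)
  have c := (FR_close hw' hu).1
  have : |σ * (w (a + R'.1 * ℓ) - u (a + R'.1 * ℓ))| ≤ 10 * ρ := by rw [abs_mul, hσ, one_mul]; exact c
  have := (abs_le.1 this).1
  have := L.ρpos
  nlinarith

lemma star_sigma {a b K t Δ ρ ℓ : ℝ} {q : ℕ} (L : Lev K t Δ ρ ℓ q) {F X : Finset (ℝ → ℝ)} (H : Good a b K F)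
    (hX : X ⊆ F) {σ : ℝ} (hσ : |σ| = 1) (Rs : Finset (ℕ × ℤ × ℤ)) (J : ℕ)
    (hRs : ∀ R ∈ Rs, a + R.1 * ℓ ≤ b ∧ R.1 < 2^J) :
    ∑ R ∈ Rs, ((WRs X a b K ℓ ρ Δ t σ R).card : ℝ) * √((FR X a ℓ ρ Δ R).card) ≤
      (q:ℝ)^3 * (Nat.log 2 X.card + 1)^2 * (453 * (J+1) * √((X.card)^3 * (Real.log Rs.card + 2)^3)) := by
  have hq0 : 0 < q := by
    have := L.hq; have := L.hK
    have : (0:ℝ) < q := by nlinarith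
    exact_mod_cast this
  have hρ := L.ρpos
  have Wm : ∀ {R w}, w ∈ WRs X a b K ℓ ρ Δ t σ R → w ∈ FR X a ℓ ρ Δ R := fun h => (Finset.mem_filter.1 h).1
  have Bm : ∀ {R w v}, v ∈ BRs X a b K ℓ ρ Δ t σ R w → v ∈ FR X a ℓ ρ Δ R := fun h => (Finset.mem_filter.1 h).1
  have FX : ∀ {R w}, w ∈ FR X a ℓ ρ Δ R → w ∈ X := fun h => (Finset.mem_filter.1 h).1
  have S := star_abs Rs X (WRs X a b K ℓ ρ Δ t σ) (BRs X a b K ℓ ρ Δ t σ) (fun R => (FR X a ℓ ρ Δ R).card)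
    (fun R => R.1) J (colr q) (Finset.range q ×ˢ (Finset.Ico (0:ℤ) q ×ˢ Finset.Ico (0:ℤ) q))
    (by
      intro R _
      have hq1 : (0:ℤ) < q := by exact_mod_cast hq0
      simp only [colr, Finset.mem_product, Finset.mem_range, Finset.mem_Ico]
      exact ⟨Nat.mod_lt _ hq0, ⟨Int.emod_nonneg _ hq1.ne', Int.emod_lt_of_pos _ hq1⟩,
        Int.emod_nonneg _ hq1.ne', Int.emod_lt_of_pos _ hq1⟩)
    (fun R _ w hw => FX (Wm hw))
    (fun R _ => Finset.card_le_card (fun w hw => Wm hw))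
    (fun R _ => Finset.card_le_card (fun w hw => FX hw))
    (fun R _ w hw => ⟨fun v hv => FX (Bm hv), (Finset.mem_filter.1 hw).2⟩)
    (fun R hR => (hRs R hR).2)
    (by
      intro R hR R' hR' hc w hw hw' v hv hv'
      by_contra hne
      have e := edge_lens L H hX hσ (hRs R hR).1 (Wm hw) hv (hRs R' hR').1 (share_far L hc (Wm hw) (Wm hw') hne)
      have c := (FR_close (Bm hv') (Wm hw')).1
      have : |σ * (v (a + R'.1 * ℓ) - w (a + R'.1 * ℓ))| ≤ 10 * ρ := by rw [abs_mul, hσ, one_mul]; exact c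
      have := (abs_le.1 this).2
      linarith)
    (by
      intro R hR R' hR' hc w hw w' hw' v hv hv' hww hne he
      have := share_far L hc (Bm hv) (Bm hv') hne
      rw [he, sub_self, abs_zero] at this
      omega)
    (by
      intro R hR R' hR' hc w hw hw' v hv v' hv' hvv hne he
      have := share_far L hc (Wm hw) (Wm hw') hne
      rw [he, sub_self, abs_zero] at this
      omega)
    (by
      intro R1 h1 R2 h2 R3 h3 R4 h4 c12 c13 c14 w w' v v' hww hvv m1 m2 m3 m4 n1 n2 n3 n4 d12 d13 d42 d43
      have wF := hX (FX (Wm m1))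
      have wF' := hX (FX (Wm m3))
      have vF := hX (FX (Bm n1))
      have vF' := hX (FX (Bm n2))
      have k1 := (hRs R1 h1).1
      have k2 := (hRs R2 h2).1
      have k3 := (hRs R3 h3).1
      have k4 := (hRs R4 h4).1
      have c24 : colr q R2 = colr q R4 := c12.symm.trans c14
      have c34 : colr q R3 = colr q R4 := c13.symm.trans c14
      refine cyc_of_signs {k : ℕ | a + k * ℓ ≤ b} (fun k : ℕ => σ * (w (a + k * ℓ) - w' (a + k * ℓ)))
        (fun k : ℕ => σ * (v' (a + k * ℓ) - v (a + k * ℓ))) k1 k2 k3 k4 (H.noalt wF wF' hσ L.ℓpos)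
        (H.noalt vF' vF hσ L.ℓpos) ?_ ?_ ?_ ?_ ?_ ?_ ?_ ?_
      · exact sig_v L H hX hσ k3 k1 c13.symm d13.symm (Wm m3) n3 (Bm n1) (Wm m1)
      · exact sig_v L H hX hσ k4 k2 c24.symm d42 (Wm m4) n4 (Bm n2) (Wm m2)
      · have := sig_v L H hX hσ k1 k3 c13 d13 (Wm m1) n1 (Bm n3) (Wm m3)
        linarith
      · have := sig_v L H hX hσ k2 k4 c24 d42.symm (Wm m2) n2 (Bm n4) (Wm m4)
        linarith
      · exact sig_w L H hX hσ k2 k1 c12.symm d12.symm (Wm m2) n2 (Wm m1) (Bm n1)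
      · have := sig_w L H hX hσ k1 k2 c12 d12 (Wm m1) n1 (Wm m2) (Bm n2)
        linarith
      · exact sig_w L H hX hσ k4 k3 c34.symm d43 (Wm m4) n4 (Wm m3) (Bm n3)
      · have := sig_w L H hX hσ k3 k4 c34 d43.symm (Wm m3) n3 (Wm m4) (Bm n4)
        linarith)
  refine S.trans (le_of_eq ?_)
  congr 2
  simp only [Finset.card_product, Finset.card_range, Int.card_Ico, sub_zero, Int.toNat_natCast]
  push_cast; ring

lemma star {a b K t Δ ρ ℓ : ℝ} {q : ℕ} (L : Lev K t Δ ρ ℓ q) {F X : Finset (ℝ → ℝ)} (H : Good a b K F)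
    (hX : X ⊆ F) (hΔt : 640 * K * Δ ≤ t) (Rs : Finset (ℕ × ℤ × ℤ)) (J : ℕ)
    (hRs : ∀ R ∈ Rs, a + R.1 * ℓ ≤ b ∧ R.1 < 2^J) :
    ∑ R ∈ Rs, ((OR X a ℓ ρ Δ t R).card : ℝ) * √((FR X a ℓ ρ Δ R).card) ≤
      2 * ((q:ℝ)^3 * (Nat.log 2 X.card + 1)^2 * (453 * (J+1) * √((X.card)^3 * (Real.log Rs.card + 2)^3))) := by
  have s1 := star_sigma L H hX (σ := 1) (by simp) Rs J hRs
  have s2 := star_sigma L H hX (σ := -1) (by simp) Rs J hRs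
  have key : ∀ R ∈ Rs, ((OR X a ℓ ρ Δ t R).card : ℝ) * √((FR X a ℓ ρ Δ R).card) ≤
      ((WRs X a b K ℓ ρ Δ t 1 R).card : ℝ) * √((FR X a ℓ ρ Δ R).card) +
      ((WRs X a b K ℓ ρ Δ t (-1) R).card : ℝ) * √((FR X a ℓ ρ Δ R).card) := by
    intro R hR
    rw [← add_mul]
    apply mul_le_mul_of_nonneg_right _ (Real.sqrt_nonneg _)
    have hsub : OR X a ℓ ρ Δ t R ⊆ WRs X a b K ℓ ρ Δ t 1 R ∪ WRs X a b K ℓ ρ Δ t (-1) R := by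
      intro w hw
      obtain ⟨hw1, hw2⟩ := Finset.mem_filter.1 hw
      have hsub2 : (FR X a ℓ ρ Δ R).filter (fun h => t / 8 < dd a w h) ⊆
          BRs X a b K ℓ ρ Δ t 1 R w ∪ BRs X a b K ℓ ρ Δ t (-1) R w := by
        intro v hv
        obtain ⟨hv1, hv2⟩ := Finset.mem_filter.1 hv
        have wF := hX (Finset.mem_filter.1 hw1).1
        have vF := hX (Finset.mem_filter.1 hv1).1
        have G := H.gh vF wF (σ := 1) (by simp)
        obtain ⟨e1, e2⟩ := deriv_lc2 (H.smooth v vF) (H.smooth w wF) 1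
        have hx : a + R.1 * ℓ ∈ Icc a b := ⟨by
          have : (0:ℝ) ≤ R.1 * ℓ := mul_nonneg (Nat.cast_nonneg _) L.ℓpos.le
          linarith, (hRs R hR).1⟩
        obtain ⟨c1, c2⟩ := FR_close hv1 hw1
        have hρΔ : ρ ≤ Δ := by
          have h1 := L.hρ; have h2 := L.hΔ; have h3 := L.hK; have h4 := L.ht
          have h5 : Δ ≤ t := by nlinarith
          by_contra hc
          push Not at hc
          nlinarith
        have hcomm : dd a v w = dd a w v := by
          unfold dd
          rw [abs_sub_comm (v a), abs_sub_comm (deriv v a), abs_sub_comm (deriv (deriv v) a)]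
        rw [← hcomm] at hv2
        have := G.const_sign hx L.ht hv2 hΔt (by simp only [one_mul]; linarith) (by rw [e1]; simp only [one_mul]; exact c2)
        rw [e2] at this
        rw [Finset.mem_union]
        rcases this with h | h
        · left; exact Finset.mem_filter.2 ⟨hv1, h⟩
        · right; exact Finset.mem_filter.2 ⟨hv1, fun θ hθ => by have := h θ hθ; simp only at this; linarith⟩
      have hc := (Finset.card_le_card hsub2).trans (Finset.card_union_le _ _)
      rw [Finset.mem_union]
      by_cases h4 : (FR X a ℓ ρ Δ R).card ≤ 4 * (BRs X a b K ℓ ρ Δ t 1 R w).card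
      · left; exact Finset.mem_filter.2 ⟨hw1, h4⟩
      · right; exact Finset.mem_filter.2 ⟨hw1, by omega⟩
    exact_mod_cast (Finset.card_le_card hsub).trans (Finset.card_union_le _ _)
  refine (Finset.sum_le_sum key).trans ?_
  rw [Finset.sum_add_distrib]
  linarith
end WM

namespace WM
open scoped Classical

lemma amgm_aux {μ ω G A s : ℝ} (hμ : 0 ≤ μ) (hA : 1 ≤ A) (hs : 0 < s) (h1 : μ ≤ A * ω) (h2 : μ^2 ≤ A^2 * G) :
    μ ^ ((3:ℝ)/2) ≤ A^2 * (s * ω + G / s) := by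
  have hω : 0 ≤ ω := by
    by_contra hc; push Not at hc; nlinarith
  have hG : 0 ≤ G := by
    by_contra hc; push Not at hc
    have : 0 < A^2 := by positivity
    nlinarith [sq_nonneg μ]
  have hrhs : 0 ≤ A^2 * (s * ω + G / s) := by positivity
  refine le_of_sq_le_sq ?_ hrhs
  have e : (μ ^ ((3:ℝ)/2))^2 = μ^3 := by
    rw [← Real.rpow_natCast, ← Real.rpow_mul hμ]
    norm_num
  rw [e]
  have h3 : μ^3 ≤ A^3 * (ω * G) := by
    calc μ^3 = μ * μ^2 := by ring
      _ ≤ (A * ω) * (A^2 * G) := mul_le_mul h1 h2 (by positivity) (by positivity)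
      _ = _ := by ring
  have h4 : ω * G ≤ (s * ω + G / s)^2 := by
    have : ω * G = (s * ω) * (G / s) := by field_simp
    rw [this]
    have u1 : 0 ≤ s * ω := by positivity
    have u2 : 0 ≤ G / s := by positivity
    nlinarith
  calc μ^3 ≤ A^3 * (ω * G) := h3
    _ ≤ A^4 * (s * ω + G / s)^2 := by
        apply mul_le_mul _ h4 (by positivity) (by positivity)
        exact pow_le_pow_right₀ hA (by norm_num)
    _ = _ := by ring

lemma pigeon {γ ι κ : Type*} (Fp : Finset γ) (Λ : Finset κ) (P : κ → Finset (γ × γ)) (near : Finset (γ × γ))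
    (I : κ → Finset ι) (M O : κ → ι → Finset γ) (G : κ → ι → Finset (γ × γ)) (s : κ → ι → ℝ) (C Q : ℝ)
    (hC : 1 ≤ C) (hQ : 0 ≤ Q) (hL : 1 ≤ Λ.card)
    (hcov : Fp ×ˢ Fp ⊆ near ∪ Λ.biUnion P) (hnear : (near.card : ℝ) ≤ Fp.card * Q)
    (hP : ∀ l ∈ Λ, P l ⊆ (I l).biUnion (G l))
    (hG : ∀ l ∈ Λ, ∀ r ∈ I l, G l r ⊆ (O l r) ×ˢ (M l r) ∪ (M l r) ×ˢ (O l r))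
    (hO : ∀ l ∈ Λ, ∀ r ∈ I l, O l r ⊆ M l r) (hM : ∀ l ∈ Λ, ∀ r ∈ I l, M l r ⊆ Fp)
    (hov : ∀ l ∈ Λ, ∀ f ∈ Fp, (((I l).filter (fun r => f ∈ M l r)).card : ℝ) ≤ C)
    (hs : ∀ l ∈ Λ, ∀ r ∈ I l, 0 < s l r) :
    (Fp.card : ℝ) ^ ((3:ℝ)/2) ≤ √(2 * Q) * Fp.card +
      (4 * Λ.card * C)^2 * ∑ l ∈ Λ, ∑ r ∈ I l, (s l r * (O l r).card + (G l r).card / s l r) := by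
  have hterm : ∀ l ∈ Λ, ∀ r ∈ I l, 0 ≤ s l r * (O l r).card + (G l r).card / s l r := by
    intro l hl r hr
    have := hs l hl r hr
    positivity
  have hsum0 : 0 ≤ ∑ l ∈ Λ, ∑ r ∈ I l, (s l r * (O l r).card + (G l r).card / s l r) :=
    Finset.sum_nonneg (fun l hl => Finset.sum_nonneg (fun r hr => hterm l hl r hr))
  set μ : ℝ := (Fp.card : ℝ) with hμ
  have hμ0 : 0 ≤ μ := Nat.cast_nonneg _
  by_cases hcase : μ ≤ 2 * Q
  · have : μ ^ ((3:ℝ)/2) ≤ √(2 * Q) * μ := by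
      rw [show (3:ℝ)/2 = 1/2 + 1 by norm_num, Real.rpow_add_of_nonneg hμ0 (by norm_num) (by norm_num), Real.rpow_one,
        ← Real.sqrt_eq_rpow]
      exact mul_le_mul_of_nonneg_right (Real.sqrt_le_sqrt hcase) hμ0
    have h2 : 0 ≤ (4 * (Λ.card:ℝ) * C)^2 := sq_nonneg _
    have := mul_nonneg h2 hsum0
    linarith
  · push Not at hcase
    have hμpos : 0 < μ := by linarith
    set L : ℝ := (Λ.card : ℝ) with hLdef
    have hL1 : 1 ≤ L := by rw [hLdef]; exact_mod_cast hL
    -- level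
    have hc1 : μ * μ ≤ μ * Q + ∑ l ∈ Λ, ((P l).card : ℝ) := by
      have h1 := Finset.card_le_card hcov
      rw [Finset.card_product] at h1
      have h2 := h1.trans (Finset.card_union_le _ _)
      have h3 := h2.trans (Nat.add_le_add_left Finset.card_biUnion_le _)
      have h4 : (Fp.card:ℝ) * Fp.card ≤ near.card + ∑ l ∈ Λ, ((P l).card : ℝ) := by exact_mod_cast h3
      linarith
    have hc2 : ∑ l ∈ Λ, μ^2 / (2 * L) ≤ ∑ l ∈ Λ, ((P l).card : ℝ) := by
      rw [Finset.sum_const, nsmul_eq_mul, ← hLdef]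
      have : L * (μ^2 / (2 * L)) = μ^2 / 2 := by field_simp
      rw [this]; nlinarith
    have hne : Λ.Nonempty := Finset.card_pos.1 hL
    obtain ⟨l, hl, hPl⟩ := Finset.exists_le_of_sum_le hne hc2
    set I' := (I l).filter (fun r => (M l r).Nonempty) with hI'
    have hc3 : ((P l).card : ℝ) ≤ ∑ r ∈ I', ((G l r).card : ℝ) := by
      have h1 := (Finset.card_le_card (hP l hl)).trans Finset.card_biUnion_le
      have h2 : ∑ r ∈ I l, (G l r).card = ∑ r ∈ I', (G l r).card := by
        symm; apply Finset.sum_filter_of_ne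
        intro r hr h
        by_contra hc
        rw [Finset.not_nonempty_iff_eq_empty] at hc
        have := hG l hl r hr
        rw [hc] at this
        apply h
        have : G l r ⊆ ∅ := by simpa using this
        simpa using this
      rw [h2] at h1
      exact_mod_cast h1
    have hc4 : ∑ r ∈ I', ((M l r).card : ℝ) ≤ C * μ := by
      have h1 : ∑ r ∈ I', ((M l r).card : ℝ) = ∑ f ∈ Fp, ((I'.filter (fun r => f ∈ M l r)).card : ℝ) := by
        have h := Finset.sum_card_bipartiteAbove_eq_sum_card_bipartiteBelow (s := I') (t := Fp) (fun r f => f ∈ M l r)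
        have e : ∀ r ∈ I', (M l r).card = (Finset.bipartiteAbove (fun r f => f ∈ M l r) Fp r).card := by
          intro r hr
          congr 1
          ext f
          rw [Finset.mem_bipartiteAbove]
          exact ⟨fun h => ⟨hM l hl r (Finset.mem_filter.1 hr).1 h, h⟩, fun h => h.2⟩
        rw [← Finset.sum_congr rfl e] at h
        unfold Finset.bipartiteBelow at h
        exact_mod_cast h
      rw [h1]
      calc _ ≤ ∑ f ∈ Fp, C := by
            apply Finset.sum_le_sum
            intro f hf
            refine le_trans ?_ (hov l hl f hf)
            exact_mod_cast Finset.card_le_card (fun r hr => by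
              rw [Finset.mem_filter] at hr ⊢
              exact ⟨(Finset.mem_filter.1 hr.1).1, hr.2⟩)
        _ = C * μ := by rw [Finset.sum_const, nsmul_eq_mul]; ring
    have hI'ne : I'.Nonempty := by
      by_contra hc
      rw [Finset.not_nonempty_iff_eq_empty] at hc
      rw [hc, Finset.sum_empty] at hc3
      have : 0 < μ^2 / (2 * L) := by positivity
      linarith
    have hc5 : ∑ r ∈ I', μ * (M l r).card / (2 * L * C) ≤ ∑ r ∈ I', ((G l r).card : ℝ) := by
      rw [← Finset.sum_div, ← Finset.mul_sum]
      calc _ ≤ μ * (C * μ) / (2 * L * C) := by gcongr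
        _ = μ^2 / (2 * L) := by field_simp
        _ ≤ _ := hPl.trans hc3
    obtain ⟨r, hr, hGr⟩ := Finset.exists_le_of_sum_le hI'ne hc5
    obtain ⟨hrI, hrne⟩ := Finset.mem_filter.1 hr
    have hm : 0 < ((M l r).card : ℝ) := by exact_mod_cast Finset.card_pos.2 hrne
    have hG2 : ((G l r).card : ℝ) ≤ 2 * (O l r).card * (M l r).card := by
      have h1 := (Finset.card_le_card (hG l hl r hrI)).trans (Finset.card_union_le _ _)
      rw [Finset.card_product, Finset.card_product] at h1
      have h2 : ((G l r).card : ℝ) ≤ (O l r).card * (M l r).card + (M l r).card * (O l r).card := by exact_mod_cast h1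
      linarith
    have hOM : ((O l r).card : ℝ) ≤ (M l r).card := by exact_mod_cast Finset.card_le_card (hO l hl r hrI)
    rw [div_le_iff₀ (by positivity)] at hGr
    have hA1 : μ ≤ 4 * L * C * (O l r).card := by
      have h1 : μ * (M l r).card ≤ (4 * L * C * (O l r).card) * (M l r).card := by
        calc μ * (M l r).card ≤ (G l r).card * (2 * L * C) := hGr
          _ ≤ (2 * (O l r).card * (M l r).card) * (2 * L * C) := by gcongr
          _ = _ := by ring
      exact le_of_mul_le_mul_right h1 hm
    have hA2 : μ^2 ≤ (4 * L * C)^2 * (G l r).card := by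
      calc μ^2 = μ * μ := by ring
        _ ≤ μ * (4 * L * C * (M l r).card) := by
            apply mul_le_mul_of_nonneg_left _ hμ0
            exact hA1.trans (mul_le_mul_of_nonneg_left hOM (by positivity))
        _ = 4 * L * C * (μ * (M l r).card) := by ring
        _ ≤ 4 * L * C * ((G l r).card * (2 * L * C)) := by
            apply mul_le_mul_of_nonneg_left hGr (by positivity)
        _ ≤ _ := by
            have : 0 ≤ (L * C)^2 * (G l r).card := by positivity
            nlinarith
    have hA : 1 ≤ 4 * L * C := by nlinarith
    have fin := amgm_aux hμ0 hA (hs l hl r hrI) hA1 hA2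
    have h5 : s l r * (O l r).card + (G l r).card / s l r ≤
        ∑ l ∈ Λ, ∑ r ∈ I l, (s l r * (O l r).card + (G l r).card / s l r) := by
      refine le_trans ?_ (Finset.single_le_sum (f := fun l => ∑ r ∈ I l, (s l r * (O l r).card + (G l r).card / s l r))
        (fun l hl => Finset.sum_nonneg (fun r hr => hterm l hl r hr)) hl)
      exact Finset.single_le_sum (f := fun r => (s l r * (O l r).card + (G l r).card / s l r))
        (fun r hr => hterm l hl r hr) hrI
    have h6 : 0 ≤ √(2 * Q) * μ := mul_nonneg (Real.sqrt_nonneg _) hμ0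
    have := mul_le_mul_of_nonneg_left h5 (sq_nonneg (4 * L * C))
    linarith
end WM

namespace WM
open scoped Classical

noncomputable def tt (δ : ℝ) (i : ℕ) : ℝ := 4^(i+1) * δ
noncomputable def DD (δ : ℝ) (i j : ℕ) : ℝ := 2^(i+1+j) * δ
noncomputable def rr (δ : ℝ) (j : ℕ) : ℝ := 4^j * δ
noncomputable def ll (K δ : ℝ) (i j : ℕ) : ℝ := DD δ i j / (8 * K * tt δ i)

lemma lev_of {K δ : ℝ} {q : ℕ} (hK : 1 ≤ K) (hδ : 0 < δ) (hq : 10240 * K^2 ≤ q) (i j : ℕ) :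
    Lev K (tt δ i) (DD δ i j) (rr δ j) (ll K δ i j) q := by
  refine ⟨hK, by unfold tt; positivity, by unfold DD; positivity, ?_, rfl, hq⟩
  unfold tt DD rr
  simp only [show ∀ n, (4:ℝ)^n = 2^n*2^n from fun n => by rw [← mul_pow]; norm_num]
  ring

noncomputable def cel (a t : ℝ) (f : ℝ → ℝ) : ℤ × ℤ × ℤ :=
  (⌊f a / t⌋, ⌊deriv f a / t⌋, ⌊deriv (deriv f) a / t⌋)

noncomputable def XC (F : Finset (ℝ → ℝ)) (a t : ℝ) (c : ℤ × ℤ × ℤ) : Finset (ℝ → ℝ) :=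
  F.filter (fun f => |f a - t * c.1| ≤ 2 * t ∧ |deriv f a - t * c.2.1| ≤ 2 * t ∧ |deriv (deriv f) a - t * c.2.2| ≤ 2 * t)

noncomputable def rect (a ℓ ρ Δ : ℝ) (k : ℕ) (f : ℝ → ℝ) : ℕ × ℤ × ℤ :=
  (k, ⌊f (a + k * ℓ) / ρ⌋, ⌊deriv f (a + k * ℓ) / Δ⌋)

noncomputable def kmax (a b ℓ : ℝ) : ℕ := ⌊(b - a) / ℓ⌋₊ + 1

noncomputable def RC (F : Finset (ℝ → ℝ)) (a b t ℓ ρ Δ : ℝ) (c : ℤ × ℤ × ℤ) : Finset (ℕ × ℤ × ℤ) :=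
  (Finset.range (kmax a b ℓ) ×ˢ XC F a t c).image (fun x => rect a ℓ ρ Δ x.1 x.2)

noncomputable def IX (F : Finset (ℝ → ℝ)) (a b t ℓ ρ Δ : ℝ) : Finset ((_ : ℤ × ℤ × ℤ) × (ℕ × ℤ × ℤ)) :=
  (F.image (cel a t)).sigma (RC F a b t ℓ ρ Δ)

lemma floor_close {ρ y : ℝ} (hρ : 0 < ρ) : |y - ρ * ⌊y / ρ⌋| ≤ ρ := by
  have h1 := Int.floor_le (y / ρ)
  have h2 := Int.lt_floor_add_one (y / ρ)
  rw [le_div_iff₀ hρ] at h1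
  rw [div_lt_iff₀ hρ] at h2
  rw [abs_le]; constructor <;> nlinarith

lemma card_win {ρ y n : ℝ} {m : ℕ} (hn : 2 * n = m) (hρ : 0 < ρ) :
    ∃ S : Finset ℤ, S.card ≤ m + 1 ∧ ∀ i : ℤ, |y - ρ * i| ≤ n * ρ → i ∈ S := by
  refine ⟨Finset.Icc ⌈y / ρ - n⌉ ⌊y / ρ + n⌋, ?_, ?_⟩
  · rw [Int.card_Icc]
    have h1 := Int.floor_le (y / ρ + n)
    have h2 := Int.le_ceil (y / ρ - n)
    have h3 : ((⌊y / ρ + n⌋ - ⌈y / ρ - n⌉ : ℤ) : ℝ) ≤ (m : ℤ) := by push_cast; linarith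
    have h4 : ⌊y / ρ + n⌋ - ⌈y / ρ - n⌉ ≤ (m:ℤ) := by exact_mod_cast h3
    omega
  · intro i hi
    rw [abs_le] at hi
    rw [Finset.mem_Icc, Int.ceil_le, Int.le_floor]
    constructor
    · rw [sub_le_iff_le_add, div_le_iff₀ hρ]; nlinarith [hi.2]
    · rw [← sub_le_iff_le_add, le_div_iff₀ hρ]; nlinarith [hi.1]

lemma overlap_cells (𝓒 : Finset (ℤ × ℤ × ℤ)) (F : Finset (ℝ → ℝ)) {a t : ℝ} (ht : 0 < t) (f : ℝ → ℝ) :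
    (𝓒.filter (fun c => f ∈ XC F a t c)).card ≤ 125 := by
  obtain ⟨S1, k1, m1⟩ := card_win (y := f a) (n := 2) (m := 4) (by norm_num) ht
  obtain ⟨S2, k2, m2⟩ := card_win (y := deriv f a) (n := 2) (m := 4) (by norm_num) ht
  obtain ⟨S3, k3, m3⟩ := card_win (y := deriv (deriv f) a) (n := 2) (m := 4) (by norm_num) ht
  have : 𝓒.filter (fun c => f ∈ XC F a t c) ⊆ S1 ×ˢ (S2 ×ˢ S3) := by
    intro c hc
    obtain ⟨_, h1, h2, h3⟩ := Finset.mem_filter.1 (Finset.mem_filter.1 hc).2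
    simp only [Finset.mem_product]
    exact ⟨m1 _ h1, m2 _ h2, m3 _ h3⟩
  refine (Finset.card_le_card this).trans ?_
  rw [Finset.card_product, Finset.card_product]
  calc _ ≤ 5 * (5 * 5) := Nat.mul_le_mul k1 (Nat.mul_le_mul k2 k3)
    _ = 125 := by norm_num

lemma overlap_rects (Rs : Finset (ℕ × ℤ × ℤ)) (X : Finset (ℝ → ℝ)) {a ℓ ρ Δ : ℝ} (hρ : 0 < ρ) (hΔ : 0 < Δ) (k : ℕ)
    (f : ℝ → ℝ) : (Rs.filter (fun R => R.1 = k ∧ f ∈ FR X a ℓ ρ Δ R)).card ≤ 121 := by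
  obtain ⟨S1, k1, m1⟩ := card_win (y := f (a + k * ℓ)) (n := 5) (m := 10) (by norm_num) hρ
  obtain ⟨S2, k2, m2⟩ := card_win (y := deriv f (a + k * ℓ)) (n := 5) (m := 10) (by norm_num) hΔ
  have : Rs.filter (fun R => R.1 = k ∧ f ∈ FR X a ℓ ρ Δ R) ⊆ {k} ×ˢ (S1 ×ˢ S2) := by
    intro R hR
    obtain ⟨_, e, hf⟩ := Finset.mem_filter.1 hR
    obtain ⟨_, h1, h2⟩ := Finset.mem_filter.1 hf
    rw [e] at h1 h2
    simp only [Finset.mem_product, Finset.mem_singleton]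
    exact ⟨e, m1 _ h1, m2 _ h2⟩
  refine (Finset.card_le_card this).trans ?_
  rw [Finset.card_product, Finset.card_product, Finset.card_singleton]
  calc _ ≤ 1 * (11 * 11) := Nat.mul_le_mul le_rfl (Nat.mul_le_mul k1 k2)
    _ = 121 := by norm_num

lemma overlap_all (F : Finset (ℝ → ℝ)) {a b t ℓ ρ Δ : ℝ} (ht : 0 < t) (hρ : 0 < ρ) (hΔ : 0 < Δ) (k : ℕ)
    (f : ℝ → ℝ) :
    ((IX F a b t ℓ ρ Δ).filter (fun r => r.2.1 = k ∧ f ∈ FR (XC F a t r.1) a ℓ ρ Δ r.2)).card ≤ 15125 := by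
  have : (IX F a b t ℓ ρ Δ).filter (fun r => r.2.1 = k ∧ f ∈ FR (XC F a t r.1) a ℓ ρ Δ r.2) ⊆
      ((F.image (cel a t)).filter (fun c => f ∈ XC F a t c)).sigma
        (fun c => (RC F a b t ℓ ρ Δ c).filter (fun R => R.1 = k ∧ f ∈ FR (XC F a t c) a ℓ ρ Δ R)) := by
    rintro ⟨c, R⟩ hr
    obtain ⟨h1, h2, h3⟩ := Finset.mem_filter.1 hr
    obtain ⟨h4, h5⟩ := Finset.mem_sigma.1 h1
    rw [Finset.mem_sigma]
    exact ⟨Finset.mem_filter.2 ⟨h4, (Finset.mem_filter.1 h3).1⟩, Finset.mem_filter.2 ⟨h5, h2, h3⟩⟩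
  refine (Finset.card_le_card this).trans ?_
  rw [Finset.card_sigma]
  refine (Finset.sum_le_card_nsmul _ _ 121 (fun c _ => overlap_rects _ _ hρ hΔ k f)).trans ?_
  rw [smul_eq_mul]
  calc _ ≤ 125 * 121 := Nat.mul_le_mul_right _ (overlap_cells _ F ht f)
    _ = 15125 := by norm_num

lemma dd_comm (θ : ℝ) (f g : ℝ → ℝ) : dd θ f g = dd θ g f := by
  unfold dd
  rw [abs_sub_comm (f θ), abs_sub_comm (deriv f θ), abs_sub_comm (deriv (deriv f) θ)]

lemma dd_tri (θ : ℝ) (f g h : ℝ → ℝ) : dd θ f g ≤ dd θ f h + dd θ h g := by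
  unfold dd
  have := abs_sub_le (f θ) (h θ) (g θ)
  have := abs_sub_le (deriv f θ) (deriv h θ) (deriv g θ)
  have := abs_sub_le (deriv (deriv f) θ) (deriv (deriv h) θ) (deriv (deriv g) θ)
  linarith

/-- candidate pairs in a rectangle -/
noncomputable def PR (X : Finset (ℝ → ℝ)) (a ℓ ρ Δ t : ℝ) (R : ℕ × ℤ × ℤ) : Finset ((ℝ → ℝ) × (ℝ → ℝ)) :=
  (FR X a ℓ ρ Δ R ×ˢ FR X a ℓ ρ Δ R).filter (fun y => t / 4 < dd a y.1 y.2 ∧ dd a y.1 y.2 ≤ t)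

lemma PR_sub {X : Finset (ℝ → ℝ)} {a ℓ ρ Δ t : ℝ} {R : ℕ × ℤ × ℤ} {y : (ℝ → ℝ) × (ℝ → ℝ)}
    (hy : y ∈ PR X a ℓ ρ Δ t R) : y.1 ∈ OR X a ℓ ρ Δ t R ∨ y.2 ∈ OR X a ℓ ρ Δ t R := by
  obtain ⟨h1, h2, h3⟩ := Finset.mem_filter.1 hy
  obtain ⟨m1, m2⟩ := Finset.mem_product.1 h1
  have hcov : FR X a ℓ ρ Δ R ⊆ (FR X a ℓ ρ Δ R).filter (fun h => t / 8 < dd a y.1 h) ∪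
      (FR X a ℓ ρ Δ R).filter (fun h => t / 8 < dd a y.2 h) := by
    intro h hh
    rw [Finset.mem_union, Finset.mem_filter, Finset.mem_filter]
    by_contra hc
    push Not at hc
    have := hc.1 hh
    have := hc.2 hh
    have := dd_tri a y.1 y.2 h
    rw [dd_comm a h y.2] at this
    linarith
  have hc := (Finset.card_le_card hcov).trans (Finset.card_union_le _ _)
  by_cases hd : (FR X a ℓ ρ Δ R).card ≤ 2 * ((FR X a ℓ ρ Δ R).filter (fun h => t / 8 < dd a y.1 h)).card
  · left; exact Finset.mem_filter.2 ⟨m1, hd⟩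
  · right; exact Finset.mem_filter.2 ⟨m2, by omega⟩

lemma PR_card {X : Finset (ℝ → ℝ)} {a ℓ ρ Δ t : ℝ} {R : ℕ × ℤ × ℤ} :
    ((PR X a ℓ ρ Δ t R).card : ℝ) ≤ 2 * (OR X a ℓ ρ Δ t R).card * (FR X a ℓ ρ Δ R).card := by
  have hsub : PR X a ℓ ρ Δ t R ⊆ OR X a ℓ ρ Δ t R ×ˢ FR X a ℓ ρ Δ R ∪ FR X a ℓ ρ Δ R ×ˢ OR X a ℓ ρ Δ t R := by
    intro y hy
    obtain ⟨m1, m2⟩ := Finset.mem_product.1 (Finset.mem_filter.1 hy).1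
    rw [Finset.mem_union, Finset.mem_product, Finset.mem_product]
    rcases PR_sub hy with h | h
    · left; exact ⟨h, m2⟩
    · right; exact ⟨m1, h⟩
  have h1 := (Finset.card_le_card hsub).trans (Finset.card_union_le _ _)
  rw [Finset.card_product, Finset.card_product] at h1
  have h2 : ((PR X a ℓ ρ Δ t R).card : ℝ) ≤ (OR X a ℓ ρ Δ t R).card * (FR X a ℓ ρ Δ R).card +
    (FR X a ℓ ρ Δ R).card * (OR X a ℓ ρ Δ t R).card := by exact_mod_cast h1
  linarith
end WM

namespace WM
open scoped Classical

noncomputable def kk (a ℓ x : ℝ) : ℕ := ⌊(x - a) / ℓ⌋₊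

lemma kk_spec {a ℓ x : ℝ} (hℓ : 0 < ℓ) (hx : a ≤ x) :
    a + kk a ℓ x * ℓ ≤ x ∧ x ≤ a + kk a ℓ x * ℓ + ℓ := by
  have h0 : 0 ≤ (x - a) / ℓ := div_nonneg (by linarith) hℓ.le
  have h1 := Nat.floor_le h0
  have h2 := Nat.lt_floor_add_one ((x - a) / ℓ)
  rw [le_div_iff₀ hℓ] at h1
  rw [div_lt_iff₀ hℓ] at h2
  unfold kk
  constructor <;> nlinarith

lemma kk_lt {a b ℓ x : ℝ} (hℓ : 0 < ℓ) (hx : x ≤ b) : kk a ℓ x < kmax a b ℓ := by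
  unfold kk kmax
  exact Nat.lt_succ_of_le (Nat.floor_le_floor (by gcongr))

lemma slope_lip {a b K t Δ ρ ℓ : ℝ} {q : ℕ} (L : Lev K t Δ ρ ℓ q) {F : Finset (ℝ → ℝ)} (H : Good a b K F)
    {f g : ℝ → ℝ} (hf : f ∈ F) (hg : g ∈ F) (hd : dd a f g ≤ t) {x y : ℝ} (hx : x ∈ Icc a b) (hy : y ∈ Icc a b)
    (hxy : |x - y| ≤ ℓ) : |(deriv f x - deriv g x) - (deriv f y - deriv g y)| ≤ Δ / 8 := by
  obtain ⟨e1, e2⟩ := deriv_lc2 (H.smooth f hf) (H.smooth g hg) 1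
  simp only [one_mul] at e1 e2
  have G := H.gh hf hg (σ := 1) (by simp)
  simp only [one_mul] at G
  have D1 := (c2_diff G.hC).2.1
  have hK := L.hK
  have := lip_bound (M := K * t) D1 (fun θ hθ => by
    have h1 := G.up θ hθ
    have := abs_nonneg (f θ - g θ)
    have := abs_nonneg (deriv (fun x => f x - g x) θ)
    have : K * dd a f g ≤ K * t := by gcongr
    linarith) hx hy hxy
  rw [e1] at this
  refine this.trans (le_of_eq ?_)
  have := L.ht
  rw [L.hℓ]; field_simp

lemma pair_in_rect {a b K t Δ ρ ℓ δ : ℝ} {q : ℕ} (L : Lev K t Δ ρ ℓ q) {F : Finset (ℝ → ℝ)} (H : Good a b K F)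
    {f g : ℝ → ℝ} (hf : f ∈ F) (hg : g ∈ F) (hd : dd a f g ≤ t) {x : ℝ} (hx : x ∈ Icc a b) (hδ : δ ≤ ρ)
    (h0 : |f x - g x| ≤ 2 * δ) (h1 : |deriv f x - deriv g x| ≤ Δ) :
    f ∈ FR (XC F a t (cel a t f)) a ℓ ρ Δ (rect a ℓ ρ Δ (kk a ℓ x) f) ∧
    g ∈ FR (XC F a t (cel a t f)) a ℓ ρ Δ (rect a ℓ ρ Δ (kk a ℓ x) f) ∧
    rect a ℓ ρ Δ (kk a ℓ x) f ∈ RC F a b t ℓ ρ Δ (cel a t f) := by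
  have hρ := L.ρpos
  have hℓ := L.ℓpos
  have hΔ := L.hΔ
  have ht := L.ht
  have hK := L.hK
  obtain ⟨kl, ku⟩ := kk_spec hℓ hx.1
  set y := a + kk a ℓ x * ℓ with hy
  have hya : a ≤ y := by
    have : (0:ℝ) ≤ kk a ℓ x * ℓ := mul_nonneg (Nat.cast_nonneg _) hℓ.le
    linarith
  have ymem : y ∈ Icc a b := ⟨hya, kl.trans hx.2⟩
  have d1 : ∀ θ ∈ Icc y x, |deriv f θ - deriv g θ| ≤ 9 / 8 * Δ := by
    intro θ hθ
    have := slope_lip L H hf hg hd (x := θ) (y := x) ⟨hya.trans hθ.1, hθ.2.trans hx.2⟩ hx (by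
      rw [abs_le]; constructor <;> linarith [hθ.1, hθ.2])
    have := abs_sub_abs_le_abs_sub (deriv f θ - deriv g θ) (deriv f x - deriv g x)
    linarith
  obtain ⟨e1, e2⟩ := deriv_lc2 (H.smooth f hf) (H.smooth g hg) 1
  simp only [one_mul] at e1 e2
  have D0 : Differentiable ℝ (fun x => f x - g x) := (c2_diff (H.smooth f hf)).1.sub (c2_diff (H.smooth g hg)).1
  have d0 := lip_bound (M := 9 / 8 * Δ) (η := ℓ) D0 (fun θ hθ => by rw [e1]; exact d1 θ hθ) (x := y) (y := x)
    ⟨le_rfl, kl⟩ ⟨kl, le_rfl⟩ (by rw [abs_le]; constructor <;> linarith)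
  have hΔℓ : Δ * ℓ ≤ ρ / 8 := by
    rw [L.hℓ, ← mul_div_assoc, div_le_iff₀ (by positivity)]
    have := L.hρ
    have h8 : ρ / 8 * (8 * K * t) = K * (ρ * t) := by ring
    rw [h8, this]
    nlinarith [sq_nonneg Δ]
  have d0' : |f y - g y| ≤ 3 * ρ := by
    have := abs_sub_abs_le_abs_sub (f y - g y) (f x - g x)
    nlinarith
  have fc := floor_close (y := f y) hρ
  have fc' := floor_close (y := deriv f y) hΔ
  have c1 := floor_close (y := f a) ht
  have c2 := floor_close (y := deriv f a) ht
  have c3 := floor_close (y := deriv (deriv f) a) ht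
  have n1 := abs_nonneg (f a - g a)
  have n2 := abs_nonneg (deriv f a - deriv g a)
  have n3 := abs_nonneg (deriv (deriv f) a - deriv (deriv g) a)
  have fX : f ∈ XC F a t (cel a t f) := by
    refine Finset.mem_filter.2 ⟨hf, ?_, ?_, ?_⟩ <;> simp only [cel] <;> linarith
  have gX : g ∈ XC F a t (cel a t f) := by
    unfold dd at hd
    refine Finset.mem_filter.2 ⟨hg, ?_, ?_, ?_⟩ <;> simp only [cel]
    · have := abs_sub_le (g a) (f a) (t * ⌊f a / t⌋)
      rw [abs_sub_comm (g a) (f a)] at this; linarith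
    · have := abs_sub_le (deriv g a) (deriv f a) (t * ⌊deriv f a / t⌋)
      rw [abs_sub_comm (deriv g a) (deriv f a)] at this; linarith
    · have := abs_sub_le (deriv (deriv g) a) (deriv (deriv f) a) (t * ⌊deriv (deriv f) a / t⌋)
      rw [abs_sub_comm (deriv (deriv g) a) (deriv (deriv f) a)] at this; linarith
  refine ⟨Finset.mem_filter.2 ⟨fX, ?_⟩, Finset.mem_filter.2 ⟨gX, ?_⟩, ?_⟩
  · simp only [rect, ← hy]
    exact ⟨by linarith, by linarith⟩
  · simp only [rect, ← hy]
    have h2 := abs_sub_le (g y) (f y) (ρ * ⌊f y / ρ⌋)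
    have h3 := abs_sub_le (deriv g y) (deriv f y) (Δ * ⌊deriv f y / Δ⌋)
    have h4 := d1 y ⟨le_rfl, kl⟩
    rw [abs_sub_comm (g y) (f y)] at h2
    rw [abs_sub_comm (deriv g y) (deriv f y)] at h3
    exact ⟨by linarith, by linarith⟩
  · refine Finset.mem_image.2 ⟨(kk a ℓ x, f), ?_, rfl⟩
    exact Finset.mem_product.2 ⟨Finset.mem_range.2 (kk_lt hℓ hx.2), fX⟩

/-- slope condition at level `(i,j)` -/
def slope (δ : ℝ) (i j : ℕ) (f g : ℝ → ℝ) (x : ℝ) : Prop :=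
  |deriv f x - deriv g x| ≤ DD δ i j ∧ (j = 0 ∨ DD δ i j / 2 < |deriv f x - deriv g x|)

lemma level_exists {a b K δ : ℝ} {F : Finset (ℝ → ℝ)} (H : Good a b K F) (hδ : 0 < δ) {L1 M2 : ℕ}
    (hL1 : K ≤ 4^L1 * δ) (hM2 : K * 2^L1 ≤ 2^M2) {f g : ℝ → ℝ} (hf : f ∈ F) (hg : g ∈ F)
    (hdK : dd a f g ≤ K) (hd : δ < dd a f g) {x : ℝ} (hx : x ∈ Icc a b) :
    ∃ i < L1, ∃ j < M2 + 1, tt δ i / 4 < dd a f g ∧ dd a f g ≤ tt δ i ∧ slope δ i j f g x := by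
  have hK := H.hK
  have ex : ∃ n : ℕ, dd a f g ≤ 4^n * δ := ⟨L1, hdK.trans hL1⟩
  have s1 := Nat.find_spec ex
  have s2 := Nat.find_min' ex (hdK.trans hL1)
  set n := Nat.find ex with hn
  have n0 : n ≠ 0 := by
    intro h; rw [h] at s1; simp at s1; linarith
  obtain ⟨i, hi⟩ := Nat.exists_eq_succ_of_ne_zero n0
  have s3 : ¬ (dd a f g ≤ 4^i * δ) := Nat.find_min ex (by omega)
  rw [hi] at s1
  have hh : |deriv f x - deriv g x| ≤ 2^(i+1+M2) * δ := by
    have h1 := H.hi f hf g hg x hx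
    have h2 : |deriv f x - deriv g x| ≤ dd x f g := by
      unfold dd
      have := abs_nonneg (f x - g x)
      have := abs_nonneg (deriv (deriv f) x - deriv (deriv g) x)
      linarith
    have h3 : K * dd a f g ≤ K * (4^(i+1) * δ) := by gcongr
    have h4 : (4:ℝ)^(i+1) = 2^(i+1) * 2^(i+1) := by rw [← mul_pow]; norm_num
    have h5 : (2:ℝ)^(i+1) ≤ 2^L1 := pow_le_pow_right₀ (by norm_num) (by omega)
    calc _ ≤ K * (4^(i+1) * δ) := h2.trans (h1.trans h3)
      _ = (2^(i+1) * (K * 2^(i+1))) * δ := by rw [h4]; ring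
      _ ≤ (2^(i+1) * (K * 2^L1)) * δ := by gcongr
      _ ≤ (2^(i+1) * 2^M2) * δ := by gcongr
      _ = _ := by rw [← pow_add]
  have ex2 : ∃ m : ℕ, |deriv f x - deriv g x| ≤ 2^(i+1+m) * δ := ⟨M2, hh⟩
  have r1 := Nat.find_spec ex2
  have r2 := Nat.find_min' ex2 hh
  set m := Nat.find ex2 with hm
  refine ⟨i, by omega, m, by omega, ?_, ?_, ?_, ?_⟩
  · unfold tt; push Not at s3; rw [pow_succ]; linarith
  · unfold tt; exact s1
  · unfold DD; exact r1
  · by_cases m0 : m = 0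
    · left; exact m0
    · right
      obtain ⟨m', hm'⟩ := Nat.exists_eq_succ_of_ne_zero m0
      have r3 : ¬ (|deriv f x - deriv g x| ≤ 2^(i+1+m') * δ) := Nat.find_min ex2 (by omega)
      push Not at r3
      unfold DD
      rw [hm', show i + 1 + m'.succ = (i + 1 + m') + 1 by omega, pow_succ]; linarith

/-- functions through the point -/
noncomputable def thr (δ : ℝ) (p : ℝ × ℝ) (S : Finset (ℝ → ℝ)) : Finset (ℝ → ℝ) :=
  S.filter (fun f => |f p.1 - p.2| ≤ δ)

noncomputable def thr2 (δ : ℝ) (i j : ℕ) (p : ℝ × ℝ) (S : Finset ((ℝ → ℝ) × (ℝ → ℝ))) : Finset ((ℝ → ℝ) × (ℝ → ℝ)) :=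
  S.filter (fun y => |y.1 p.1 - p.2| ≤ δ ∧ |y.2 p.1 - p.2| ≤ δ ∧ slope δ i j y.1 y.2 p.1)

/-- index set of level `(i,j)` -/
noncomputable def IXl (F : Finset (ℝ → ℝ)) (a b K δ : ℝ) (l : ℕ × ℕ) : Finset ((_ : ℤ × ℤ × ℤ) × (ℕ × ℤ × ℤ)) :=
  IX F a b (tt δ l.1) (ll K δ l.1 l.2) (rr δ l.2) (DD δ l.1 l.2)
noncomputable def Fl (F : Finset (ℝ → ℝ)) (a K δ : ℝ) (l : ℕ × ℕ) (r : (_ : ℤ × ℤ × ℤ) × (ℕ × ℤ × ℤ)) : Finset (ℝ → ℝ) :=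
  FR (XC F a (tt δ l.1) r.1) a (ll K δ l.1 l.2) (rr δ l.2) (DD δ l.1 l.2) r.2
noncomputable def Ol (F : Finset (ℝ → ℝ)) (a K δ : ℝ) (l : ℕ × ℕ) (r : (_ : ℤ × ℤ × ℤ) × (ℕ × ℤ × ℤ)) : Finset (ℝ → ℝ) :=
  OR (XC F a (tt δ l.1) r.1) a (ll K δ l.1 l.2) (rr δ l.2) (DD δ l.1 l.2) (tt δ l.1) r.2
noncomputable def Pl (F : Finset (ℝ → ℝ)) (a K δ : ℝ) (l : ℕ × ℕ) (r : (_ : ℤ × ℤ × ℤ) × (ℕ × ℤ × ℤ)) :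
    Finset ((ℝ → ℝ) × (ℝ → ℝ)) :=
  PR (XC F a (tt δ l.1) r.1) a (ll K δ l.1 l.2) (rr δ l.2) (DD δ l.1 l.2) (tt δ l.1) r.2

lemma pointwise {a b K δ Q : ℝ} {F : Finset (ℝ → ℝ)} (H : Good a b K F) (hδ : 0 < δ) {L1 M2 : ℕ} (hL0 : 1 ≤ L1)
    (hL1 : K ≤ 4^L1 * δ) (hM2 : K * 2^L1 ≤ 2^M2) (hdK : ∀ f ∈ F, ∀ g ∈ F, dd a f g ≤ K) (hQ0 : 0 ≤ Q)
    (hQ : ∀ f ∈ F, ((F.filter (fun g => dd a f g ≤ δ)).card : ℝ) ≤ Q)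
    (s : ℕ × ℕ → ((_ : ℤ × ℤ × ℤ) × (ℕ × ℤ × ℤ)) → ℝ) (hs : ∀ l r, r ∈ IXl F a b K δ l → 0 < s l r)
    (p : ℝ × ℝ) (hp : p.1 ∈ Icc a b) :
    ((thr δ p F).card : ℝ) ^ ((3:ℝ)/2) ≤ √(2 * Q) * (thr δ p F).card +
      (4 * (L1 * (M2 + 1) : ℕ) * 15125)^2 * ∑ l ∈ Finset.range L1 ×ˢ Finset.range (M2 + 1),
        ∑ r ∈ (IXl F a b K δ l).filter (fun r => r.2.1 = kk a (ll K δ l.1 l.2) p.1),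
          (s l r * (thr δ p (Ol F a K δ l r)).card + (thr2 δ l.1 l.2 p (Pl F a K δ l r)).card / s l r) := by
  obtain ⟨q, hq⟩ := exists_nat_ge (10240 * K^2)
  have LL : ∀ i j, Lev K (tt δ i) (DD δ i j) (rr δ j) (ll K δ i j) q := fun i j => lev_of H.hK hδ hq i j
  have hcard : (Finset.range L1 ×ˢ Finset.range (M2 + 1)).card = L1 * (M2 + 1) := by
    rw [Finset.card_product, Finset.card_range, Finset.card_range]
  have PG := pigeon (thr δ p F) (Finset.range L1 ×ˢ Finset.range (M2 + 1))
    (fun l => (thr δ p F ×ˢ thr δ p F).filter (fun y => tt δ l.1 / 4 < dd a y.1 y.2 ∧ dd a y.1 y.2 ≤ tt δ l.1 ∧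
      slope δ l.1 l.2 y.1 y.2 p.1))
    ((thr δ p F ×ˢ thr δ p F).filter (fun y => dd a y.1 y.2 ≤ δ))
    (fun l => (IXl F a b K δ l).filter (fun r => r.2.1 = kk a (ll K δ l.1 l.2) p.1))
    (fun l r => thr δ p (Fl F a K δ l r)) (fun l r => thr δ p (Ol F a K δ l r))
    (fun l r => thr2 δ l.1 l.2 p (Pl F a K δ l r)) s 15125 Q (by norm_num) hQ0
    (by rw [hcard]; exact Nat.mul_pos hL0 (by omega))
    (by
      intro y hy
      obtain ⟨m1, m2⟩ := Finset.mem_product.1 hy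
      have f1 := (Finset.mem_filter.1 m1).1
      have f2 := (Finset.mem_filter.1 m2).1
      rw [Finset.mem_union]
      by_cases hd : dd a y.1 y.2 ≤ δ
      · left; exact Finset.mem_filter.2 ⟨hy, hd⟩
      · right
        push Not at hd
        obtain ⟨i, hi, j, hj, h1, h2, h3⟩ := level_exists H hδ hL1 hM2 f1 f2 (hdK _ f1 _ f2) hd hp
        rw [Finset.mem_biUnion]
        exact ⟨(i, j), Finset.mem_product.2 ⟨Finset.mem_range.2 hi, Finset.mem_range.2 hj⟩,
          Finset.mem_filter.2 ⟨hy, h1, h2, h3⟩⟩)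
    (by
      have e : ((thr δ p F ×ˢ thr δ p F).filter (fun y => dd a y.1 y.2 ≤ δ)) ⊆
          (thr δ p F).biUnion (fun f => (F.filter (fun g => dd a f g ≤ δ)).image (fun g => (f, g))) := by
        intro y hy
        obtain ⟨h1, h2⟩ := Finset.mem_filter.1 hy
        obtain ⟨m1, m2⟩ := Finset.mem_product.1 h1
        rw [Finset.mem_biUnion]
        exact ⟨y.1, m1, Finset.mem_image.2 ⟨y.2, Finset.mem_filter.2 ⟨(Finset.mem_filter.1 m2).1, h2⟩, rfl⟩⟩
      have h1 := (Finset.card_le_card e).trans Finset.card_biUnion_le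
      have h2 : (((thr δ p F ×ˢ thr δ p F).filter (fun y => dd a y.1 y.2 ≤ δ)).card : ℝ) ≤
        ∑ f ∈ thr δ p F, (((F.filter (fun g => dd a f g ≤ δ)).image (fun g => (f, g))).card : ℝ) := by exact_mod_cast h1
      refine h2.trans ?_
      rw [← nsmul_eq_mul]
      apply Finset.sum_le_card_nsmul
      intro f hf
      refine le_trans ?_ (hQ f (Finset.mem_filter.1 hf).1)
      exact_mod_cast Finset.card_image_le)
    (by
      intro l _ y hy
      obtain ⟨h1, h2, h3, h4⟩ := Finset.mem_filter.1 hy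
      obtain ⟨m1, m2⟩ := Finset.mem_product.1 h1
      obtain ⟨f1, g1⟩ := Finset.mem_filter.1 m1
      obtain ⟨f2, g2⟩ := Finset.mem_filter.1 m2
      have hδρ : δ ≤ rr δ l.2 := by
        unfold rr
        have : (1:ℝ) ≤ 4^l.2 := one_le_pow₀ (by norm_num)
        nlinarith
      have hc : |y.1 p.1 - y.2 p.1| ≤ 2 * δ := by
        have := abs_sub_le (y.1 p.1) p.2 (y.2 p.1)
        rw [abs_sub_comm p.2] at this
        linarith
      obtain ⟨r1, r2, r3⟩ := pair_in_rect (LL l.1 l.2) H f1 f2 h3 hp hδρ hc h4.1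
      rw [Finset.mem_biUnion]
      refine ⟨⟨cel a (tt δ l.1) y.1, rect a (ll K δ l.1 l.2) (rr δ l.2) (DD δ l.1 l.2) (kk a (ll K δ l.1 l.2) p.1) y.1⟩,
        ?_, ?_⟩
      · refine Finset.mem_filter.2 ⟨Finset.mem_sigma.2 ⟨Finset.mem_image_of_mem _ f1, r3⟩, rfl⟩
      · exact Finset.mem_filter.2 ⟨Finset.mem_filter.2 ⟨Finset.mem_product.2 ⟨r1, r2⟩, h2, h3⟩, g1, g2, h4⟩)
    (by
      intro l _ r _ y hy
      obtain ⟨h1, h2, h3, h4⟩ := Finset.mem_filter.1 hy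
      obtain ⟨m1, m2⟩ := Finset.mem_product.1 (Finset.mem_filter.1 h1).1
      rw [Finset.mem_union, Finset.mem_product, Finset.mem_product]
      rcases PR_sub h1 with h | h
      · left; exact ⟨Finset.mem_filter.2 ⟨h, h2⟩, Finset.mem_filter.2 ⟨m2, h3⟩⟩
      · right; exact ⟨Finset.mem_filter.2 ⟨m1, h2⟩, Finset.mem_filter.2 ⟨h, h3⟩⟩)
    (by
      intro l _ r _
      exact Finset.filter_subset_filter _ (Finset.filter_subset _ _))
    (by
      intro l _ r _ f hf
      obtain ⟨h1, h2⟩ := Finset.mem_filter.1 hf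
      exact Finset.mem_filter.2 ⟨(Finset.mem_filter.1 (Finset.mem_filter.1 h1).1).1, h2⟩)
    (by
      intro l _ f hf
      have L := LL l.1 l.2
      have := overlap_all F (a := a) (b := b) (ℓ := ll K δ l.1 l.2) L.ht L.ρpos L.hΔ (kk a (ll K δ l.1 l.2) p.1) f
      refine le_trans ?_ (show ((15125:ℕ):ℝ) ≤ 15125 by norm_num)
      refine Nat.cast_le.2 (le_trans (Finset.card_le_card ?_) this)
      intro r hr
      obtain ⟨h1, h2⟩ := Finset.mem_filter.1 hr
      obtain ⟨h3, h4⟩ := Finset.mem_filter.1 h1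
      exact Finset.mem_filter.2 ⟨h3, h4, (Finset.mem_filter.1 h2).1⟩)
    (fun l _ r hr => hs l r (Finset.mem_filter.1 hr).1)
  rw [hcard] at PG
  exact PG
end WM

namespace WM
open scoped Classical

lemma tube_meas {δ α C : ℝ} {E : Set (ℝ × ℝ)} {A : Set ℝ} (hδ : 0 < δ) (hα : 0 < α) (hC : 0 ≤ C)
    (hEA : ∀ p ∈ E, p.1 ∈ A)
    (hA : ∀ u v : ℝ, u ≤ v → Icc u v ⊆ Icc (0:ℝ) 1 → volume (A ∩ Icc u v) ≤ ENNReal.ofReal (C * (v - u) ^ α))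
    {a b : ℝ} (hab : Icc a b ⊆ Icc (0:ℝ) 1) {f : ℝ → ℝ} (hf : Continuous f) {X : Set ℝ} (hX : X ⊆ Icc a b) {r : ℝ}
    (_hr0 : 0 ≤ r) (hr : ∀ x ∈ X, ∀ y ∈ X, |x - y| ≤ r) :
    volume (E ∩ {p : ℝ × ℝ | p.1 ∈ X ∧ |f p.1 - p.2| ≤ δ}) ≤ ENNReal.ofReal (2 * δ * C * r ^ α) := by
  rcases X.eq_empty_or_nonempty with rfl | hne
  · simp
  have bb : BddBelow X := ⟨a, fun x hx => (hX hx).1⟩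
  have ba : BddAbove X := ⟨b, fun x hx => (hX hx).2⟩
  set u := sInf X with hu
  set v := sSup X with hv
  obtain ⟨x0, hx0⟩ := hne
  have ux : ∀ x ∈ X, u ≤ x ∧ x ≤ v := fun x hx => ⟨csInf_le bb hx, le_csSup ba hx⟩
  have huv : u ≤ v := (ux x0 hx0).1.trans (ux x0 hx0).2
  have hvr : v - u ≤ r := by
    have h1 : ∀ x ∈ X, v ≤ x + r := fun x hx => csSup_le ⟨x0, hx0⟩ (fun y hy => by
      have := (abs_le.1 (hr y hy x hx)).2; linarith)
    have : v - r ≤ u := le_csInf ⟨x0, hx0⟩ (fun x hx => by linarith [h1 x hx])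
    linarith
  have hua : a ≤ u := le_csInf ⟨x0, hx0⟩ (fun x hx => (hX hx).1)
  have hvb : v ≤ b := csSup_le ⟨x0, hx0⟩ (fun x hx => (hX hx).2)
  have h01 : Icc u v ⊆ Icc (0:ℝ) 1 := (Icc_subset_Icc hua hvb).trans hab
  have hm := hA u v huv h01
  set A' := toMeasurable volume (A ∩ Icc u v) with hA'
  have mA' : MeasurableSet A' := measurableSet_toMeasurable _ _
  have hS : MeasurableSet {p : ℝ × ℝ | p.1 ∈ A' ∧ |f p.1 - p.2| ≤ δ} := by
    apply MeasurableSet.inter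
    · exact measurable_fst mA'
    · exact (isClosed_le (f := fun p : ℝ × ℝ => |f p.1 - p.2|) (by fun_prop) continuous_const).measurableSet
  have hsub : E ∩ {p : ℝ × ℝ | p.1 ∈ X ∧ |f p.1 - p.2| ≤ δ} ⊆ {p : ℝ × ℝ | p.1 ∈ A' ∧ |f p.1 - p.2| ≤ δ} := by
    rintro p ⟨hE, hX1, hX2⟩
    exact ⟨subset_toMeasurable _ _ ⟨hEA p hE, ux _ hX1⟩, hX2⟩
  refine (measure_mono hsub).trans ?_
  rw [Measure.volume_eq_prod, Measure.prod_apply hS]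
  have hle : ∀ x, volume (Prod.mk x ⁻¹' {p : ℝ × ℝ | p.1 ∈ A' ∧ |f p.1 - p.2| ≤ δ}) ≤
      A'.indicator (fun _ => ENNReal.ofReal (2 * δ)) x := by
    intro x
    by_cases hx : x ∈ A'
    · rw [indicator_of_mem hx]
      refine (measure_mono (t := Icc (f x - δ) (f x + δ)) ?_).trans ?_
      · rintro y ⟨_, hy⟩
        have := abs_le.1 hy
        simp only at this
        exact ⟨by linarith [this.2], by linarith [this.1]⟩
      · rw [Real.volume_Icc]; exact ENNReal.ofReal_le_ofReal (by linarith)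
    · rw [indicator_of_notMem hx]
      simp [hx]
  refine (lintegral_mono hle).trans ?_
  rw [lintegral_indicator_const mA', measure_toMeasurable]
  refine (mul_le_mul_right hm _).trans ?_
  rw [← ENNReal.ofReal_mul (by linarith)]
  apply ENNReal.ofReal_le_ofReal
  rw [← mul_assoc]
  have : (v - u)^α ≤ r^α := Real.rpow_le_rpow (by linarith) hvr hα.le
  gcongr

/-- integral bound bookkeeping -/
structure IB (ν : Measure (ℝ × ℝ)) (h : ℝ × ℝ → ℝ) (m : ℝ) : Prop where
  nn : ∀ p, 0 ≤ h p
  meas : Measurable h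
  m0 : 0 ≤ m
  int : ∫⁻ p, ENNReal.ofReal (h p) ∂ν ≤ ENNReal.ofReal m

lemma IB.add {ν : Measure (ℝ × ℝ)} {h g : ℝ × ℝ → ℝ} {m n : ℝ} (H : IB ν h m) (G : IB ν g n) :
    IB ν (fun p => h p + g p) (m + n) := by
  refine ⟨fun p => add_nonneg (H.nn p) (G.nn p), H.meas.add G.meas, add_nonneg H.m0 G.m0, ?_⟩
  simp only [fun p => ENNReal.ofReal_add (H.nn p) (G.nn p)]
  rw [lintegral_add_left H.meas.ennreal_ofReal, ENNReal.ofReal_add H.m0 G.m0]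
  exact add_le_add H.int G.int

lemma IB.smul {ν : Measure (ℝ × ℝ)} {h : ℝ × ℝ → ℝ} {m : ℝ} (H : IB ν h m) {c : ℝ} (hc : 0 ≤ c) :
    IB ν (fun p => c * h p) (c * m) := by
  refine ⟨fun p => mul_nonneg hc (H.nn p), H.meas.const_mul c, mul_nonneg hc H.m0, ?_⟩
  simp only [fun p => ENNReal.ofReal_mul (q := h p) hc]
  rw [lintegral_const_mul _ H.meas.ennreal_ofReal, ENNReal.ofReal_mul hc]
  exact mul_le_mul_right H.int _

lemma IB.sum {ι : Type*} {ν : Measure (ℝ × ℝ)} (s : Finset ι) {h : ι → ℝ × ℝ → ℝ} {m : ι → ℝ}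
    (H : ∀ i ∈ s, IB ν (h i) (m i)) : IB ν (fun p => ∑ i ∈ s, h i p) (∑ i ∈ s, m i) := by
  induction s using Finset.induction_on with
  | empty => exact ⟨by simp, by simp, by simp, by simp⟩
  | insert i s hi ih =>
    simp only [Finset.sum_insert hi]
    exact (H i (Finset.mem_insert_self _ _)).add (ih (fun j hj => H j (Finset.mem_insert_of_mem hj)))

lemma IB.ind {ν : Measure (ℝ × ℝ)} {P : ℝ × ℝ → Prop} [DecidablePred P] {m : ℝ} (hP : MeasurableSet {p | P p}) (hm : 0 ≤ m)
    (h : ν {p | P p} ≤ ENNReal.ofReal m) : IB ν (fun p => if P p then 1 else 0) m := by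
  refine ⟨fun p => by positivity, Measurable.ite hP measurable_const measurable_const, hm, ?_⟩
  have : ∀ p, ENNReal.ofReal (if P p then 1 else 0) = {p | P p}.indicator (fun _ => (1:ℝ≥0∞)) p := by
    intro p
    by_cases hp : P p <;> simp [hp, indicator]
  simp only [this]
  rw [lintegral_indicator_const hP, one_mul]
  exact h

lemma IB.mono {ν : Measure (ℝ × ℝ)} {h : ℝ × ℝ → ℝ} {m n : ℝ} (H : IB ν h m) (hmn : m ≤ n) : IB ν h n :=
  ⟨H.nn, H.meas, H.m0.trans hmn, H.int.trans (ENNReal.ofReal_le_ofReal hmn)⟩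

lemma diam_pair {a b K δ : ℝ} {F : Finset (ℝ → ℝ)} (H : Good a b K F) (hδ : 0 < δ) {i j : ℕ}
    {f g : ℝ → ℝ} (hf : f ∈ F) (hg : g ∈ F) (hd : dd a f g ≤ tt δ i) {x y : ℝ} (hx : x ∈ Icc a b) (hy : y ∈ Icc a b)
    (hxy : |x - y| ≤ ll K δ i j) (hx2 : |f x - g x| ≤ 2 * δ) (hy2 : |f y - g y| ≤ 2 * δ)
    (hs : slope δ i j f g x) : |x - y| ≤ 16 * δ / DD δ i j := by
  obtain ⟨q, hq⟩ := exists_nat_ge (10240 * K^2)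
  have L := lev_of H.hK hδ hq i j
  have hΔ := L.hΔ
  have ht := L.ht
  have hK := L.hK
  rcases hs.2 with h0 | h1
  · refine hxy.trans ?_
    rw [L.hℓ, div_le_div_iff₀ (by positivity) hΔ]
    have h2 := L.hρ
    have h3 : rr δ j = δ := by subst h0; simp [rr]
    rw [h3] at h2
    have : DD δ i j * DD δ i j = δ * tt δ i := by rw [h2]; ring
    rw [this]
    have h5 : 0 < δ * tt δ i := by positivity
    nlinarith
  · obtain ⟨e1, e2⟩ := deriv_lc2 (H.smooth f hf) (H.smooth g hg) 1
    simp only [one_mul] at e1 e2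
    have D0 : Differentiable ℝ (fun x => f x - g x) := (c2_diff (H.smooth f hf)).1.sub (c2_diff (H.smooth g hg)).1
    rw [le_div_iff₀ hΔ]
    have key : ∃ θ ∈ uIcc x y, (f x - g x) - (f y - g y) = (deriv f θ - deriv g θ) * (x - y) := by
      rcases lt_trichotomy x y with h | h | h
      · obtain ⟨c, hc, he⟩ := exists_deriv_eq_slope (fun x => f x - g x) h D0.continuous.continuousOn D0.differentiableOn
        refine ⟨c, by rw [uIcc_of_le h.le]; exact ⟨hc.1.le, hc.2.le⟩, ?_⟩
        rw [e1] at he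
        have : y - x ≠ 0 := by linarith
        field_simp at he
        linarith
      · exact ⟨x, left_mem_uIcc, by rw [h]; ring⟩
      · obtain ⟨c, hc, he⟩ := exists_deriv_eq_slope (fun x => f x - g x) h D0.continuous.continuousOn D0.differentiableOn
        refine ⟨c, by rw [uIcc_of_ge h.le]; exact ⟨hc.1.le, hc.2.le⟩, ?_⟩
        rw [e1] at he
        have : x - y ≠ 0 := by linarith
        field_simp at he
        linarith
    obtain ⟨θ, hθ, he⟩ := key
    have hθm : θ ∈ Icc a b := by
      have := uIcc_subset_Icc hx hy
      exact this hθ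
    have hxθ : |x - θ| ≤ ll K δ i j := by
      have := abs_sub_left_of_mem_uIcc hθ
      rw [abs_sub_comm x θ]
      rw [abs_sub_comm y x] at this
      exact this.trans hxy
    have s1 := slope_lip L H hf hg hd hx hθm hxθ
    have s2 := abs_sub_abs_le_abs_sub (deriv f x - deriv g x) (deriv f θ - deriv g θ)
    have s3 : 3 / 8 * DD δ i j ≤ |deriv f θ - deriv g θ| := by linarith
    have s4 : |(f x - g x) - (f y - g y)| ≤ 4 * δ := (abs_sub _ _).trans (by linarith)
    rw [he, abs_mul] at s4
    have s5 := mul_le_mul_of_nonneg_right s3 (abs_nonneg (x - y))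
    nlinarith
end WM

namespace WM
open scoped Classical

lemma kk_meas (a ℓ : ℝ) (k : ℕ) : MeasurableSet {p : ℝ × ℝ | k = kk a ℓ p.1} := by
  have h : Measurable (fun p : ℝ × ℝ => kk a ℓ p.1) := by
    unfold kk
    exact Nat.measurable_floor.comp (by fun_prop)
  have := h (measurableSet_singleton k)
  convert this using 1
  ext p; simp [eq_comm]

lemma tube_ms {f : ℝ → ℝ} (hf : Continuous f) (δ : ℝ) : MeasurableSet {p : ℝ × ℝ | |f p.1 - p.2| ≤ δ} :=
  (isClosed_le (f := fun p : ℝ × ℝ => |f p.1 - p.2|) (by fun_prop) continuous_const).measurableSet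

lemma slope_ms {f g : ℝ → ℝ} (hf : ContDiff ℝ 2 f) (hg : ContDiff ℝ 2 g) (δ : ℝ) (i j : ℕ) :
    MeasurableSet {p : ℝ × ℝ | slope δ i j f g p.1} := by
  have c1 : Continuous (deriv f) := (c2_diff hf).2.1.continuous
  have c2 : Continuous (deriv g) := (c2_diff hg).2.1.continuous
  have c : Continuous (fun p : ℝ × ℝ => |deriv f p.1 - deriv g p.1|) := by fun_prop
  unfold slope
  apply MeasurableSet.inter
  · exact (isClosed_le c continuous_const).measurableSet
  · apply MeasurableSet.union
    · exact MeasurableSet.const _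
    · exact (isOpen_lt continuous_const c).measurableSet

/-- the measure hypothesis -/
structure NU (ν : Measure (ℝ × ℝ)) (a b δ α c : ℝ) : Prop where
  c0 : 0 ≤ c
  supp : ∀ᵐ p ∂ν, p.1 ∈ Icc a b
  tube : ∀ f : ℝ → ℝ, Continuous f → ∀ X : Set ℝ, X ⊆ Icc a b → ∀ r : ℝ, 0 ≤ r →
    (∀ x ∈ X, ∀ y ∈ X, |x - y| ≤ r) →
    ν {p : ℝ × ℝ | p.1 ∈ X ∧ |f p.1 - p.2| ≤ δ} ≤ ENNReal.ofReal (c * r ^ α)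

lemma NU.le {ν : Measure (ℝ × ℝ)} {a b δ α c : ℝ} (N : NU ν a b δ α c) {f : ℝ → ℝ} (hf : Continuous f)
    {X : Set ℝ} {r : ℝ} (hr : 0 ≤ r) (hd : ∀ x ∈ X, ∀ y ∈ X, x ∈ Icc a b → y ∈ Icc a b → |x - y| ≤ r)
    {P : ℝ × ℝ → Prop} (hP : ∀ p, P p → p.1 ∈ X ∧ |f p.1 - p.2| ≤ δ) :
    ν {p | P p} ≤ ENNReal.ofReal (c * r ^ α) := by
  refine le_trans ?_ (N.tube f hf (X ∩ Icc a b) inter_subset_right r hr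
    (fun x hx y hy => hd x hx.1 y hy.1 hx.2 hy.2))
  apply measure_mono_ae
  filter_upwards [N.supp] with p hp
  intro h
  exact ⟨⟨(hP p h).1, hp⟩, (hP p h).2⟩

lemma kk_diam {a ℓ x y : ℝ} (hℓ : 0 < ℓ) (hx : a ≤ x) (hy : a ≤ y) (h : kk a ℓ x = kk a ℓ y) : |x - y| ≤ ℓ := by
  have h1 := kk_spec hℓ hx
  have h2 := kk_spec hℓ hy
  rw [h] at h1
  rw [abs_le]; constructor <;> linarith [h1.1, h1.2, h2.1, h2.2]

lemma ll_pos {K δ : ℝ} (hK : 1 ≤ K) (hδ : 0 < δ) (i j : ℕ) : 0 < ll K δ i j := by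
  unfold ll DD tt; positivity

lemma DD_pos {δ : ℝ} (hδ : 0 < δ) (i j : ℕ) : 0 < DD δ i j := by unfold DD; positivity

lemma thr_ib {ν : Measure (ℝ × ℝ)} {a b K δ α c : ℝ} (N : NU ν a b δ α c) {F S : Finset (ℝ → ℝ)} (H : Good a b K F)
    (hS : S ⊆ F) :
    IB ν (fun p => ((thr δ p S).card : ℝ)) (S.card * (c * (b - a) ^ α)) := by
  have e : (fun p => ((thr δ p S).card : ℝ)) = fun p => ∑ f ∈ S, if |f p.1 - p.2| ≤ δ then (1:ℝ) else 0 := by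
    funext p; unfold thr; rw [Finset.sum_boole]
  have hab := H.hab
  have hab' : 0 ≤ b - a := by linarith
  rw [e, ← nsmul_eq_mul, ← Finset.sum_const]
  apply IB.sum
  intro f hf
  have cf := (c2_diff (H.smooth f (hS hf))).1.continuous
  refine IB.ind (tube_ms cf δ) (mul_nonneg N.c0 (Real.rpow_nonneg hab' _)) ?_
  exact N.le cf (X := univ) hab' (fun x _ y _ hx hy => by
    rw [abs_le]; constructor <;> linarith [hx.1, hx.2, hy.1, hy.2]) (fun p hp => ⟨mem_univ _, hp⟩)

lemma thrO_ib {ν : Measure (ℝ × ℝ)} {a b K δ α c : ℝ} (N : NU ν a b δ α c) {F S : Finset (ℝ → ℝ)} (H : Good a b K F)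
    (hS : S ⊆ F) {ℓ : ℝ} (hℓ : 0 < ℓ) (k : ℕ) :
    IB ν (fun p => if k = kk a ℓ p.1 then ((thr δ p S).card : ℝ) else 0) (S.card * (c * ℓ ^ α)) := by
  have e : (fun p : ℝ × ℝ => if k = kk a ℓ p.1 then ((thr δ p S).card : ℝ) else 0) =
      fun p => ∑ f ∈ S, if (k = kk a ℓ p.1 ∧ |f p.1 - p.2| ≤ δ) then (1:ℝ) else 0 := by
    funext p; unfold thr; rw [← Finset.sum_boole]
    by_cases h : k = kk a ℓ p.1 <;> simp [h]
  rw [e, ← nsmul_eq_mul, ← Finset.sum_const]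
  apply IB.sum
  intro f hf
  have cf := (c2_diff (H.smooth f (hS hf))).1.continuous
  refine IB.ind (P := fun p => k = kk a ℓ p.1 ∧ |f p.1 - p.2| ≤ δ) ((kk_meas a ℓ k).inter (tube_ms cf δ)) (mul_nonneg N.c0 (Real.rpow_nonneg hℓ.le _)) ?_
  exact N.le cf (X := {x | k = kk a ℓ x}) hℓ.le (fun x h1 y h2 hx hy => kk_diam hℓ hx.1 hy.1 (h1.symm.trans h2))
    (fun p hp => hp)

lemma thrP_ib {ν : Measure (ℝ × ℝ)} {a b K δ α c : ℝ} (N : NU ν a b δ α c) {F : Finset (ℝ → ℝ)} (H : Good a b K F)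
    (hδ : 0 < δ) {S : Finset ((ℝ → ℝ) × (ℝ → ℝ))} {i j : ℕ}
    (hS : ∀ y ∈ S, y.1 ∈ F ∧ y.2 ∈ F ∧ dd a y.1 y.2 ≤ tt δ i) (k : ℕ) :
    IB ν (fun p => if k = kk a (ll K δ i j) p.1 then ((thr2 δ i j p S).card : ℝ) else 0)
      (S.card * (c * (16 * δ / DD δ i j) ^ α)) := by
  have e : (fun p : ℝ × ℝ => if k = kk a (ll K δ i j) p.1 then ((thr2 δ i j p S).card : ℝ) else 0) =
      fun p => ∑ y ∈ S, if (k = kk a (ll K δ i j) p.1 ∧ |y.1 p.1 - p.2| ≤ δ ∧ |y.2 p.1 - p.2| ≤ δ ∧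
        slope δ i j y.1 y.2 p.1) then (1:ℝ) else 0 := by
    funext p; unfold thr2; rw [← Finset.sum_boole]
    by_cases h : k = kk a (ll K δ i j) p.1 <;> simp [h]
  rw [e, ← nsmul_eq_mul, ← Finset.sum_const]
  have hr : 0 ≤ 16 * δ / DD δ i j := div_nonneg (by linarith) (DD_pos hδ i j).le
  have hℓ := ll_pos (K := K) H.hK hδ i j
  apply IB.sum
  intro y hy
  obtain ⟨f1, f2, hd⟩ := hS y hy
  have cf := (c2_diff (H.smooth _ f1)).1.continuous
  have cg := (c2_diff (H.smooth _ f2)).1.continuous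
  refine IB.ind (P := fun p => k = kk a (ll K δ i j) p.1 ∧ |y.1 p.1 - p.2| ≤ δ ∧ |y.2 p.1 - p.2| ≤ δ ∧ slope δ i j y.1 y.2 p.1)
    ((kk_meas a _ k).inter ((tube_ms cf δ).inter ((tube_ms cg δ).inter
    (slope_ms (H.smooth _ f1) (H.smooth _ f2) δ i j)))) (mul_nonneg N.c0 (Real.rpow_nonneg hr _)) ?_
  refine N.le cf (X := {x | k = kk a (ll K δ i j) x ∧ |y.1 x - y.2 x| ≤ 2 * δ ∧ slope δ i j y.1 y.2 x}) hr ?_ ?_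
  · rintro x ⟨h1, h2, h3⟩ z ⟨g1, g2, g3⟩ hx hz
    exact diam_pair H hδ f1 f2 hd hx hz (kk_diam hℓ hx.1 hz.1 (h1.symm.trans g1)) h2 g2 h3
  · rintro p ⟨h1, h2, h3, h4⟩
    refine ⟨⟨h1, ?_, h4⟩, h2⟩
    have := abs_sub_le (y.1 p.1) p.2 (y.2 p.1)
    rw [abs_sub_comm p.2 (y.2 p.1)] at this
    linarith

lemma Ol_sub {F : Finset (ℝ → ℝ)} {a K δ : ℝ} {l : ℕ × ℕ} {r} : Ol F a K δ l r ⊆ F := fun _ hf =>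
  (Finset.mem_filter.1 (Finset.mem_filter.1 (Finset.mem_filter.1 hf).1).1).1

lemma Fl_sub {F : Finset (ℝ → ℝ)} {a K δ : ℝ} {l : ℕ × ℕ} {r} : Fl F a K δ l r ⊆ F := fun _ hf =>
  (Finset.mem_filter.1 (Finset.mem_filter.1 hf).1).1

lemma integrated {ν : Measure (ℝ × ℝ)} {a b K δ Q α c : ℝ} (N : NU ν a b δ α c) {F : Finset (ℝ → ℝ)}
    (H : Good a b K F) (hδ : 0 < δ) (hα : 0 < α) {L1 M2 : ℕ} (hL0 : 1 ≤ L1)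
    (hL1 : K ≤ 4^L1 * δ) (hM2 : K * 2^L1 ≤ 2^M2) (hdK : ∀ f ∈ F, ∀ g ∈ F, dd a f g ≤ K) (hQ0 : 0 ≤ Q)
    (hQ : ∀ f ∈ F, ((F.filter (fun g => dd a f g ≤ δ)).card : ℝ) ≤ Q)
    (s : ℕ × ℕ → ((_ : ℤ × ℤ × ℤ) × (ℕ × ℤ × ℤ)) → ℝ) (hs : ∀ l r, 0 < s l r) :
    ∫⁻ p, ENNReal.ofReal (((thr δ p F).card : ℝ) ^ ((3:ℝ)/2)) ∂ν ≤ ENNReal.ofReal (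
      √(2 * Q) * (F.card * (c * (b - a)^α)) +
      (4 * (L1 * (M2 + 1) : ℕ) * 15125)^2 * ∑ l ∈ Finset.range L1 ×ˢ Finset.range (M2 + 1),
        ∑ r ∈ IXl F a b K δ l,
          (s l r * ((Ol F a K δ l r).card * (c * (ll K δ l.1 l.2)^α)) +
            (s l r)⁻¹ * ((Pl F a K δ l r).card * (c * (16 * δ / DD δ l.1 l.2)^α)))) := by
  have I : IB ν (fun p => √(2 * Q) * (thr δ p F).card +
      (4 * (L1 * (M2 + 1) : ℕ) * 15125)^2 * ∑ l ∈ Finset.range L1 ×ˢ Finset.range (M2 + 1),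
        ∑ r ∈ IXl F a b K δ l,
          (s l r * (if r.2.1 = kk a (ll K δ l.1 l.2) p.1 then ((thr δ p (Ol F a K δ l r)).card : ℝ) else 0) +
            (s l r)⁻¹ * (if r.2.1 = kk a (ll K δ l.1 l.2) p.1 then
              ((thr2 δ l.1 l.2 p (Pl F a K δ l r)).card : ℝ) else 0))) (√(2 * Q) * (F.card * (c * (b - a)^α)) +
      (4 * (L1 * (M2 + 1) : ℕ) * 15125)^2 * ∑ l ∈ Finset.range L1 ×ˢ Finset.range (M2 + 1),
        ∑ r ∈ IXl F a b K δ l,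
          (s l r * ((Ol F a K δ l r).card * (c * (ll K δ l.1 l.2)^α)) +
            (s l r)⁻¹ * ((Pl F a K δ l r).card * (c * (16 * δ / DD δ l.1 l.2)^α)))) := by
    refine ((thr_ib N H (Finset.Subset.refl F)).smul (Real.sqrt_nonneg _)).add (IB.smul (IB.sum _ (fun l _ =>
      IB.sum _ (fun r _ => ((thrO_ib N H Ol_sub (ll_pos H.hK hδ l.1 l.2) r.2.1).smul (hs l r).le).add
        ((thrP_ib N H hδ (fun y hy => ?_) r.2.1).smul (inv_pos.2 (hs l r)).le)))) (sq_nonneg _))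
    obtain ⟨h1, h2, h3⟩ := Finset.mem_filter.1 hy
    obtain ⟨m1, m2⟩ := Finset.mem_product.1 h1
    exact ⟨(Finset.mem_filter.1 (Finset.mem_filter.1 m1).1).1, (Finset.mem_filter.1 (Finset.mem_filter.1 m2).1).1, h3⟩
  refine le_trans ?_ I.int
  apply lintegral_mono_ae
  filter_upwards [N.supp] with p hp
  apply ENNReal.ofReal_le_ofReal
  refine (pointwise H hδ hL0 hL1 hM2 hdK hQ0 hQ s (fun l r _ => hs l r) p hp).trans (le_of_eq ?_)
  congr 2
  refine Finset.sum_congr rfl (fun l _ => ?_)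
  rw [Finset.sum_filter]
  refine Finset.sum_congr rfl (fun r _ => ?_)
  by_cases h : r.2.1 = kk a (ll K δ l.1 l.2) p.1
  · simp only [h, if_true]; ring
  · simp only [h, if_false]; ring
end WM

namespace WM
open scoped Classical

lemma per_rect {O M P c α ℓ w : ℝ} (hO : 0 ≤ O) (hOM : O ≤ M) (hP0 : 0 ≤ P) (hP : P ≤ 2 * O * M) (hc : 0 ≤ c)
    (hℓ : 0 < ℓ) (hw : 0 < w) {s : ℝ} (hs : s = if M = 0 then 1 else √M * (w / ℓ) ^ (α / 2)) :
    s * (O * (c * ℓ ^ α)) + s⁻¹ * (P * (c * w ^ α)) ≤ 3 * c * (ℓ * w) ^ (α / 2) * (O * √M) := by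
  by_cases hM : M = 0
  · have : O = 0 := by linarith
    have : P = 0 := by subst this; nlinarith
    simp [*]
  have hM0 : 0 < M := lt_of_le_of_ne (hO.trans hOM) (Ne.symm hM)
  rw [if_neg hM] at hs
  have hm : 0 < √M := Real.sqrt_pos.2 hM0
  have hmm : √M * √M = M := Real.mul_self_sqrt hM0.le
  have e1 : ℓ ^ α = ℓ ^ (α/2) * ℓ ^ (α/2) := by rw [← Real.rpow_add hℓ]; ring_nf
  have e2 : w ^ α = w ^ (α/2) * w ^ (α/2) := by rw [← Real.rpow_add hw]; ring_nf
  rw [Real.div_rpow hw.le hℓ.le] at hs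
  rw [Real.mul_rpow hℓ.le hw.le, e1, e2, hs]
  have hu : 0 < ℓ ^ (α/2) := Real.rpow_pos_of_pos hℓ _
  have hv : 0 < w ^ (α/2) := Real.rpow_pos_of_pos hw _
  generalize ℓ ^ (α/2) = u at *
  generalize w ^ (α/2) = v at *
  have t1 : √M * (v / u) * (O * (c * (u * u))) = c * (u * v) * (O * √M) := by field_simp
  have t2 : (√M * (v / u))⁻¹ * (P * (c * (v * v))) = c * (u * v) * (P / √M) := by field_simp
  have t3 : P / √M ≤ 2 * (O * √M) := by
    rw [div_le_iff₀ hm]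
    calc P ≤ 2 * O * M := hP
      _ = 2 * O * (√M * √M) := by rw [hmm]
      _ = _ := by ring
  rw [t1, t2]
  have : c * (u * v) * (P / √M) ≤ c * (u * v) * (2 * (O * √M)) := by gcongr
  linarith

lemma RC_lt {F : Finset (ℝ → ℝ)} {a b t ℓ ρ Δ : ℝ} {c} {R} (hR : R ∈ RC F a b t ℓ ρ Δ c) : R.1 < kmax a b ℓ := by
  obtain ⟨x, hx, rfl⟩ := Finset.mem_image.1 hR
  exact Finset.mem_range.1 (Finset.mem_product.1 hx).1

lemma kmax_le {a b ℓ : ℝ} (hℓ : 0 < ℓ) (hab : a ≤ b) {k : ℕ} (hk : k < kmax a b ℓ) : a + k * ℓ ≤ b := by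
  unfold kmax at hk
  have h1 : k ≤ ⌊(b - a) / ℓ⌋₊ := by omega
  have h2 : (k:ℝ) ≤ (b - a) / ℓ := (Nat.le_floor_iff (div_nonneg (by linarith) hℓ.le)).1 h1
  rw [le_div_iff₀ hℓ] at h2
  linarith

lemma RC_card {F : Finset (ℝ → ℝ)} {a b t ℓ ρ Δ : ℝ} {c} :
    (RC F a b t ℓ ρ Δ c).card ≤ kmax a b ℓ * F.card := by
  refine Finset.card_image_le.trans ?_
  rw [Finset.card_product, Finset.card_range]
  exact Nat.mul_le_mul_left _ (Finset.card_le_card (Finset.filter_subset _ _))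

lemma sum_FR (Rs : Finset (ℕ × ℤ × ℤ)) (X : Finset (ℝ → ℝ)) {a ℓ ρ Δ : ℝ} (hρ : 0 < ρ) (hΔ : 0 < Δ) (k : ℕ)
    (hk : ∀ R ∈ Rs, R.1 < k) : ∑ R ∈ Rs, (FR X a ℓ ρ Δ R).card ≤ k * (X.card * 121) := by
  have h1 : ∑ R ∈ Rs, (FR X a ℓ ρ Δ R).card =
      ∑ i ∈ Finset.range k, ∑ R ∈ Rs.filter (fun R => R.1 = i), (FR X a ℓ ρ Δ R).card :=
    (Finset.sum_fiberwise_of_maps_to (fun R hR => Finset.mem_range.2 (hk R hR)) _).symm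
  rw [h1]
  refine (Finset.sum_le_card_nsmul _ _ (X.card * 121) (fun i _ => ?_)).trans (by simp)
  have h2 : ∀ R, (FR X a ℓ ρ Δ R).card = ∑ f ∈ X, if f ∈ FR X a ℓ ρ Δ R then 1 else 0 := by
    intro R
    rw [← Finset.card_filter]
    congr 1
    ext f
    simp only [Finset.mem_filter]
    exact ⟨fun h => ⟨(Finset.mem_filter.1 h).1, h⟩, fun h => h.2⟩
  simp only [h2]
  rw [Finset.sum_comm]
  refine (Finset.sum_le_card_nsmul _ _ 121 (fun f _ => ?_)).trans (by simp)
  rw [← Finset.card_filter, Finset.filter_filter]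
  exact overlap_rects Rs X hρ hΔ i f

lemma star_num {q N x y z Λ : ℝ} (hq : 0 ≤ q) (hN : 0 ≤ N) (hx0 : 0 ≤ x) (hy0 : 0 ≤ y) (hz0 : 0 ≤ z) (hx : x ≤ Λ) (hy : y ≤ Λ) (hz : z ≤ Λ)
    (hΛ : 1 ≤ Λ) : 2 * (q^3 * x^2 * (453 * y * √(N^3 * z^3))) ≤ 906 * q^3 * Λ^5 * √(N^3) := by
  have h1 : √(N^3 * z^3) ≤ √(N^3) * Λ^2 := by
    rw [Real.sqrt_mul (by positivity)]
    gcongr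
    rw [Real.sqrt_le_left (by positivity)]
    calc z^3 ≤ Λ^3 := by gcongr
      _ ≤ Λ^4 := pow_le_pow_right₀ hΛ (by norm_num)
      _ = (Λ^2)^2 := by ring
  calc 2 * (q^3 * x^2 * (453 * y * √(N^3 * z^3))) ≤ 2 * (q^3 * Λ^2 * (453 * Λ * (√(N^3) * Λ^2))) := by gcongr
    _ = _ := by ring

lemma natlog_le (n : ℕ) : ((Nat.log 2 n : ℕ) : ℝ) ≤ 2 * Real.log n := by
  rcases Nat.eq_zero_or_pos n with rfl | hn
  · simp
  have h := Real.natLog_le_logb n 2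
  have hl : (1:ℝ)/2 ≤ Real.log 2 := by linarith [Real.log_two_gt_d9]
  have h0 : 0 ≤ Real.log n := Real.log_natCast_nonneg n
  refine h.trans ?_
  unfold Real.logb
  push_cast
  rw [div_le_iff₀ (by linarith)]
  nlinarith

lemma kmax_bd {a b K δ : ℝ} {F : Finset (ℝ → ℝ)} (H : Good a b K F) (hδ : 0 < δ) {L1 i j : ℕ} (hi : i < L1) :
    kmax a b (ll K δ i j) ≤ 2^(L1+1) := by
  have hK := H.hK
  have hl := H.len
  have hab := H.hab
  have h1 : (b - a) / ll K δ i j ≤ 2^L1 := by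
    rw [div_le_iff₀ (ll_pos hK hδ i j)]
    unfold ll tt DD
    rw [← mul_div_assoc, le_div_iff₀ (by positivity)]
    have e : (4:ℝ)^(i+1) = 2^(i+1) * 2^(i+1) := by rw [← mul_pow]; norm_num
    have h5 : (2:ℝ)^(i+1) ≤ 2^L1 := pow_le_pow_right₀ (by norm_num) (by omega)
    have h6 : (2:ℝ)^(i+1) ≤ 2^(i+1+j) := pow_le_pow_right₀ (by norm_num) (by omega)
    have h7 : (b - a) * (8 * K) ≤ 1 := by
      have : 0 ≤ b - a := by linarith
      nlinarith [mul_nonneg this (by linarith : 0 ≤ K - 1), mul_nonneg (mul_nonneg this (by linarith : 0 ≤ K)) (by linarith : 0 ≤ K - 1)]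
    calc (b - a) * (8 * K * (4^(i+1) * δ)) = ((b - a) * (8 * K)) * (2^(i+1) * 2^(i+1) * δ) := by rw [e]; ring
      _ ≤ 1 * (2^(i+1) * 2^(i+1) * δ) := by gcongr
      _ ≤ 1 * (2^L1 * 2^(i+1+j) * δ) := by gcongr
      _ = _ := by ring
  have h2 : ⌊(b - a) / ll K δ i j⌋₊ ≤ 2^L1 := by
    have := Nat.floor_le_floor h1
    have e : ⌊(2:ℝ)^L1⌋₊ = 2^L1 := by exact_mod_cast Nat.floor_natCast (R := ℝ) (2^L1)
    rwa [e] at this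
  unfold kmax
  have : 1 ≤ 2^L1 := Nat.one_le_two_pow
  rw [pow_succ]; omega

lemma cell_sum {a b K δ Λ : ℝ} {q : ℕ} {F : Finset (ℝ → ℝ)} (H : Good a b K F) (hδ : 0 < δ)
    (hq : 10240 * K^2 ≤ q) {L1 i j : ℕ} (hi : i < L1) (hΛ : (L1:ℝ) + 3 + 2 * Real.log F.card ≤ Λ) (c : ℤ × ℤ × ℤ) :
    ∑ R ∈ RC F a b (tt δ i) (ll K δ i j) (rr δ j) (DD δ i j) c,
      ((OR (XC F a (tt δ i) c) a (ll K δ i j) (rr δ j) (DD δ i j) (tt δ i) R).card : ℝ) *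
        √((FR (XC F a (tt δ i) c) a (ll K δ i j) (rr δ j) (DD δ i j) R).card) ≤
      906 * (q:ℝ)^3 * Λ^5 * √(((XC F a (tt δ i) c).card : ℝ)^3) := by
  have L := lev_of H.hK hδ hq i j
  have hK := H.hK
  have hX : XC F a (tt δ i) c ⊆ F := Finset.filter_subset _ _
  have hcX := Finset.card_le_card hX
  have hlF : 0 ≤ Real.log F.card := Real.log_natCast_nonneg _
  have hL10 : (0:ℝ) ≤ L1 := Nat.cast_nonneg _
  have hΛ1 : 1 ≤ Λ := by linarith
  have kb := kmax_bd H hδ (j := j) hi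
  have hq1 : (1:ℝ) ≤ q := by nlinarith
  by_cases hcase : 640 * K * DD δ i j ≤ tt δ i
  · refine (star L H hX hcase _ (L1+1) (fun R hR => ⟨kmax_le L.ℓpos H.hab (RC_lt hR), (RC_lt hR).trans_le kb⟩)).trans ?_
    set Rs := RC F a b (tt δ i) (ll K δ i j) (rr δ j) (DD δ i j) c with hRs
    have hz : Real.log Rs.card ≤ L1 + 1 + Real.log F.card := by
      have h1 : Rs.card ≤ 2^(L1+1) * F.card := RC_card.trans (Nat.mul_le_mul_right _ kb)
      rcases Nat.eq_zero_or_pos Rs.card with h0 | h0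
      · rw [h0]; simp; linarith
      have hF0 : 0 < F.card := by
        rcases Nat.eq_zero_or_pos F.card with h | h
        · rw [h] at h1; omega
        · exact h
      have h2 : (Rs.card : ℝ) ≤ 2^(L1+1) * F.card := by exact_mod_cast h1
      have h3 := Real.log_le_log (by exact_mod_cast h0) h2
      have hF0' : (F.card : ℝ) ≠ 0 := by exact_mod_cast hF0.ne'
      rw [Real.log_mul (by positivity) hF0', Real.log_pow] at h3
      have h4 : Real.log 2 ≤ 1 := by linarith [Real.log_two_lt_d9]
      push_cast at h3
      nlinarith
    have hx : ((Nat.log 2 (XC F a (tt δ i) c).card : ℕ) : ℝ) ≤ 2 * Real.log F.card := by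
      refine le_trans ?_ (natlog_le F.card)
      exact_mod_cast Nat.log_mono_right hcX
    have hz0 : 0 ≤ Real.log Rs.card := Real.log_natCast_nonneg _
    refine star_num (Nat.cast_nonneg q) (Nat.cast_nonneg _) (by positivity) (by positivity) (by linarith) (by linarith) ?_ (by linarith) hΛ1
    push_cast; linarith
  · push Not at hcase
    have hk : kmax a b (ll K δ i j) ≤ 7 := by
      have h1 : (b - a) / ll K δ i j ≤ 6 := by
        rw [div_le_iff₀ L.ℓpos, L.hℓ, ← mul_div_assoc, le_div_iff₀ (mul_pos (by linarith) L.ht)]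
        have hba : 0 ≤ b - a := by linarith [H.hab]
        have h2 := H.len
        have hD := L.hΔ
        calc (b - a) * (8 * K * tt δ i) ≤ (b - a) * (8 * K * (640 * K * DD δ i j)) := by gcongr
          _ = (1000 * K^2 * (b - a)) * (5.12 * DD δ i j) := by ring
          _ ≤ 1 * (5.12 * DD δ i j) := by gcongr
          _ ≤ _ := by linarith
      have h2 := Nat.floor_le_floor h1
      have e : ⌊(6:ℝ)⌋₊ = 6 := by norm_num
      rw [e] at h2
      unfold kmax; omega
    set X := XC F a (tt δ i) c with hXd
    set Rs := RC F a b (tt δ i) (ll K δ i j) (rr δ j) (DD δ i j) c with hRs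
    have h3 := sum_FR Rs X (a := a) (ℓ := ll K δ i j) L.ρpos L.hΔ 7 (fun R hR => (RC_lt hR).trans_le hk)
    have h3' : ∑ R ∈ Rs, ((FR X a (ll K δ i j) (rr δ j) (DD δ i j) R).card : ℝ) ≤ 7 * (X.card * 121) := by
      exact_mod_cast h3
    have h4 : ∑ R ∈ Rs, ((OR X a (ll K δ i j) (rr δ j) (DD δ i j) (tt δ i) R).card : ℝ) *
        √((FR X a (ll K δ i j) (rr δ j) (DD δ i j) R).card) ≤
        ∑ R ∈ Rs, ((FR X a (ll K δ i j) (rr δ j) (DD δ i j) R).card : ℝ) * √X.card := by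
      apply Finset.sum_le_sum
      intro R _
      have g1 : (OR X a (ll K δ i j) (rr δ j) (DD δ i j) (tt δ i) R).card ≤ (FR X a (ll K δ i j) (rr δ j) (DD δ i j) R).card :=
        Finset.card_le_card (Finset.filter_subset _ _)
      have g2 : (FR X a (ll K δ i j) (rr δ j) (DD δ i j) R).card ≤ X.card := Finset.card_le_card (Finset.filter_subset _ _)
      gcongr
    refine h4.trans ?_
    rw [← Finset.sum_mul]
    have e : √((X.card:ℝ)^3) = X.card * √X.card := by
      rw [show (X.card:ℝ)^3 = X.card^2 * X.card by ring, Real.sqrt_mul (by positivity), Real.sqrt_sq (by positivity)]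
    rw [e]
    have hs := Real.sqrt_nonneg (X.card:ℝ)
    have hqΛ : 1 ≤ (q:ℝ)^3 * Λ^5 := one_le_mul_of_one_le_of_one_le (one_le_pow₀ hq1) (one_le_pow₀ hΛ1)
    calc _ ≤ (7 * (X.card * 121)) * √(X.card:ℝ) := by gcongr
      _ = 847 * (1 * (X.card * √(X.card:ℝ))) := by ring
      _ ≤ 906 * (((q:ℝ)^3 * Λ^5) * (X.card * √(X.card:ℝ))) := by gcongr; norm_num
      _ = _ := by ring
end WM

namespace WM
open scoped Classical

lemma XC_card {a δ Q ζ t : ℝ} {F : Finset (ℝ → ℝ)} (hδ : 0 < δ) (ht : δ ≤ t) (hQ0 : 0 ≤ Q)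
    (hQ : ∀ f ∈ F, ∀ r, δ ≤ r → ((F.filter (fun g => dd a f g ≤ r)).card : ℝ) ≤ Q * (r / δ)^ζ) (c : ℤ × ℤ × ℤ) :
    ((XC F a t c).card : ℝ) ≤ Q * (12 * t / δ)^ζ := by
  rcases (XC F a t c).eq_empty_or_nonempty with h | ⟨f, hf⟩
  · rw [h]; simp only [Finset.card_empty, Nat.cast_zero]
    have : 0 ≤ 12 * t / δ := div_nonneg (by linarith) hδ.le
    positivity
  · obtain ⟨hfF, h1, h2, h3⟩ := Finset.mem_filter.1 hf
    refine le_trans ?_ (hQ f hfF (12 * t) (by linarith))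
    refine Nat.cast_le.2 (Finset.card_le_card ?_)
    intro g hg
    obtain ⟨hgF, g1, g2, g3⟩ := Finset.mem_filter.1 hg
    refine Finset.mem_filter.2 ⟨hgF, ?_⟩
    unfold dd
    have e1 := abs_sub_le (f a) (t * c.1) (g a)
    have e2 := abs_sub_le (deriv f a) (t * c.2.1) (deriv g a)
    have e3 := abs_sub_le (deriv (deriv f) a) (t * c.2.2) (deriv (deriv g) a)
    rw [abs_sub_comm (t * (c.1:ℝ)) (g a)] at e1
    rw [abs_sub_comm (t * (c.2.1:ℝ)) (deriv g a)] at e2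
    rw [abs_sub_comm (t * (c.2.2:ℝ)) (deriv (deriv g) a)] at e3
    linarith

lemma cells_sum {a t M : ℝ} {F : Finset (ℝ → ℝ)} (ht : 0 < t) (𝓒 : Finset (ℤ × ℤ × ℤ))
    (hM : ∀ c, ((XC F a t c).card : ℝ) ≤ M) :
    ∑ c ∈ 𝓒, √(((XC F a t c).card : ℝ)^3) ≤ 125 * F.card * √M := by
  have h1 : ∑ c ∈ 𝓒, (XC F a t c).card ≤ F.card * 125 := by
    have h2 : ∀ c, (XC F a t c).card = ∑ f ∈ F, if f ∈ XC F a t c then 1 else 0 := by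
      intro c
      rw [← Finset.card_filter]
      congr 1
      ext f
      simp only [Finset.mem_filter]
      exact ⟨fun h => ⟨(Finset.mem_filter.1 h).1, h⟩, fun h => h.2⟩
    simp only [h2]
    rw [Finset.sum_comm]
    refine (Finset.sum_le_card_nsmul _ _ 125 (fun f _ => ?_)).trans (by simp)
    rw [← Finset.card_filter]
    exact overlap_cells 𝓒 F ht f
  have h1' : ∑ c ∈ 𝓒, ((XC F a t c).card : ℝ) ≤ F.card * 125 := by exact_mod_cast h1
  calc ∑ c ∈ 𝓒, √(((XC F a t c).card : ℝ)^3) ≤ ∑ c ∈ 𝓒, ((XC F a t c).card : ℝ) * √M := by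
        apply Finset.sum_le_sum
        intro c _
        rw [show ((XC F a t c).card:ℝ)^3 = (XC F a t c).card^2 * (XC F a t c).card by ring,
          Real.sqrt_mul (by positivity), Real.sqrt_sq (by positivity)]
        gcongr
        exact hM c
    _ ≤ (F.card * 125) * √M := by rw [← Finset.sum_mul]; gcongr
    _ = _ := by ring

noncomputable def ss (F : Finset (ℝ → ℝ)) (a K δ α : ℝ) (l : ℕ × ℕ) (r : (_ : ℤ × ℤ × ℤ) × (ℕ × ℤ × ℤ)) : ℝ :=
  if ((Fl F a K δ l r).card : ℝ) = 0 then 1 else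
    √((Fl F a K δ l r).card) * ((16 * δ / DD δ l.1 l.2) / ll K δ l.1 l.2) ^ (α / 2)

lemma ss_pos {F : Finset (ℝ → ℝ)} {a K δ α : ℝ} (hK : 1 ≤ K) (hδ : 0 < δ) (l r) : 0 < ss F a K δ α l r := by
  unfold ss
  split_ifs with h
  · norm_num
  · have h1 : (0:ℝ) < (Fl F a K δ l r).card := lt_of_le_of_ne (Nat.cast_nonneg _) (Ne.symm h)
    have h2 := ll_pos hK hδ l.1 l.2
    have h3 := DD_pos hδ l.1 l.2
    have h4 : 0 < (16 * δ / DD δ l.1 l.2) / ll K δ l.1 l.2 := div_pos (div_pos (by linarith) h3) h2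
    exact mul_pos (Real.sqrt_pos.2 h1) (Real.rpow_pos_of_pos h4 _)

lemma ll_DD {K δ : ℝ} (hK : 1 ≤ K) (hδ : 0 < δ) (i j : ℕ) :
    ll K δ i j * (16 * δ / DD δ i j) ≤ 2 / 4^(i+1) := by
  have h3 := DD_pos hδ i j
  unfold ll tt
  have h4 : (0:ℝ) < 4^(i+1) := by positivity
  have e : DD δ i j / (8 * K * (4^(i+1) * δ)) * (16 * δ / DD δ i j) = 2 / 4^(i+1) * (1 / K) := by
    field_simp; norm_num
  rw [e]
  have : 1 / K ≤ 1 := by rw [div_le_one (by linarith)]; exact hK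
  have h5 : (0:ℝ) ≤ 2 / 4^(i+1) := by positivity
  nlinarith

lemma pow_num {y Y α ζ : ℝ} (hy : 1 ≤ y) (hyY : y ≤ Y) (hα : 0 < α) (hαζ : α ≤ ζ) (hζ : ζ ≤ 1) :
    (2 / y)^(α/2) * √((12 * y)^ζ) ≤ 24 * Y ^ ((ζ - α)/2) := by
  have hy0 : 0 < y := by linarith
  rw [Real.sqrt_eq_rpow, ← Real.rpow_mul (by positivity), Real.div_rpow (by norm_num) hy0.le,
    Real.mul_rpow (by norm_num) hy0.le]
  have h1 : (2:ℝ)^(α/2) ≤ 2 := by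
    calc (2:ℝ)^(α/2) ≤ 2^(1:ℝ) := Real.rpow_le_rpow_of_exponent_le (by norm_num) (by linarith)
      _ = 2 := by norm_num
  have h2 : (12:ℝ)^(ζ*(1/2)) ≤ 12 := by
    calc (12:ℝ)^(ζ*(1/2)) ≤ 12^(1:ℝ) := Real.rpow_le_rpow_of_exponent_le (by norm_num) (by linarith)
      _ = 12 := by norm_num
  have h3 : y^(ζ*(1/2)) / y^(α/2) = y^((ζ-α)/2) := by
    rw [← Real.rpow_sub hy0]; ring_nf
  have h4 : y^((ζ-α)/2) ≤ Y^((ζ-α)/2) := Real.rpow_le_rpow hy0.le hyY (by linarith)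
  have h5 : 0 < y^((ζ-α)/2) := Real.rpow_pos_of_pos hy0 _
  calc 2^(α/2) / y^(α/2) * (12^(ζ*(1/2)) * y^(ζ*(1/2))) = 2^(α/2) * 12^(ζ*(1/2)) * (y^(ζ*(1/2)) / y^(α/2)) := by ring
    _ = 2^(α/2) * 12^(ζ*(1/2)) * y^((ζ-α)/2) := by rw [h3]
    _ ≤ 2 * 12 * Y^((ζ-α)/2) := by gcongr
    _ = _ := by ring

lemma level_sum {a b K δ Λ Q α ζ c : ℝ} {q : ℕ} {F : Finset (ℝ → ℝ)} (H : Good a b K F) (hδ : 0 < δ) (hα : 0 < α)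
    (hαζ : α ≤ ζ) (hζ : ζ ≤ 1) (hc : 0 ≤ c) (hQ0 : 0 ≤ Q)
    (hQ : ∀ f ∈ F, ∀ r, δ ≤ r → ((F.filter (fun g => dd a f g ≤ r)).card : ℝ) ≤ Q * (r / δ)^ζ)
    (hq : 10240 * K^2 ≤ q) {L1 : ℕ} {l : ℕ × ℕ} (hi : l.1 < L1) (hΛ : (L1:ℝ) + 3 + 2 * Real.log F.card ≤ Λ)
    (hΛ0 : 0 ≤ Λ) :
    ∑ r ∈ IXl F a b K δ l,
          (ss F a K δ α l r * ((Ol F a K δ l r).card * (c * (ll K δ l.1 l.2)^α)) +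
            (ss F a K δ α l r)⁻¹ * ((Pl F a K δ l r).card * (c * (16 * δ / DD δ l.1 l.2)^α))) ≤
      3 * 906 * 125 * 24 * (c * (q:ℝ)^3 * Λ^5 * F.card * √Q * (4^L1 : ℝ)^((ζ - α)/2)) := by
  have hK := H.hK
  have hℓ := ll_pos hK hδ l.1 l.2
  have hD := DD_pos hδ l.1 l.2
  have hw : 0 < 16 * δ / DD δ l.1 l.2 := div_pos (by linarith) hD
  have s1 : ∑ r ∈ IXl F a b K δ l,
          (ss F a K δ α l r * ((Ol F a K δ l r).card * (c * (ll K δ l.1 l.2)^α)) +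
            (ss F a K δ α l r)⁻¹ * ((Pl F a K δ l r).card * (c * (16 * δ / DD δ l.1 l.2)^α))) ≤
      ∑ r ∈ IXl F a b K δ l, 3 * c * (2 / 4^(l.1+1)) ^ (α / 2) *
        (((Ol F a K δ l r).card : ℝ) * √((Fl F a K δ l r).card)) := by
    apply Finset.sum_le_sum
    intro r _
    have hOF : ((Ol F a K δ l r).card : ℝ) ≤ (Fl F a K δ l r).card :=
      Nat.cast_le.2 (Finset.card_le_card (Finset.filter_subset _ _))
    refine (per_rect (M := (Fl F a K δ l r).card) (Nat.cast_nonneg _) hOF (Nat.cast_nonneg _) PR_card hc hℓ hw rfl).trans ?_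
    have := Real.rpow_le_rpow (mul_pos hℓ hw).le (ll_DD hK hδ l.1 l.2) (z := α/2) (by linarith)
    gcongr
  refine s1.trans ?_
  rw [← Finset.mul_sum]
  have s2 : ∑ r ∈ IXl F a b K δ l, (((Ol F a K δ l r).card : ℝ) * √((Fl F a K δ l r).card)) ≤
      906 * (q:ℝ)^3 * Λ^5 * (125 * F.card * √(Q * (12 * tt δ l.1 / δ)^ζ)) := by
    unfold IXl IX
    rw [Finset.sum_sigma]
    have ht : 0 < tt δ l.1 := by unfold tt; positivity
    have ht' : δ ≤ tt δ l.1 := by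
      unfold tt
      have : (1:ℝ) ≤ 4^(l.1+1) := one_le_pow₀ (by norm_num)
      nlinarith
    refine (Finset.sum_le_sum (fun c _ => cell_sum H hδ hq hi hΛ c)).trans ?_
    rw [← Finset.mul_sum]
    have := cells_sum ht (F.image (cel a (tt δ l.1))) (fun c => XC_card hδ ht' hQ0 hQ c)
    gcongr
  have e : 12 * tt δ l.1 / δ = 12 * 4^(l.1+1) := by unfold tt; field_simp
  rw [e, Real.sqrt_mul hQ0] at s2
  have s3 := pow_num (y := 4^(l.1+1)) (Y := 4^L1) (one_le_pow₀ (by norm_num))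
    (pow_le_pow_right₀ (by norm_num) (by omega)) hα hαζ hζ
  have h0 : (0:ℝ) ≤ (2 / 4^(l.1+1)) ^ (α / 2) := Real.rpow_nonneg (by positivity) _
  have h1 : (0:ℝ) ≤ c * (q:ℝ)^3 * Λ^5 * F.card * √Q := by positivity
  calc _ ≤ 3 * c * (2 / 4^(l.1+1)) ^ (α / 2) * (906 * (q:ℝ)^3 * Λ^5 * (125 * F.card * (√Q * √((12 * 4^(l.1+1))^ζ)))) := by
        gcongr
    _ = 3 * 906 * 125 * (c * (q:ℝ)^3 * Λ^5 * F.card * √Q) * ((2 / 4^(l.1+1)) ^ (α / 2) * √((12 * 4^(l.1+1))^ζ)) := by ring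
    _ ≤ 3 * 906 * 125 * (c * (q:ℝ)^3 * Λ^5 * F.card * √Q) * (24 * (4^L1 : ℝ)^((ζ - α)/2)) := by gcongr
    _ = _ := by ring

lemma piece_num {n c Q Λ q W x : ℝ} (hn : 0 ≤ n) (hc : 0 ≤ c) (hΛ : 1 ≤ Λ) (hq : 1 ≤ q) (hW : 1 ≤ W)
    (hx0 : 0 ≤ x) (hx : x ≤ Λ^2) :
    √(2 * Q) * (n * c) + (4 * x * 15125)^2 * (x * (3 * 906 * 125 * 24 * (c * q^3 * Λ^5 * n * √Q * W))) ≤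
      10^18 * q^3 * Λ^11 * (n * c * √Q * W) := by
  rw [Real.sqrt_mul (by norm_num)]
  have h2 : √2 ≤ 2 := by rw [Real.sqrt_le_left (by norm_num)]; norm_num
  have hP : 0 ≤ n * c * √Q := by positivity
  have h3 : 1 ≤ q^3 * Λ^11 * W :=
    one_le_mul_of_one_le_of_one_le (one_le_mul_of_one_le_of_one_le (one_le_pow₀ hq) (one_le_pow₀ hΛ)) hW
  have t1 : √2 * √Q * (n * c) ≤ 2 * (q^3 * Λ^11 * W * (n * c * √Q)) := by
    calc √2 * √Q * (n * c) = √2 * (1 * (n * c * √Q)) := by ring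
      _ ≤ 2 * (q^3 * Λ^11 * W * (n * c * √Q)) := by gcongr
  have t2 : (4 * x * 15125)^2 * (x * (3 * 906 * 125 * 24 * (c * q^3 * Λ^5 * n * √Q * W))) ≤
      (4 * 15125)^2 * 3 * 906 * 125 * 24 * (q^3 * Λ^11 * W * (n * c * √Q)) := by
    have : (4 * x * 15125)^2 * (x * (3 * 906 * 125 * 24 * (c * q^3 * Λ^5 * n * √Q * W))) =
      (4 * 15125)^2 * 3 * 906 * 125 * 24 * ((x^3 * Λ^5) * (q^3 * W * (n * c * √Q))) := by ring
    rw [this]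
    have e : x^3 * Λ^5 ≤ (Λ^2)^3 * Λ^5 := by gcongr
    have h4 : 0 ≤ q^3 * W * (n * c * √Q) := by positivity
    calc _ ≤ (4 * 15125)^2 * 3 * 906 * 125 * 24 * (((Λ^2)^3 * Λ^5) * (q^3 * W * (n * c * √Q))) := by gcongr
      _ = _ := by ring
  have h5 : 0 ≤ q^3 * Λ^11 * W * (n * c * √Q) := by positivity
  calc _ ≤ 2 * (q^3 * Λ^11 * W * (n * c * √Q)) + (4 * 15125)^2 * 3 * 906 * 125 * 24 * (q^3 * Λ^11 * W * (n * c * √Q)) :=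
        add_le_add t1 t2
    _ ≤ 10^18 * (q^3 * Λ^11 * W * (n * c * √Q)) := by nlinarith
    _ = _ := by ring

/-- bound on one short piece -/
lemma piece {ν : Measure (ℝ × ℝ)} {a b K δ Q α ζ c Λ : ℝ} {q : ℕ} (N : NU ν a b δ α c) {F : Finset (ℝ → ℝ)}
    (H : Good a b K F) (hδ : 0 < δ) (hα : 0 < α) (hαζ : α ≤ ζ) (hζ : ζ ≤ 1)
    {L1 M2 : ℕ} (hL0 : 1 ≤ L1) (hL1 : K ≤ 4^L1 * δ) (hM2 : K * 2^L1 ≤ 2^M2)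
    (hdK : ∀ f ∈ F, ∀ g ∈ F, dd a f g ≤ K) (hQ0 : 0 ≤ Q)
    (hQ : ∀ f ∈ F, ∀ r, δ ≤ r → ((F.filter (fun g => dd a f g ≤ r)).card : ℝ) ≤ Q * (r / δ)^ζ)
    (hq : 10240 * K^2 ≤ q) (hΛ : (L1:ℝ) + 3 + 2 * Real.log F.card ≤ Λ) (hΛ2 : (M2:ℝ) + 1 ≤ Λ) :
    ∫⁻ p, ENNReal.ofReal (((thr δ p F).card : ℝ) ^ ((3:ℝ)/2)) ∂ν ≤ ENNReal.ofReal (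
      10^18 * (q:ℝ)^3 * Λ^11 * (F.card * c * √Q * (4^L1 : ℝ)^((ζ - α)/2))) := by
  have hK := H.hK
  have hL10 : (0:ℝ) ≤ L1 := Nat.cast_nonneg _
  have hM20 : (0:ℝ) ≤ M2 := Nat.cast_nonneg _
  have hΛ1 : 1 ≤ Λ := by linarith
  have hlF : 0 ≤ Real.log F.card := Real.log_natCast_nonneg _
  have hq1 : (1:ℝ) ≤ q := by nlinarith
  have hQ1 : ∀ f ∈ F, ((F.filter (fun g => dd a f g ≤ δ)).card : ℝ) ≤ Q := by
    intro f hf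
    have := hQ f hf δ le_rfl
    rwa [div_self hδ.ne', Real.one_rpow, mul_one] at this
  refine (integrated N H hδ hα hL0 hL1 hM2 hdK hQ0 hQ1 (ss F a K δ α) (fun l r => ss_pos hK hδ l r)).trans ?_
  apply ENNReal.ofReal_le_ofReal
  have hba : (b - a)^α ≤ 1 := by
    apply Real.rpow_le_one _ _ hα.le
    · linarith [H.hab]
    · have := H.len; nlinarith [H.hab]
  have hc := N.c0
  refine le_trans (add_le_add (b := √(2 * Q) * (F.card * c)) ?_ (mul_le_mul_of_nonneg_left
    (Finset.sum_le_card_nsmul _ _ _ (fun l hl => level_sum H hδ hα hαζ hζ hc hQ0 hQ hq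
    (Finset.mem_range.1 (Finset.mem_product.1 hl).1) hΛ (by linarith))) (sq_nonneg _))) ?_
  · have : c * (b - a)^α ≤ c * 1 := by gcongr
    rw [mul_one] at this
    gcongr
  · rw [nsmul_eq_mul, Finset.card_product, Finset.card_range, Finset.card_range]
    refine piece_num (Nat.cast_nonneg _) hc hΛ1 hq1 ?_ (Nat.cast_nonneg _) ?_
    · exact Real.one_le_rpow (one_le_pow₀ (by norm_num)) (by linarith)
    · push_cast
      rw [sq]
      exact mul_le_mul (by linarith) hΛ2 (by linarith) (by linarith)
end WM

namespace WM
open scoped Classical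

lemma dd_le_c2 {a b : ℝ} {f g : ℝ → ℝ} (hf : ContDiff ℝ 2 f) (hg : ContDiff ℝ 2 g) {θ : ℝ} (hθ : θ ∈ Icc a b) :
    dd θ f g ≤ c2dist (Icc a b) f g := by
  unfold c2dist dd
  obtain ⟨f1, f2, f3⟩ := c2_diff hf
  obtain ⟨g1, g2, g3⟩ := c2_diff hg
  have f1 := f1.continuous
  have f2 := f2.continuous
  have g1 := g1.continuous
  have g2 := g2.continuous
  have hc : Continuous (fun θ => |f θ - g θ| + |deriv f θ - deriv g θ| + |deriv (deriv f) θ - deriv (deriv g) θ|) := by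
    fun_prop
  have hb := (isCompact_Icc (a := a) (b := b)).bddAbove_image hc.continuousOn
  exact le_csSup hb (mem_image_of_mem _ hθ)

lemma c2_le_dd {a b K : ℝ} (hK : 1 ≤ K) {𝓕 : Set (ℝ → ℝ)} (h : CinematicFamily (Icc a b) K 𝓕) {f g : ℝ → ℝ}
    (hf : f ∈ 𝓕) (hg : g ∈ 𝓕) {θ : ℝ} (hθ : θ ∈ Icc a b) : c2dist (Icc a b) f g ≤ K * dd θ f g := by
  have h1 := h.2.2 f hf g hg θ hθ
  rw [inv_mul_le_iff₀ (by linarith)] at h1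
  exact h1

lemma good_of {a b a' b' K : ℝ} (hK : 1 ≤ K) {𝓕 : Set (ℝ → ℝ)} (h : CinematicFamily (Icc a b) K 𝓕)
    {F : Finset (ℝ → ℝ)} (hF : ↑F ⊆ 𝓕) (hab : a' ≤ b') (hsub : Icc a' b' ⊆ Icc a b)
    (hlen : 1000 * K^2 * (b' - a') ≤ 1) : Good a' b' K F := by
  have ha' : a' ∈ Icc a b := hsub ⟨le_rfl, hab⟩
  refine ⟨hK, hab, hlen, fun f hf => h.1 f (hF hf), ?_, ?_⟩
  · intro f hf g hg θ hθ
    exact (dd_le_c2 (h.1 f (hF hf)) (h.1 g (hF hg)) ha').trans (c2_le_dd hK h (hF hf) (hF hg) (hsub hθ))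
  · intro f hf g hg θ hθ
    exact (dd_le_c2 (h.1 f (hF hf)) (h.1 g (hF hg)) (hsub hθ)).trans (c2_le_dd hK h (hF hf) (hF hg) ha')

lemma nonconc_of {a b a' K δ ε ζ : ℝ} (hK : 1 ≤ K) (hδ : 0 < δ) (hζ0 : 0 ≤ ζ) (hζ : ζ ≤ 1)
    {𝓕 : Set (ℝ → ℝ)} (h : CinematicFamily (Icc a b) K 𝓕)
    {F : Finset (ℝ → ℝ)} (hF : ↑F ⊆ 𝓕) (ha' : a' ∈ Icc a b)
    (hN : ∀ g : ℝ → ℝ, ContDiff ℝ 2 g → ∀ r : ℝ, δ ≤ r →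
        (({f ∈ (F : Set (ℝ → ℝ)) | c2dist (Icc a b) f g ≤ r}).ncard : ℝ) ≤ δ ^ (-ε) * (r / δ) ^ ζ) :
    ∀ f ∈ F, ∀ r, δ ≤ r → ((F.filter (fun g => dd a' f g ≤ r)).card : ℝ) ≤ (K * δ^(-ε)) * (r / δ)^ζ := by
  intro f hf r hr
  have h1 := hN f (h.1 f (hF hf)) (K * r) (by nlinarith)
  have h2 : (F.filter (fun g => dd a' f g ≤ r)).card ≤ ({g ∈ (F : Set (ℝ → ℝ)) | c2dist (Icc a b) g f ≤ K * r}).ncard := by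
    rw [← Set.ncard_coe_finset]
    apply Set.ncard_le_ncard
    · intro g hg
      obtain ⟨g1, g2⟩ := Finset.mem_filter.1 (Finset.mem_coe.1 hg)
      refine ⟨Finset.mem_coe.2 g1, ?_⟩
      refine (c2_le_dd hK h (hF g1) (hF hf) ha').trans ?_
      rw [dd_comm]
      gcongr
    · exact F.finite_toSet.subset (fun g hg => hg.1)
  have h3 : (K * r / δ)^ζ ≤ K * (r / δ)^ζ := by
    rw [mul_div_assoc, Real.mul_rpow (by linarith) (div_nonneg (by linarith) hδ.le)]
    have : K^ζ ≤ K := by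
      calc K^ζ ≤ K^(1:ℝ) := Real.rpow_le_rpow_of_exponent_le hK hζ
        _ = K := Real.rpow_one _
    have h0 : 0 ≤ (r / δ)^ζ := Real.rpow_nonneg (div_nonneg (by linarith) hδ.le) _
    gcongr
  have h4 : 0 ≤ δ^(-ε) := Real.rpow_nonneg hδ.le _
  calc ((F.filter (fun g => dd a' f g ≤ r)).card : ℝ) ≤ _ := Nat.cast_le.2 h2
    _ ≤ _ := h1
    _ ≤ δ^(-ε) * (K * (r / δ)^ζ) := by gcongr
    _ = _ := by ring

lemma cardF_of {a b K δ ε ζ : ℝ} (hK : 1 ≤ K) (hδ : 0 < δ) (hδ1 : δ ≤ 1) (hε : 0 < ε) (hζ : ζ ≤ 1)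
    {𝓕 : Set (ℝ → ℝ)} (h : CinematicFamily (Icc a b) K 𝓕)
    {F : Finset (ℝ → ℝ)} (hF : ↑F ⊆ 𝓕)
    (hN : ∀ g : ℝ → ℝ, ContDiff ℝ 2 g → ∀ r : ℝ, δ ≤ r →
        (({f ∈ (F : Set (ℝ → ℝ)) | c2dist (Icc a b) f g ≤ r}).ncard : ℝ) ≤ δ ^ (-ε) * (r / δ) ^ ζ) :
    Real.log F.card ≤ Real.log K + (1 + ε) * (-Real.log δ) := by
  have hlδ : Real.log δ ≤ 0 := Real.log_nonpos hδ.le hδ1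
  have hlK : 0 ≤ Real.log K := Real.log_nonneg hK
  rcases F.eq_empty_or_nonempty with rfl | ⟨f, hf⟩
  · simp only [Finset.card_empty, Nat.cast_zero, Real.log_zero]
    nlinarith
  have h1 := hN f (h.1 f (hF hf)) K (by linarith)
  have h2 : {g ∈ (F : Set (ℝ → ℝ)) | c2dist (Icc a b) g f ≤ K} = (F : Set (ℝ → ℝ)) := by
    ext g
    exact ⟨fun hg => hg.1, fun hg => ⟨hg, h.2.1 g (hF hg) f (hF hf)⟩⟩
  rw [h2, Set.ncard_coe_finset] at h1
  have hc : (0:ℝ) < F.card := by exact_mod_cast Finset.card_pos.2 ⟨f, hf⟩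
  have h3 := Real.log_le_log hc h1
  have hKδ : 0 < K / δ := div_pos (by linarith) hδ
  rw [Real.log_mul (Real.rpow_pos_of_pos hδ _).ne' (Real.rpow_pos_of_pos hKδ _).ne', Real.log_rpow hδ,
    Real.log_rpow hKδ, Real.log_div (by linarith) hδ.ne'] at h3
  have : ζ * (Real.log K - Real.log δ) ≤ 1 * (Real.log K - Real.log δ) := by
    apply mul_le_mul_of_nonneg_right hζ; linarith
  linarith

lemma nu_of {δ α C a b : ℝ} {E : Set (ℝ × ℝ)} {A : Set ℝ} (hδ : 0 < δ) (hα : 0 < α) (hC : 0 ≤ C)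
    (hEm : MeasurableSet E) (hEA : ∀ p ∈ E, p.1 ∈ A)
    (hA : ∀ u v : ℝ, u ≤ v → Icc u v ⊆ Icc (0:ℝ) 1 → volume (A ∩ Icc u v) ≤ ENNReal.ofReal (C * (v - u) ^ α))
    (hab : Icc a b ⊆ Icc (0:ℝ) 1) :
    NU (volume.restrict (E ∩ {p : ℝ × ℝ | p.1 ∈ Icc a b})) a b δ α (2 * δ * C) := by
  have hm : MeasurableSet {p : ℝ × ℝ | p.1 ∈ Icc a b} := measurable_fst measurableSet_Icc
  refine ⟨by positivity, ?_, ?_⟩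
  · refine (ae_restrict_mem (hEm.inter hm)).mono (fun p hp => hp.2)
  · intro f hf X hX r hr hd
    rw [Measure.restrict_apply' (hEm.inter hm)]
    refine le_trans (measure_mono ?_) (tube_meas hδ hα hC hEA hA hab hf hX hr hd)
    rintro p ⟨h1, h2, _⟩
    exact ⟨h2, h1⟩

lemma levels_of {K δ : ℝ} (hK : 1 ≤ K) (hδ : 0 < δ) (hδ1 : δ ≤ 1) :
    ∃ L1 M2 : ℕ, 1 ≤ L1 ∧ K ≤ 4^L1 * δ ∧ K * 2^L1 ≤ 2^M2 ∧ (4:ℝ)^L1 ≤ 4 * K / δ ∧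
      (L1:ℝ) ≤ Real.log K + (-Real.log δ) + 1 ∧ (M2:ℝ) + 1 ≤ 4 + 4 * Real.log K + 2 * (-Real.log δ) := by
  have hK0 : 0 < K := by linarith
  have h1 : 1 ≤ K / δ := by rw [le_div_iff₀ hδ]; linarith
  obtain ⟨n, hn1, hn2⟩ := exists_nat_pow_near h1 (by norm_num : (1:ℝ) < 4)
  have h2 : 1 ≤ K * 2^(n+1) := one_le_mul_of_one_le_of_one_le hK (one_le_pow₀ (by norm_num))
  obtain ⟨m, hm1, hm2⟩ := exists_nat_pow_near h2 (by norm_num : (1:ℝ) < 2)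
  have hlK : 0 ≤ Real.log K := Real.log_nonneg hK
  have hlδ : Real.log δ ≤ 0 := Real.log_nonpos hδ.le hδ1
  have hl2 : (1:ℝ)/2 ≤ Real.log 2 := by linarith [Real.log_two_gt_d9]
  have hl2' : Real.log 2 ≤ 1 := by linarith [Real.log_two_lt_d9]
  have hl4 : (1:ℝ) ≤ Real.log 4 := by
    rw [show (4:ℝ) = 2^2 by norm_num, Real.log_pow]; push_cast; linarith
  have hL : (n:ℝ) ≤ Real.log K + -Real.log δ := by
    have := Real.log_le_log (by positivity) hn1
    rw [Real.log_pow, Real.log_div hK0.ne' hδ.ne'] at this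
    have hn : (0:ℝ) ≤ n := Nat.cast_nonneg n
    nlinarith
  have hM : (m:ℝ) * (1/2) ≤ Real.log K + (n + 1) * Real.log 2 := by
    have := Real.log_le_log (by positivity) hm1
    rw [Real.log_pow, Real.log_mul hK0.ne' (by positivity), Real.log_pow] at this
    push_cast at this
    have hn : (0:ℝ) ≤ m := Nat.cast_nonneg m
    nlinarith
  have hM' : (m:ℝ) * (1/2) * 2 ≤ 2 * Real.log K + 2 * ((n + 1) * 1) := by
    have hn : (0:ℝ) ≤ n := Nat.cast_nonneg n
    nlinarith
  refine ⟨n+1, m+1, by omega, ?_, hm2.le, ?_, ?_, ?_⟩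
  · rw [div_lt_iff₀ hδ] at hn2; exact hn2.le
  · rw [pow_succ, mul_div_assoc]; linarith
  · push_cast; linarith
  · push_cast; linarith

lemma final_num {K δ ε α ζ q Λ n Y M : ℝ} (hK : 1 ≤ K) (hδ : 0 < δ) (hδ1 : δ ≤ 1) (hαζ : α ≤ ζ) (hζ : ζ ≤ 1) (hα : 0 < α) (hn : 0 ≤ n)
    (hM : 0 ≤ M) (hq : 0 ≤ q) (hΛ : 0 ≤ Λ) (hY0 : 0 ≤ Y) (hY : Y ≤ 4 * K / δ)
    (hbig : M * 10^18 * q^3 * 2 * K * (4 * K) * Λ^11 ≤ δ^(-(3/2 * ε))) :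
    M * (10^18 * q^3 * Λ^11 * (n * (2 * δ * (δ^(-ε) * δ^(1-α))) * √(K * δ^(-ε)) * Y^((ζ - α)/2))) ≤
      δ^(2 - α/2 - ζ/2 - 3 * ε) * n := by
  have hK0 : 0 < K := by linarith
  have h1 : Y^((ζ-α)/2) ≤ 4 * K * δ^(-((ζ-α)/2)) := by
    calc Y^((ζ-α)/2) ≤ (4 * K / δ)^((ζ-α)/2) := Real.rpow_le_rpow hY0 hY (by linarith)
      _ = (4 * K)^((ζ-α)/2) * δ^(-((ζ-α)/2)) := by
          rw [Real.div_rpow (by linarith) hδ.le, Real.rpow_neg hδ.le]; rfl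
      _ ≤ 4 * K * δ^(-((ζ-α)/2)) := by
          have : (4 * K)^((ζ-α)/2) ≤ (4*K)^(1:ℝ) := Real.rpow_le_rpow_of_exponent_le (by linarith) (by linarith)
          rw [Real.rpow_one] at this
          have := Real.rpow_nonneg hδ.le (-((ζ-α)/2))
          gcongr
  have h2 : √(K * δ^(-ε)) ≤ K * δ^(-ε/2) := by
    rw [Real.sqrt_mul hK0.le]
    have e : √(δ^(-ε)) = δ^(-ε/2) := by
      rw [Real.sqrt_eq_rpow, ← Real.rpow_mul hδ.le]; ring_nf
    rw [e]
    have : √K ≤ K := by rw [Real.sqrt_le_left hK0.le]; nlinarith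
    have := Real.rpow_nonneg hδ.le (-ε/2)
    gcongr
  have h3 : δ * (δ^(-ε) * δ^(1-α)) * δ^(-ε/2) * δ^(-((ζ-α)/2)) = δ^(2 - α/2 - ζ/2 - 3/2 * ε) := by
    nth_rw 1 [← Real.rpow_one δ]
    rw [← Real.rpow_add hδ, ← Real.rpow_add hδ, ← Real.rpow_add hδ, ← Real.rpow_add hδ]
    congr 1; ring
  have h4 : δ^(2 - α/2 - ζ/2 - 3 * ε) = δ^(-(3/2*ε)) * δ^(2 - α/2 - ζ/2 - 3/2 * ε) := by
    rw [← Real.rpow_add hδ]; congr 1; ring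
  have p1 := Real.rpow_nonneg hδ.le (-ε)
  have p2 := Real.rpow_nonneg hδ.le (1-α)
  have p3 : 0 ≤ δ^(2 - α/2 - ζ/2 - 3/2 * ε) := Real.rpow_nonneg hδ.le _
  have p4 := Real.rpow_nonneg hδ.le (-ε/2)
  have p5 : 0 ≤ Y^((ζ-α)/2) := Real.rpow_nonneg hY0 _
  calc _ ≤ M * (10^18 * q^3 * Λ^11 * (n * (2 * δ * (δ^(-ε) * δ^(1-α))) * (K * δ^(-ε/2)) * (4 * K * δ^(-((ζ-α)/2))))) := by
        gcongr
    _ = (M * 10^18 * q^3 * 2 * K * (4 * K) * Λ^11) * (δ * (δ^(-ε) * δ^(1-α)) * δ^(-ε/2) * δ^(-((ζ-α)/2))) * n := by ring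
    _ = (M * 10^18 * q^3 * 2 * K * (4 * K) * Λ^11) * δ^(2 - α/2 - ζ/2 - 3/2 * ε) * n := by rw [h3]
    _ ≤ δ^(-(3/2 * ε)) * δ^(2 - α/2 - ζ/2 - 3/2 * ε) * n := by gcongr
    _ = _ := by rw [h4]

lemma delta0 {B k ε : ℝ} (hε : 0 < ε) (hk : 0 ≤ k) : ∃ δ₀ : ℝ, 0 < δ₀ ∧ δ₀ ≤ 1 ∧ ∀ δ, 0 < δ → δ ≤ δ₀ →
    B * (4 + 4 * k + (3 + 2 * ε) * (-Real.log δ))^11 ≤ δ^(-(3/2 * ε)) := by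
  set A := 7 + 4 * k + 2 * ε with hA
  have hA0 : 0 < A := by positivity
  have h := isLittleO_pow_exp_pos_mul_atTop 11 (b := 3/2 * ε) (by positivity)
  have hcpos : 0 < 1 / ((|B| + 1) * A^11) := by positivity
  have h2 := h.def hcpos
  obtain ⟨X0, hX0⟩ := Filter.eventually_atTop.1 h2
  refine ⟨Real.exp (-(max X0 1)), Real.exp_pos _, by rw [Real.exp_le_one_iff]; linarith [le_max_right X0 1], ?_⟩
  intro δ hδ hle
  set x := -Real.log δ with hx
  have hx1 : max X0 1 ≤ x := by
    have := Real.log_le_log hδ hle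
    rw [Real.log_exp] at this
    linarith
  have hxX := hX0 x ((le_max_left _ _).trans hx1)
  have hx1' : 1 ≤ x := (le_max_right _ _).trans hx1
  have e : δ^(-(3/2 * ε)) = Real.exp (3/2 * ε * x) := by
    rw [Real.rpow_def_of_pos hδ, hx]; congr 1; ring
  rw [e]
  rw [Real.norm_of_nonneg (by positivity), Real.norm_of_nonneg (Real.exp_pos _).le] at hxX
  have h3 : 4 + 4 * k + (3 + 2 * ε) * x ≤ A * x := by
    have : (4 + 4 * k) * 1 ≤ (4 + 4 * k) * x := by gcongr
    rw [hA]; linarith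
  have h4 : 0 ≤ 4 + 4 * k + (3 + 2 * ε) * x := by positivity
  calc B * (4 + 4 * k + (3 + 2 * ε) * x)^11 ≤ (|B| + 1) * (A * x)^11 := by
        have : B ≤ |B| + 1 := (le_abs_self B).trans (by linarith)
        gcongr
    _ = (|B| + 1) * A^11 * x^11 := by ring
    _ ≤ (|B| + 1) * A^11 * (1 / ((|B| + 1) * A^11) * Real.exp (3/2 * ε * x)) := by gcongr
    _ = _ := by field_simp
end WM

namespace WM
open scoped Classical

lemma integrand_le {a b δ : ℝ} (F : Finset (ℝ → ℝ)) (p : ℝ × ℝ) :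
    (∑ f ∈ F, (vtube (Set.Icc a b) f δ).indicator (fun _ => (1 : ℝ≥0∞)) p) ^ ((3 : ℝ)/2) ≤
      ENNReal.ofReal (((thr δ p F).card : ℝ) ^ ((3:ℝ)/2)) := by
  rw [← ENNReal.ofReal_rpow_of_nonneg (Nat.cast_nonneg _) (by norm_num)]
  apply ENNReal.rpow_le_rpow _ (by norm_num)
  rw [ENNReal.ofReal_natCast]
  unfold thr
  rw [← Finset.sum_boole]
  apply Finset.sum_le_sum
  intro f _
  by_cases h : p ∈ vtube (Set.Icc a b) f δ
  · rw [indicator_of_mem h, if_pos h.2]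
  · rw [indicator_of_notMem h]; exact zero_le

lemma cover {a b K x : ℝ} (hK : 1 ≤ K) (h0 : x ∈ Icc (0:ℝ) 1) (hx : x ∈ Icc a b) {M : ℕ} (hM : 1000 * K^2 + 1 ≤ M) :
    ∃ i : Fin M, x ∈ Icc (max (max a 0) ((i:ℕ) / (1000 * K^2))) (min (min b 1) (((i:ℕ) + 1) / (1000 * K^2))) := by
  have hp : 0 < 1000 * K^2 := by positivity
  have h1 : 0 ≤ x * (1000 * K^2) := mul_nonneg h0.1 hp.le
  have h2 := Nat.floor_le h1
  have h3 := Nat.lt_floor_add_one (x * (1000 * K^2))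
  have h4 : ⌊x * (1000 * K^2)⌋₊ < M := by
    have : (⌊x * (1000 * K^2)⌋₊ : ℝ) < M := by nlinarith [h0.2]
    exact_mod_cast this
  refine ⟨⟨_, h4⟩, ?_, ?_⟩
  · refine max_le (max_le hx.1 h0.1) ?_
    rw [div_le_iff₀ hp]; exact h2
  · refine le_min (le_min hx.2 h0.2) ?_
    rw [le_div_iff₀ hp]; exact h3.le

lemma lam1 {L k x ε n : ℝ} (hL : L ≤ k + x + 1) (hn : n ≤ k + (1 + ε) * x) (hk : 0 ≤ k) (hx : 0 ≤ x) :
    L + 3 + 2 * n ≤ 4 + 4 * k + (3 + 2 * ε) * x := by linarith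

lemma lam2 {k x ε m : ℝ} (hM : m + 1 ≤ 4 + 4 * k + 2 * x) (hx : 0 ≤ x) (h : 0 ≤ ε * x) :
    m + 1 ≤ 4 + 4 * k + (3 + 2 * ε) * x := by linarith

lemma lam0 {k x ε : ℝ} (hk : 0 ≤ k) (hx : 0 ≤ x) (h : 0 ≤ ε * x) :
    0 ≤ 4 + 4 * k + (3 + 2 * ε) * x := by linarith
end WM

open WM

theorem wolff_maximal_cinematic_short_curve (D : ℝ) (hD : 1 ≤ D) :
    ∃ C₀ : ℝ, 0 < C₀ ∧
    ∀ ε K : ℝ, 0 < ε → 1 ≤ K →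
    ∃ δ₀ : ℝ, 0 < δ₀ ∧
    ∀ α ζ δ : ℝ, 0 < α → α ≤ ζ → ζ ≤ 1 → 0 < δ → δ ≤ δ₀ →
    ∀ a b : ℝ, a ≤ b →
    ∀ 𝓕 : Set (ℝ → ℝ), CinematicFamily (Set.Icc a b) K 𝓕 →
      DoublingFamily (Set.Icc a b) D 𝓕 →
    ∀ E : Set (ℝ × ℝ), IsQuasiProduct δ α α (δ ^ (-ε)) E →
    ∀ F : Finset (ℝ → ℝ), ↑F ⊆ 𝓕 →
      (∀ g : ℝ → ℝ, ContDiff ℝ 2 g → ∀ r : ℝ, δ ≤ r →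
        (({f ∈ (F : Set (ℝ → ℝ)) | c2dist (Set.Icc a b) f g ≤ r}).ncard : ℝ)
          ≤ δ ^ (-ε) * (r / δ) ^ ζ) →
      ∫⁻ p in E ∩ {p : ℝ × ℝ | p.1 ∈ subIcc (1/16) a b},
          (∑ f ∈ F, (vtube (Set.Icc a b) f δ).indicator (fun _ => (1 : ℝ≥0∞)) p)
            ^ ((3 : ℝ)/2)
        ≤ ENNReal.ofReal (δ ^ (2 - α/2 - ζ/2 - C₀ * ε) * F.card) := by
  refine ⟨3, by norm_num, fun ε K hε hK => ?_⟩
  obtain ⟨q, hq⟩ := exists_nat_ge (10240 * K^2)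
  obtain ⟨M, hM⟩ := exists_nat_ge (1000 * K^2 + 1)
  have hlK : 0 ≤ Real.log K := Real.log_nonneg hK
  obtain ⟨δ₀, h0, h01, hbig⟩ := delta0 (B := M * 10^18 * (q:ℝ)^3 * 2 * K * (4 * K)) hε hlK
  refine ⟨δ₀, h0, fun α ζ δ hα hαζ hζ hδ hδ0 a b hab 𝓕 hcin _ E hE F hF hN => ?_⟩
  have hδ1 : δ ≤ 1 := hδ0.trans h01
  have hbig := hbig δ hδ hδ0
  obtain ⟨hEm, A, B, ⟨hA01, _, hA⟩, _, hEeq⟩ := hE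
  have hEA : ∀ p ∈ E, p.1 ∈ A := fun p hp => by rw [hEeq] at hp; exact hp.1
  obtain ⟨L1, M2, hL0, hL1, hM2, hL4, hLb, hMb⟩ := levels_of hK hδ hδ1
  have hcard := cardF_of hK hδ hδ1 hε hζ hcin hF hN
  have hx0 : 0 ≤ -Real.log δ := by linarith [Real.log_nonpos hδ.le hδ1]
  have hεx : 0 ≤ ε * -Real.log δ := mul_nonneg hε.le hx0
  set Λ := 4 + 4 * Real.log K + (3 + 2 * ε) * (-Real.log δ) with hΛ
  have hΛ1 : (L1:ℝ) + 3 + 2 * Real.log F.card ≤ Λ := lam1 hLb hcard hlK hx0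
  have hΛ2 : (M2:ℝ) + 1 ≤ Λ := lam2 hMb hx0 hεx
  have hΛ0 : 0 ≤ Λ := lam0 hlK hx0 hεx
  have hC : 0 ≤ δ^(-ε) * δ^(1-α) := mul_nonneg (Real.rpow_nonneg hδ.le _) (Real.rpow_nonneg hδ.le _)
  have hQ0 : 0 ≤ K * δ^(-ε) := mul_nonneg (by linarith) (Real.rpow_nonneg hδ.le _)
  set T := 10^18 * (q:ℝ)^3 * Λ^11 * (F.card * (2 * δ * (δ^(-ε) * δ^(1-α))) * √(K * δ^(-ε)) * (4^L1 : ℝ)^((ζ - α)/2)) with hT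
  set P : Fin M → Set (ℝ × ℝ) := fun i => E ∩ {p : ℝ × ℝ | p.1 ∈
    Set.Icc (max (max a 0) ((i:ℕ) / (1000 * K^2))) (min (min b 1) (((i:ℕ) + 1) / (1000 * K^2)))} with hP
  have hp : 0 < 1000 * K^2 := by positivity
  have hpiece : ∀ i : Fin M, ∫⁻ p in P i, (∑ f ∈ F, (vtube (Set.Icc a b) f δ).indicator (fun _ => (1 : ℝ≥0∞)) p)
            ^ ((3 : ℝ)/2) ≤ ENNReal.ofReal T := by
    intro i
    refine (lintegral_mono (fun p => integrand_le F p)).trans ?_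
    simp only [hP]
    set a' := max (max a 0) (((i:ℕ):ℝ) / (1000 * K^2)) with ha'
    set b' := min (min b 1) ((((i:ℕ):ℝ) + 1) / (1000 * K^2)) with hb'
    rcases lt_or_ge b' a' with hlt | hle
    · have : E ∩ {p : ℝ × ℝ | p.1 ∈ Set.Icc a' b'} = ∅ := by
        rw [Set.Icc_eq_empty (not_le.2 hlt)]; simp
      rw [this]; simp
    have e1 : a ≤ a' := (le_max_left _ _).trans (le_max_left _ _)
    have e2 : 0 ≤ a' := (le_max_right _ _).trans (le_max_left _ _)
    have e3 : b' ≤ b := (min_le_left _ _).trans (min_le_left _ _)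
    have e4 : b' ≤ 1 := (min_le_left _ _).trans (min_le_right _ _)
    have hlen : 1000 * K^2 * (b' - a') ≤ 1 := by
      have g1 : ((i:ℕ):ℝ) / (1000 * K^2) ≤ a' := le_max_right _ _
      have g2 : b' ≤ (((i:ℕ):ℝ) + 1) / (1000 * K^2) := min_le_right _ _
      rw [div_le_iff₀ hp] at g1
      rw [le_div_iff₀ hp] at g2
      linarith
    have G := good_of hK hcin hF hle (Set.Icc_subset_Icc e1 e3) hlen
    have ha'm : a' ∈ Set.Icc a b := ⟨e1, hle.trans e3⟩
    exact piece (nu_of hδ hα hC hEm hEA hA (Set.Icc_subset_Icc e2 e4)) G hδ hα hαζ hζ hL0 hL1 hM2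
      (fun f hf g hg => (dd_le_c2 (hcin.1 f (hF hf)) (hcin.1 g (hF hg)) ha'm).trans (hcin.2.1 f (hF hf) g (hF hg))) hQ0
      (nonconc_of hK hδ (by linarith) hζ hcin hF ha'm hN) hq hΛ1 hΛ2
  have hsub : E ∩ {p : ℝ × ℝ | p.1 ∈ subIcc (1/16) a b} ⊆ ⋃ i, P i := by
    rintro p ⟨hpE, hps⟩
    have hps' : p.1 ∈ Set.Icc a b := ⟨by have := hps.1; linarith, by have := hps.2; linarith⟩
    obtain ⟨i, hi⟩ := cover hK (hA01 (hEA p hpE)) hps' hM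
    exact Set.mem_iUnion.2 ⟨i, hpE, hi⟩
  refine (lintegral_mono_set hsub).trans ((lintegral_iUnion_le _ _).trans ?_)
  rw [tsum_fintype]
  refine (Finset.sum_le_card_nsmul _ _ _ (fun i _ => hpiece i)).trans ?_
  rw [Finset.card_univ, Fintype.card_fin, nsmul_eq_mul, ← ENNReal.ofReal_natCast,
    ← ENNReal.ofReal_mul (Nat.cast_nonneg _)]
  apply ENNReal.ofReal_le_ofReal
  exact final_num hK hδ hδ1 hαζ hζ hα (Nat.cast_nonneg _) (Nat.cast_nonneg _) (Nat.cast_nonneg _) hΛ0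
    (by positivity) hL4 hbig
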